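/- Let (ΛV,d) = (Λ(x₁,…,x_n, y₁,…,y_m), d) be a pure coformal elliptic minimal Sullivan model with n = dim V^{even} = 2. Then for any basis B of V^{even}, L(ΛV,B) = 2, and consequently TC_r(ΛV) = r·cat(ΛV) + χ_π(ΛV) = (r−1)·m + 2 for every integer r ≥ 2. -/

import Mathlib

noncomputable section

namespace RHT

/-- A graded-commutative differential graded algebra over `ℚ`, graded by `ℕ`,
with a degree `+1` differential satisfying the graded Leibniz rule. -/
class GCDGA (A : Type) extends Ring A, Algebra ℚ A where
  grading : ℕ → Submodule ℚ A
  gradedAlgebra : GradedAlgebra grading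
  grading_comm : ∀ (i j : ℕ) (a b : A), a ∈ grading i → b ∈ grading j →
    a * b = ((-1 : ℚ) ^ (i * j)) • (b * a)
  d : A →ₗ[ℚ] A
  d_sq : ∀ a : A, d (d a) = 0
  d_grading : ∀ (i : ℕ) (a : A), a ∈ grading i → d a ∈ grading (i + 1)
  d_leibniz : ∀ (i : ℕ) (a b : A), a ∈ grading i →
    d (a * b) = d a * b + ((-1 : ℚ) ^ i) • (a * d b)

/-- The grading of a gcdga, with the algebra explicit. -/
def Gr (A : Type) [GCDGA A] : ℕ → Submodule ℚ A := GCDGA.grading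

/-- The differential of a gcdga, with the algebra explicit. -/
def Dd (A : Type) [GCDGA A] : A →ₗ[ℚ] A := GCDGA.d

/-- Morphisms of cdga's: `ℚ`-algebra morphisms preserving the grading and
commuting with the differentials. -/
def IsDGAHom {A B : Type} [GCDGA A] [GCDGA B] (f : A →ₐ[ℚ] B) : Prop :=
  (∀ a : A, f (Dd A a) = Dd B (f a)) ∧
    ∀ (i : ℕ) (a : A), a ∈ Gr A i → f a ∈ Gr B i

theorem isDGAHom_id (A : Type) [GCDGA A] : IsDGAHom (AlgHom.id ℚ A) :=
  ⟨fun _ => rfl, fun _ _ h => h⟩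

/-- A quasi-isomorphism: a morphism inducing an isomorphism in cohomology
(stated elementwise: surjectivity and injectivity on cohomology classes). -/
def QuasiIso {A B : Type} [GCDGA A] [GCDGA B] (f : A →ₐ[ℚ] B) : Prop :=
  (∀ b : B, Dd B b = 0 → ∃ a : A, Dd A a = 0 ∧ ∃ c : B, f a - b = Dd B c) ∧
    ∀ a : A, Dd A a = 0 → (∃ c : B, f a = Dd B c) → ∃ e : A, a = Dd A e

/-- Injectivity in cohomology, stated elementwise. -/
def CohomologyInjective {A B : Type} [GCDGA A] [GCDGA B] (f : A →ₐ[ℚ] B) : Prop :=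
  ∀ a : A, Dd A a = 0 → (∃ c : B, f a = Dd B c) → ∃ e : A, a = Dd A e

/-- A homotopy retraction for a morphism `ρ` of cdga's: a factorization of `ρ`
through a surjective quasi-isomorphism `q : C → Q` (playing the role of the
relative Sullivan model of `ρ`) together with a cdga retraction `τ`. -/
structure HtpyRetraction {T Q : Type} [GCDGA T] [GCDGA Q] (ρ : T →ₐ[ℚ] Q) where
  C : Type
  [instC : GCDGA C]
  j : T →ₐ[ℚ] C
  q : C →ₐ[ℚ] Q
  τ : C →ₐ[ℚ] T
  j_dga : IsDGAHom j
  q_dga : IsDGAHom q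
  τ_dga : IsDGAHom τ
  q_surj : Function.Surjective q
  q_quasi : QuasiIso q
  hqj : q.comp j = ρ
  hτj : τ.comp j = AlgHom.id ℚ T

attribute [instance] HtpyRetraction.instC

/-- A homotopy retraction of `T`-modules for a morphism `ρ : T → Q` of cdga's:
as above, but the retraction `τ` is only required to be a morphism of
differential `T`-modules. -/
structure ModHtpyRetraction {T Q : Type} [GCDGA T] [GCDGA Q] (ρ : T →ₐ[ℚ] Q) where
  C : Type
  [instC : GCDGA C]
  j : T →ₐ[ℚ] C
  q : C →ₐ[ℚ] Q
  τ : C →ₗ[ℚ] T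
  j_dga : IsDGAHom j
  q_dga : IsDGAHom q
  q_surj : Function.Surjective q
  q_quasi : QuasiIso q
  hqj : q.comp j = ρ
  τ_chain : ∀ c : C, τ (Dd C c) = Dd T (τ c)
  τ_mod : ∀ (t : T) (c : C), τ (j t * c) = t * τ c
  hτj : ∀ t : T, τ (j t) = t

attribute [instance] ModHtpyRetraction.instC

/-- `T`, together with the morphisms `ι j : A → T`, is the `r`-fold (graded)
tensor power of `A`, characterized as the `r`-fold coproduct of copies of `A`
in the category of cdga's. -/
structure TensorPower (A : Type) [GCDGA A] (r : ℕ) (T : Type) [GCDGA T] where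
  ι : Fin r → (A →ₐ[ℚ] T)
  ι_dga : ∀ j, IsDGAHom (ι j)
  coprod : ∀ (B : Type) [GCDGA B] (f : Fin r → (A →ₐ[ℚ] B)), (∀ j, IsDGAHom (f j)) →
    ∃! g : T →ₐ[ℚ] B, IsDGAHom g ∧ ∀ j, g.comp (ι j) = f j

/-- The `r`-fold multiplication morphism `μ : A^{⊗ r} → A`, i.e. the fold map
of the coproduct. -/
noncomputable def TensorPower.mu {A : Type} [GCDGA A] {r : ℕ} {T : Type} [GCDGA T]
    (TP : TensorPower A r T) : T →ₐ[ℚ] A :=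
  (TP.coprod A (fun _ => AlgHom.id ℚ A) (fun _ => isDGAHom_id A)).choose

/-- The kernel of the `r`-fold multiplication, as a `ℚ`-submodule (ideal). -/
noncomputable def TensorPower.kerMu {A : Type} [GCDGA A] {r : ℕ} {T : Type} [GCDGA T]
    (TP : TensorPower A r T) : Submodule ℚ T :=
  LinearMap.ker TP.mu.toLinearMap

/-- A witness that `TC_r(ΛV) ≤ n`: the projection
`ρ^r_n : (ΛV)^{⊗ r} → (ΛV)^{⊗ r}/(ker μ^r)^{n+1}` admits a homotopy retraction
of cdga's.  The quotient is encoded as a surjective cdga morphism with kernel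
`(ker μ^r)^{n+1}`. -/
structure TCWitness (A : Type) [GCDGA A] (r n : ℕ) where
  T : Type
  [instT : GCDGA T]
  TP : TensorPower A r T
  Q : Type
  [instQ : GCDGA Q]
  ρ : T →ₐ[ℚ] Q
  ρ_dga : IsDGAHom ρ
  ρ_surj : Function.Surjective ρ
  ρ_ker : LinearMap.ker ρ.toLinearMap = TP.kerMu ^ (n + 1)
  retr : Nonempty (HtpyRetraction ρ)

/-- The higher rational topological complexity `TC_r`. -/
noncomputable def TC (A : Type) [GCDGA A] (r : ℕ) : ℕ :=
  sInf {n | Nonempty (TCWitness A r n)}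

/-- A witness that `MTC_r(ΛV) ≤ n`: `ρ^r_n` admits a homotopy retraction of
`(ΛV)^{⊗ r}`-modules. -/
structure MTCWitness (A : Type) [GCDGA A] (r n : ℕ) where
  T : Type
  [instT : GCDGA T]
  TP : TensorPower A r T
  Q : Type
  [instQ : GCDGA Q]
  ρ : T →ₐ[ℚ] Q
  ρ_dga : IsDGAHom ρ
  ρ_surj : Function.Surjective ρ
  ρ_ker : LinearMap.ker ρ.toLinearMap = TP.kerMu ^ (n + 1)
  retr : Nonempty (ModHtpyRetraction ρ)

/-- The higher module rational topological complexity `MTC_r`. -/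
noncomputable def MTC (A : Type) [GCDGA A] (r : ℕ) : ℕ :=
  sInf {n | Nonempty (MTCWitness A r n)}

/-- A witness that `HTC_r(ΛV) ≤ n`: `ρ^r_n` is injective in cohomology. -/
structure HTCWitness (A : Type) [GCDGA A] (r n : ℕ) where
  T : Type
  [instT : GCDGA T]
  TP : TensorPower A r T
  Q : Type
  [instQ : GCDGA Q]
  ρ : T →ₐ[ℚ] Q
  ρ_dga : IsDGAHom ρ
  ρ_surj : Function.Surjective ρ
  ρ_ker : LinearMap.ker ρ.toLinearMap = TP.kerMu ^ (n + 1)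
  inj : CohomologyInjective ρ

/-- The invariant `HTC_r`. -/
noncomputable def HTC (A : Type) [GCDGA A] (r : ℕ) : ℕ :=
  sInf {n | Nonempty (HTCWitness A r n)}

/-- A minimal Sullivan model structure on a gcdga `A`: a simply-connected
graded space of generators `V` of finite type, the word-length grading `lam`
(`lam k` is `Λ^k V`), freeness of `A` over `V` as a graded-commutative
algebra (expressed by the universal property), and minimality `d V ⊆ Λ^{≥2}V`. -/
structure MinimalSullivan (A : Type) [GCDGA A] where
  V : ℕ → Submodule ℚ A
  lam : ℕ → Submodule ℚ A
  V_le : ∀ n, V n ≤ Gr A n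
  V0 : V 0 = ⊥
  V1 : V 1 = ⊥
  V_fin : ∀ n, FiniteDimensional ℚ (V n)
  lam_zero : lam 0 = 1
  lam_one : lam 1 = ⨆ n, V n
  lam_mul : ∀ p q, lam p * lam q ≤ lam (p + q)
  lam_internal : DirectSum.IsInternal lam
  minimal : ∀ (n : ℕ), ∀ v ∈ V n, Dd A v ∈ ⨆ k, ⨆ (_ : 2 ≤ k), lam k
  free : ∀ (B : Type) [GCDGA B] (f : ∀ n, V n →ₗ[ℚ] B),
    (∀ (n : ℕ) (v : V n), f n v ∈ Gr B n) →
    ∃! g : A →ₐ[ℚ] B, (∀ (i : ℕ) (a : A), a ∈ Gr A i → g a ∈ Gr B i) ∧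
      ∀ (n : ℕ) (v : V n), g (v : A) = f n v

namespace MinimalSullivan

variable {A : Type} [GCDGA A] (S : MinimalSullivan A)

/-- The even part of the space of generators. -/
def Veven : Submodule ℚ A := ⨆ n, S.V (2 * n)

/-- The odd part of the space of generators. -/
def Vodd : Submodule ℚ A := ⨆ n, S.V (2 * n + 1)

/-- The homotopy characteristic `χ_π = dim V^even - dim V^odd`. -/
noncomputable def chiPi : ℤ :=
  (Module.finrank ℚ S.Veven : ℤ) - (Module.finrank ℚ S.Vodd : ℤ)

/-- Purity: `d V^even = 0` and `d V^odd ⊆ Λ V^even`. -/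
def Pure : Prop :=
  (∀ a ∈ S.Veven, Dd A a = 0) ∧
    ∀ a ∈ S.Vodd, Dd A a ∈ Algebra.adjoin ℚ (S.Veven : Set A)

/-- Coformality: the differential is quadratic, `d V ⊆ Λ² V`. -/
def Coformal : Prop := ∀ (n : ℕ), ∀ v ∈ S.V n, Dd A v ∈ S.lam 2

/-- Constant length `l` of the differential: `d V ⊆ Λ^l V`. -/
def ConstantLength (l : ℕ) : Prop := ∀ (n : ℕ), ∀ v ∈ S.V n, Dd A v ∈ S.lam l

end MinimalSullivan

/-- The cohomology of a gcdga, as a `ℚ`-module. -/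
def CohClasses (A : Type) [GCDGA A] :=
  LinearMap.ker (Dd A) ⧸ ((LinearMap.range (Dd A)).comap (LinearMap.ker (Dd A)).subtype)

instance (A : Type) [GCDGA A] : AddCommGroup (CohClasses A) := by
  unfold CohClasses; infer_instance

instance (A : Type) [GCDGA A] : Module ℚ (CohClasses A) := by
  unfold CohClasses; infer_instance

/-- Ellipticity: both the generating space `V` and the cohomology are
finite-dimensional. -/
def Elliptic (A : Type) [GCDGA A] (S : MinimalSullivan A) : Prop :=
  FiniteDimensional ℚ (⨆ n, S.V n : Submodule ℚ A) ∧ FiniteDimensional ℚ (CohClasses A)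

/-- A witness of formality: a quasi-isomorphism to a gcdga with zero
differential. -/
structure FormalityWitness (A : Type) [GCDGA A] where
  B : Type
  [instB : GCDGA B]
  hd : Dd B = 0
  ψ : A →ₐ[ℚ] B
  ψ_dga : IsDGAHom ψ
  ψ_quasi : QuasiIso ψ

/-- Formality of a (Sullivan) cdga. -/
def Formal (A : Type) [GCDGA A] : Prop := Nonempty (FormalityWitness A)

/-- A witness that `cat(ΛV) ≤ n`: the projection `ΛV → ΛV/Λ^{>n}V` admits a
homotopy retraction.  The quotient is encoded as a surjective cdga morphism
whose kernel is `Λ^{>n}V`. -/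
structure CatWitness (A : Type) [GCDGA A] (S : MinimalSullivan A) (n : ℕ) where
  Q : Type
  [instQ : GCDGA Q]
  π : A →ₐ[ℚ] Q
  π_dga : IsDGAHom π
  π_surj : Function.Surjective π
  π_ker : LinearMap.ker π.toLinearMap = ⨆ k, ⨆ (_ : n < k), S.lam k
  retr : Nonempty (HtpyRetraction π)

/-- The rational LS-category. -/
noncomputable def cat (A : Type) [GCDGA A] (S : MinimalSullivan A) : ℕ :=
  sInf {n | Nonempty (CatWitness A S n)}

/-- A witness that `zcl_r(ΛV) ≥ p`: `p` cocycles in `(ΛV)^{⊗ r}` whose classes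
are zero-divisors (killed by `H(μ^r)`) and whose product is not exact. -/
structure ZclWitness (A : Type) [GCDGA A] (r p : ℕ) where
  T : Type
  [instT : GCDGA T]
  TP : TensorPower A r T
  a : Fin p → T
  closed : ∀ i, Dd T (a i) = 0
  zero_div : ∀ i, ∃ b : A, TP.mu (a i) = Dd A b
  prod_ne : ∀ b : T, (List.ofFn a).prod ≠ Dd T b

/-- The `r`-zero-divisor-cuplength `zcl_r`. -/
noncomputable def zcl (A : Type) [GCDGA A] (r : ℕ) : ℕ :=
  sSup {p | Nonempty (ZclWitness A r p)}

/-- A witness that `cl_ℚ(ΛV) ≥ p`: `p` cocycles of positive degree with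
non-exact product. -/
structure ClWitness (A : Type) [GCDGA A] (p : ℕ) where
  a : Fin p → A
  pos : ∀ i, a i ∈ ⨆ k, ⨆ (_ : 0 < k), Gr A k
  closed : ∀ i, Dd A (a i) = 0
  prod_ne : ∀ b : A, (List.ofFn a).prod ≠ Dd A b

/-- The rational cuplength `cl_ℚ`. -/
noncomputable def clQ (A : Type) [GCDGA A] : ℕ :=
  sSup {p | Nonempty (ClWitness A p)}


/-- Given a pure coformal model `(ΛV,d)` with a (homogeneous) basis
`x₁,…,x_n` of `X = V^even`, the extension `ΛW_B = Λ(V ⊕ U)` obtained by adding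
odd generators `u_i` with `du_i = x_i²`, together with its bigrading by the
word length in `X` (`bl p q` encodes `Λ^p X ⊗ Λ^q (Y ⊕ U)`), for which the
quadratic differential has bidegree `(+2,−1)`. -/
structure LExt (A : Type) [GCDGA A] (S : MinimalSullivan A) {n : ℕ}
    (x : Fin n → A) (e : Fin n → ℕ) (W : Type) [GCDGA W] where
  incl : A →ₐ[ℚ] W
  incl_dga : IsDGAHom incl
  u : Fin n → W
  u_mem : ∀ i, u i ∈ Gr W (2 * e i - 1)
  hdu : ∀ i, Dd W (u i) = incl (x i) ^ 2
  free : ∀ (B : Type) [GCDGA B] (f : A →ₐ[ℚ] B), IsDGAHom f →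
    ∀ b : Fin n → B, (∀ i, b i ∈ Gr B (2 * e i - 1)) →
    (∀ i, Dd B (b i) = f (x i) ^ 2) →
    ∃! g : W →ₐ[ℚ] B, IsDGAHom g ∧ g.comp incl = f ∧ ∀ i, g (u i) = b i
  bl : ℕ → ℕ → Submodule ℚ W
  bl_internal : DirectSum.IsInternal fun pq : ℕ × ℕ => bl pq.1 pq.2
  bl_one : (1 : W) ∈ bl 0 0
  bl_mul : ∀ (p q p' q' : ℕ) (a b : W), a ∈ bl p q → b ∈ bl p' q' →
    a * b ∈ bl (p + p') (q + q')
  bl_x : ∀ i, incl (x i) ∈ bl 1 0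
  bl_y : ∀ a ∈ S.Vodd, incl a ∈ bl 0 1
  bl_u : ∀ i, u i ∈ bl 0 1
  bl_d : ∀ (p q : ℕ), ∀ a ∈ bl p q, Dd W a ∈ bl (p + 2) (q - 1)

/-- A witness that `L(ΛV, B) ≥ i`: `i` cocycles of odd `X`-word-length
(representing classes of `H_{odd,*}(ΛW_B)`) with non-exact product. -/
structure LWitness {A : Type} [GCDGA A] {S : MinimalSullivan A} {n : ℕ}
    {x : Fin n → A} {e : Fin n → ℕ} {W : Type} [GCDGA W]
    (ext : LExt A S x e W) (i : ℕ) where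
  z : Fin i → W
  closed : ∀ j, Dd W (z j) = 0
  odd_wl : ∀ j, z j ∈ ⨆ (p : ℕ) (_ : Odd p) (q : ℕ), ext.bl p q
  prod_ne : ∀ c : W, (List.ofFn z).prod ≠ Dd W c

/-- The invariant `L(ΛV, B)`. -/
noncomputable def Lval {A : Type} [GCDGA A] {S : MinimalSullivan A} {n : ℕ}
    {x : Fin n → A} {e : Fin n → ℕ} {W : Type} [GCDGA W]
    (ext : LExt A S x e W) : ℕ :=
  sSup {i | Nonempty (LWitness ext i)}

/-! ### Basic facts on graded algebras -/

instance instGradedAlgebraGr (A : Type) [GCDGA A] : GradedAlgebra (Gr A) := GCDGA.gradedAlgebra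

section Basic

variable {A : Type} [GCDGA A]

theorem iSup_Gr : (⨆ n, Gr A n) = ⊤ :=
  (DirectSum.Decomposition.isInternal (Gr A)).submodule_iSup_eq_top

theorem Gr_induction {p : A → Prop} (hom : ∀ n, ∀ a ∈ Gr A n, p a)
    (add : ∀ a b, p a → p b → p (a + b)) (a : A) : p a := by
  have ha : a ∈ ⨆ n, Gr A n := by rw [iSup_Gr]; trivial
  induction ha using Submodule.iSup_induction' with
  | mem n a ha => exact hom n a ha
  | zero => exact hom 0 0 (zero_mem _)
  | add a b _ _ ha hb => exact add a b ha hb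

theorem one_mem_Gr : (1 : A) ∈ Gr A 0 := SetLike.GradedOne.one_mem

theorem mul_mem_Gr {i j : ℕ} {a b : A} (ha : a ∈ Gr A i) (hb : b ∈ Gr A j) :
    a * b ∈ Gr A (i + j) := SetLike.GradedMul.mul_mem ha hb

/-- The homogeneous component of degree `n`. -/
def pr (A : Type) [GCDGA A] (n : ℕ) : A →ₗ[ℚ] A :=
  (Gr A n).subtype ∘ₗ DirectSum.component ℚ ℕ (fun i => Gr A i) n ∘ₗ
    (DirectSum.decomposeLinearEquiv (Gr A)).toLinearMap

theorem pr_mem (n : ℕ) (a : A) : pr A n a ∈ Gr A n := by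
  simp [pr]

theorem pr_of_mem {n : ℕ} {a : A} (h : a ∈ Gr A n) : pr A n a = a := by
  have := DirectSum.decompose_of_mem_same (Gr A) h
  exact this

theorem pr_of_ne {m n : ℕ} {a : A} (h : a ∈ Gr A n) (hmn : m ≠ n) : pr A m a = 0 := by
  have := DirectSum.decompose_of_mem_ne (Gr A) h hmn.symm
  exact this

/-- The sign involution `a ↦ (-1)^|a| a`, as a linear map. -/
def sgnL (A : Type) [GCDGA A] : A →ₗ[ℚ] A :=
  DirectSum.toModule ℚ ℕ A (fun n => ((-1 : ℚ) ^ n) • (Gr A n).subtype) ∘ₗ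
    (DirectSum.decomposeLinearEquiv (Gr A)).toLinearMap

theorem sgnL_of_mem {n : ℕ} {a : A} (h : a ∈ Gr A n) : sgnL A a = ((-1 : ℚ) ^ n) • a := by
  have : DirectSum.decompose (Gr A) a = DirectSum.lof ℚ ℕ (fun i => Gr A i) n ⟨a, h⟩ :=
    DirectSum.decompose_of_mem (Gr A) h
  simp only [sgnL, LinearMap.comp_apply, LinearEquiv.coe_coe, DirectSum.decomposeLinearEquiv_apply]
  rw [this, DirectSum.toModule_lof]
  simp

theorem sgnL_mul (a b : A) : sgnL A (a * b) = sgnL A a * sgnL A b := by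
  induction a using Gr_induction with
  | add a a' h h' => simp [add_mul, h, h']
  | hom i a ha =>
    induction b using Gr_induction with
    | add b b' h h' => simp [mul_add, h, h']
    | hom j b hb =>
      rw [sgnL_of_mem ha, sgnL_of_mem hb, sgnL_of_mem (mul_mem_Gr ha hb), smul_mul_smul_comm,
        pow_add]

/-- The sign involution `a ↦ (-1)^|a| a`. -/
def sgn (A : Type) [GCDGA A] : A →ₐ[ℚ] A :=
  AlgHom.ofLinearMap (sgnL A) (by rw [sgnL_of_mem one_mem_Gr]; simp) sgnL_mul

theorem sgn_of_mem {n : ℕ} {a : A} (h : a ∈ Gr A n) : sgn A a = ((-1 : ℚ) ^ n) • a :=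
  sgnL_of_mem h

theorem sgn_of_even {n : ℕ} {a : A} (h : a ∈ Gr A n) (hn : Even n) : sgn A a = a := by
  rw [sgn_of_mem h, hn.neg_one_pow, one_smul]

theorem sgn_of_odd {n : ℕ} {a : A} (h : a ∈ Gr A n) (hn : Odd n) : sgn A a = -a := by
  rw [sgn_of_mem h, hn.neg_one_pow, neg_one_smul]

theorem sgn_mem {n : ℕ} {a : A} (h : a ∈ Gr A n) : sgn A a ∈ Gr A n := by
  rw [sgn_of_mem h]; exact Submodule.smul_mem _ _ h

@[simp] theorem sgn_sgn (a : A) : sgn A (sgn A a) = a := by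
  induction a using Gr_induction with
  | add a b h h' => simp [h, h']
  | hom n a ha =>
    rw [sgn_of_mem (sgn_mem ha), sgn_of_mem ha, smul_smul, ← mul_pow]; simp

theorem Dd_mem {n : ℕ} {a : A} (h : a ∈ Gr A n) : Dd A a ∈ Gr A (n + 1) :=
  GCDGA.d_grading n a h

@[simp] theorem Dd_Dd (a : A) : Dd A (Dd A a) = 0 := GCDGA.d_sq a

theorem Dd_sgn (a : A) : Dd A (sgn A a) = -sgn A (Dd A a) := by
  induction a using Gr_induction with
  | add a b h h' => simp only [map_add, h, h', neg_add]
  | hom n a ha =>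
    rw [sgn_of_mem ha, sgn_of_mem (Dd_mem ha), map_smul, pow_succ]; simp

theorem sgn_Dd (a : A) : sgn A (Dd A a) = -Dd A (sgn A a) := by rw [Dd_sgn, neg_neg]

theorem Dd_mul (a b : A) : Dd A (a * b) = Dd A a * b + sgn A a * Dd A b := by
  induction a using Gr_induction with
  | add a a' h h' => simp only [add_mul, map_add, h, h']; abel
  | hom i a ha =>
    have := GCDGA.d_leibniz i a b ha
    rw [sgn_of_mem ha, smul_mul_assoc]; exact this

@[simp] theorem Dd_one : Dd A (1 : A) = 0 := by
  have := Dd_mul (1 : A) 1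
  simpa using this

@[simp] theorem Dd_algebraMap (c : ℚ) : Dd A (algebraMap ℚ A c) = 0 := by
  rw [Algebra.algebraMap_eq_smul_one, map_smul, Dd_one, smul_zero]

theorem Gr_comm {i j : ℕ} {a b : A} (ha : a ∈ Gr A i) (hb : b ∈ Gr A j) :
    a * b = ((-1 : ℚ) ^ (i * j)) • (b * a) := GCDGA.grading_comm i j a b ha hb

theorem even_comm {n : ℕ} {a : A} (h : a ∈ Gr A n) (hn : Even n) (b : A) : a * b = b * a := by
  induction b using Gr_induction with
  | add b b' h h' => rw [mul_add, add_mul, h, h']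
  | hom j b hb => rw [Gr_comm h hb, (hn.mul_right j).neg_one_pow, one_smul]

theorem odd_comm {n : ℕ} {a : A} (h : a ∈ Gr A n) (hn : Odd n) (b : A) :
    a * b = sgn A b * a := by
  induction b using Gr_induction with
  | add b b' h h' => rw [mul_add, map_add, add_mul, h, h']
  | hom j b hb =>
    rw [Gr_comm h hb, sgn_of_mem hb, smul_mul_assoc, pow_mul, hn.neg_one_pow]

theorem odd_anticomm {m n : ℕ} {a b : A} (ha : a ∈ Gr A m) (hm : Odd m) (hb : b ∈ Gr A n)
    (hn : Odd n) : a * b = -(b * a) := by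
  rw [odd_comm ha hm, sgn_of_odd hb hn, neg_mul]

theorem odd_sq {n : ℕ} {a : A} (h : a ∈ Gr A n) (hn : Odd n) : a * a = 0 := by
  have h2 : (2 : ℚ) • (a * a) = 0 := by
    rw [two_smul]; nth_rw 1 [odd_anticomm h hn h hn]; exact neg_add_cancel _
  exact (smul_eq_zero.1 h2).resolve_left two_ne_zero

/-- Maps preserving the grading. -/
def GrHom {A B : Type} [GCDGA A] [GCDGA B] (f : A →ₐ[ℚ] B) : Prop :=
  ∀ (i : ℕ) (a : A), a ∈ Gr A i → f a ∈ Gr B i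

variable {B C : Type} [GCDGA B] [GCDGA C]

theorem GrHom.sgn {f : A →ₐ[ℚ] B} (hf : GrHom f) (a : A) : f (sgn A a) = RHT.sgn B (f a) := by
  induction a using Gr_induction with
  | add a a' h h' => simp only [map_add, h, h']
  | hom i a ha => rw [sgn_of_mem ha, sgn_of_mem (hf i a ha), map_smul]

theorem GrHom.pr {f : A →ₐ[ℚ] B} (hf : GrHom f) (n : ℕ) (a : A) :
    f (pr A n a) = RHT.pr B n (f a) := by
  induction a using Gr_induction with
  | add a a' h h' => simp only [map_add, h, h']
  | hom i a ha =>
    by_cases h : n = i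
    · subst h; rw [pr_of_mem ha, pr_of_mem (hf n a ha)]
    · rw [pr_of_ne ha h, pr_of_ne (hf i a ha) h, map_zero]

theorem GrHom.comp {g : B →ₐ[ℚ] C} {f : A →ₐ[ℚ] B} (hg : GrHom g) (hf : GrHom f) :
    GrHom (g.comp f) := fun i a ha => hg i _ (hf i a ha)

theorem IsDGAHom.comp {g : B →ₐ[ℚ] C} {f : A →ₐ[ℚ] B} (hg : IsDGAHom g) (hf : IsDGAHom f) :
    IsDGAHom (g.comp f) :=
  ⟨fun a => by simp [hf.1, hg.1], fun i a ha => hg.2 i _ (hf.2 i a ha)⟩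

theorem IsDGAHom.gr {f : A →ₐ[ℚ] B} (hf : IsDGAHom f) : GrHom f := hf.2

/-- A graded morphism which commutes with the differentials on generators is a cdga morphism. -/
theorem isDGAHom_of_gens {f : A →ₐ[ℚ] B} (hf : GrHom f) {s : Set A}
    (hs : Algebra.adjoin ℚ s = ⊤) (h : ∀ a ∈ s, f (Dd A a) = Dd B (f a)) : IsDGAHom f := by
  refine ⟨fun a => ?_, hf⟩
  have ha : a ∈ Algebra.adjoin ℚ s := by rw [hs]; trivial
  induction ha using Algebra.adjoin_induction with
  | mem x hx => exact h x hx
  | algebraMap r => simp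
  | add x y _ _ hx hy => simp only [map_add, hx, hy]
  | mul x y _ _ hx hy => rw [Dd_mul, map_add, map_mul, map_mul, map_mul, Dd_mul, hx, hy, hf.sgn]

/-- Surjective morphisms with acyclic kernel. -/
def SurjAcyc (f : A →ₐ[ℚ] B) : Prop :=
  Function.Surjective f ∧ ∀ a, f a = 0 → Dd A a = 0 → ∃ k, f k = 0 ∧ Dd A k = a

theorem SurjAcyc.comp {g : B →ₐ[ℚ] C} {f : A →ₐ[ℚ] B} (hg : SurjAcyc g) (hf : SurjAcyc f)
    (hfd : IsDGAHom f) : SurjAcyc (g.comp f) := by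
  refine ⟨hg.1.comp hf.1, fun a ha hda => ?_⟩
  obtain ⟨k, hk, hdk⟩ := hg.2 (f a) ha (by rw [← hfd.1, hda, map_zero])
  obtain ⟨k', rfl⟩ := hf.1 k
  obtain ⟨l, hl, hdl⟩ := hf.2 (a - Dd A k') (by rw [map_sub, hfd.1, hdk, sub_self])
    (by rw [map_sub, hda, Dd_Dd, sub_zero])
  refine ⟨k' + l, ?_, ?_⟩
  · simp only [AlgHom.comp_apply] at hk ⊢
    rw [map_add, hl, add_zero, hk]
  · rw [map_add, hdl]; abel

/-- The image of a non-exact element detects non-exactness. -/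
theorem not_exact_of_map {f : A →ₐ[ℚ] B} (hf : IsDGAHom f) {a : A}
    (h : ∀ b, f a ≠ Dd B b) (c : A) : a ≠ Dd A c := by
  rintro rfl
  exact h (f c) (hf.1 c)

end Basic

/-- A grading is an algebra grading as soon as it is multiplicative, exhausting and separated by
a family of linear projections. -/
theorem isInternal_of_proj {B : Type} [Ring B] [Algebra ℚ B] (gr : ℕ → Submodule ℚ B)
    (π : ℕ → B →ₗ[ℚ] B) (hid : ∀ n, ∀ x ∈ gr n, π n x = x)
    (hz : ∀ m n, m ≠ n → ∀ x ∈ gr n, π m x = 0) (hspan : ∀ x, x ∈ ⨆ n, gr n) :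
    DirectSum.IsInternal gr := by
  rw [DirectSum.isInternal_submodule_iff_iSupIndep_and_iSup_eq_top]
  refine ⟨?_, eq_top_iff.2 fun x _ => hspan x⟩
  intro n
  rw [Submodule.disjoint_def]
  intro x hx hx'
  rw [← hid n x hx]
  have : (⨆ j, ⨆ (_ : j ≠ n), gr j) ≤ LinearMap.ker (π n) :=
    iSup_le fun j => iSup_le fun hj y hy => hz n j hj.symm y hy
  exact this hx'

/-- Building a graded algebra from projections. -/
@[reducible] def gradedOfProj {B : Type} [Ring B] [Algebra ℚ B] (gr : ℕ → Submodule ℚ B)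
    (π : ℕ → B →ₗ[ℚ] B) (hone : (1 : B) ∈ gr 0)
    (hmul : ∀ i j a b, a ∈ gr i → b ∈ gr j → a * b ∈ gr (i + j))
    (hid : ∀ n, ∀ x ∈ gr n, π n x = x)
    (hz : ∀ m n, m ≠ n → ∀ x ∈ gr n, π m x = 0) (hspan : ∀ x, x ∈ ⨆ n, gr n) :
    GradedAlgebra gr :=
  { one_mem := hone
    mul_mem := fun i j a b ha hb => hmul i j a b ha hb
    toDecomposition := (isInternal_of_proj gr π hid hz hspan).chooseDecomposition }

/-! ### Subalgebras and quotients -/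

section SubQuot

variable {A : Type} [GCDGA A]

theorem exists_sum_pr (a : A) : ∃ s : Finset ℕ, a = ∑ i ∈ s, pr A i a := by
  classical
  refine ⟨DFinsupp.support (DirectSum.decompose (Gr A) a), ?_⟩
  exact (DirectSum.sum_support_decompose (Gr A) a).symm

/-- The gcdga structure on a subalgebra stable under homogeneous components and `d`. -/
@[reducible] def subGCDGA (S : Subalgebra ℚ A) (hpr : ∀ n, ∀ a ∈ S, pr A n a ∈ S)
    (hd : ∀ a ∈ S, Dd A a ∈ S) : GCDGA S where
  grading n := (Gr A n).comap S.val.toLinearMap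
  gradedAlgebra := by
    refine gradedOfProj _
      (fun n => (pr A n).restrict (p := Subalgebra.toSubmodule S) (q := Subalgebra.toSubmodule S)
        (hpr n)) one_mem_Gr (fun i j a b ha hb => mul_mem_Gr (A := A) ha hb) ?_ ?_ ?_
    · intro n x hx; exact Subtype.ext (pr_of_mem hx)
    · intro m n hmn x hx; exact Subtype.ext (pr_of_ne hx hmn)
    · intro x
      obtain ⟨s, hs⟩ := exists_sum_pr (x : A)
      have : x = ∑ i ∈ s, (⟨pr A i x, hpr i x x.2⟩ : S) := by
        apply Subtype.ext
        rw [AddSubmonoidClass.coe_finsetSum]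
        exact hs
      rw [this]
      exact Submodule.sum_mem _ fun i _ => Submodule.mem_iSup_of_mem i (pr_mem (A := A) i x)
  grading_comm i j a b ha hb := Subtype.ext (Gr_comm (A := A) ha hb)
  d := (Dd A).restrict (p := Subalgebra.toSubmodule S) (q := Subalgebra.toSubmodule S) hd
  d_sq a := Subtype.ext (Dd_Dd (a : A))
  d_grading i a ha := Dd_mem (A := A) ha
  d_leibniz i a b ha := Subtype.ext (GCDGA.d_leibniz i (a : A) b ha)

/-- Descending a linear map along a surjection. -/
def descend {B K : Type} [Ring B] [Algebra ℚ B] [AddCommGroup K] [Module ℚ K] (f : A →ₐ[ℚ] B)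
    (hf : Function.Surjective f) (g : A →ₗ[ℚ] K) (h : ∀ a, f a = 0 → g a = 0) : B →ₗ[ℚ] K :=
  (LinearMap.ker f.toLinearMap).liftQ g h ∘ₗ
    (f.toLinearMap.quotKerEquivOfSurjective hf).symm.toLinearMap

theorem descend_apply {B K : Type} [Ring B] [Algebra ℚ B] [AddCommGroup K] [Module ℚ K]
    (f : A →ₐ[ℚ] B) (hf : Function.Surjective f) (g : A →ₗ[ℚ] K) (h : ∀ a, f a = 0 → g a = 0)
    (m : A) : descend f hf g h (f m) = g m := by
  have : (f.toLinearMap.quotKerEquivOfSurjective hf).symm (f m) = Submodule.Quotient.mk m := by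
    rw [LinearEquiv.symm_apply_eq]; rfl
  rw [descend, LinearMap.comp_apply, LinearEquiv.coe_coe, this]; rfl

/-- The gcdga structure on a quotient. -/
@[reducible] def quotGCDGA {B : Type} [Ring B] [Algebra ℚ B] (f : A →ₐ[ℚ] B)
    (hf : Function.Surjective f) (hpr : ∀ n a, f a = 0 → f (pr A n a) = 0)
    (hd : ∀ a, f a = 0 → f (Dd A a) = 0) : GCDGA B where
  grading n := (Gr A n).map f.toLinearMap
  gradedAlgebra := by
    refine gradedOfProj _ (fun n => descend f hf (f.toLinearMap ∘ₗ pr A n) (hpr n))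
      ⟨1, one_mem_Gr, map_one f⟩ ?_ ?_ ?_ ?_
    · rintro i j _ _ ⟨a, ha, rfl⟩ ⟨b, hb, rfl⟩
      exact ⟨a * b, mul_mem_Gr ha hb, map_mul f a b⟩
    · rintro n _ ⟨a, ha, rfl⟩
      exact (descend_apply f hf _ _ a).trans (congrArg f (pr_of_mem ha))
    · rintro m n hmn _ ⟨a, ha, rfl⟩
      exact (descend_apply f hf _ _ a).trans ((congrArg f (pr_of_ne ha hmn)).trans (map_zero f))
    · intro x
      obtain ⟨a, rfl⟩ := hf x
      induction a using Gr_induction with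
      | add a b ha hb => rw [map_add]; exact add_mem ha hb
      | hom n a ha => exact Submodule.mem_iSup_of_mem n ⟨a, ha, rfl⟩
  grading_comm := by
    rintro i j _ _ ⟨a, ha, rfl⟩ ⟨b, hb, rfl⟩
    have := congrArg f (Gr_comm ha hb)
    rwa [map_mul, map_smul, map_mul] at this
  d := descend f hf (f.toLinearMap ∘ₗ Dd A) hd
  d_sq b := by
    obtain ⟨a, rfl⟩ := hf b
    have h := descend_apply f hf (f.toLinearMap ∘ₗ Dd A) hd
    have h1 := h a
    have h2 := h (Dd A a)
    simp only [AlgHom.toLinearMap_apply, LinearMap.comp_apply, Dd_Dd, map_zero] at h1 h2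
    rw [h1, h2]
  d_grading := by
    rintro i _ ⟨a, ha, rfl⟩
    exact ⟨_, Dd_mem ha, (descend_apply f hf (f.toLinearMap ∘ₗ Dd A) hd a).symm⟩
  d_leibniz := by
    rintro i _ b ⟨a, ha, rfl⟩
    obtain ⟨b, rfl⟩ := hf b
    have h := descend_apply f hf (f.toLinearMap ∘ₗ Dd A) hd
    have h1 := h a
    have h2 := h b
    have h3 := h (a * b)
    simp only [AlgHom.toLinearMap_apply, LinearMap.comp_apply] at h1 h2 h3 ⊢
    rw [h1, h2, ← map_mul, h3, Dd_mul, sgn_of_mem ha]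
    simp

/-- Quotients by differential homogeneous two-sided ideals. -/
theorem exists_quotient (J : Submodule ℚ A) (hl : ∀ a, ∀ b ∈ J, a * b ∈ J)
    (hr : ∀ a, ∀ b ∈ J, b * a ∈ J) (hpr : ∀ n, ∀ a ∈ J, pr A n a ∈ J)
    (hd : ∀ a ∈ J, Dd A a ∈ J) :
    ∃ (Q : Type) (_ : GCDGA Q) (ρ : A →ₐ[ℚ] Q), IsDGAHom ρ ∧ Function.Surjective ρ ∧
      LinearMap.ker ρ.toLinearMap = J := by
  let I : Ideal A :=
    { carrier := J
      add_mem' := fun ha hb => J.add_mem ha hb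
      zero_mem' := J.zero_mem
      smul_mem' := fun a b hb => hl a b hb }
  have : I.IsTwoSided := ⟨fun {a} b ha => hr b a ha⟩
  have hker : ∀ a, Ideal.Quotient.mkₐ ℚ I a = 0 ↔ a ∈ J := fun a =>
    Ideal.Quotient.eq_zero_iff_mem (I := I)
  have hs : Function.Surjective (Ideal.Quotient.mkₐ ℚ I) := Ideal.Quotient.mkₐ_surjective ℚ I
  have hpr' : ∀ n a, Ideal.Quotient.mkₐ ℚ I a = 0 → Ideal.Quotient.mkₐ ℚ I (pr A n a) = 0 :=
    fun n a ha => (hker _).2 (hpr n a ((hker a).1 ha))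
  have hd' : ∀ a, Ideal.Quotient.mkₐ ℚ I a = 0 → Ideal.Quotient.mkₐ ℚ I (Dd A a) = 0 :=
    fun a ha => (hker _).2 (hd a ((hker a).1 ha))
  let inst : GCDGA (A ⧸ I) := quotGCDGA (Ideal.Quotient.mkₐ ℚ I) hs hpr' hd'
  refine ⟨A ⧸ I, inst, Ideal.Quotient.mkₐ ℚ I, ⟨fun a => ?_, fun i a ha => ⟨a, ha, rfl⟩⟩, hs, ?_⟩
  · exact (descend_apply (Ideal.Quotient.mkₐ ℚ I) hs ((Ideal.Quotient.mkₐ ℚ I).toLinearMap ∘ₗ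
      Dd A) hd' a).symm
  · ext a; exact hker a

end SubQuot

/-! ### Adjoining an odd generator -/

/-- An even cocycle together with the (odd) degree of a generator to be adjoined to kill it. -/
structure OddCocycle (B : Type) [GCDGA B] where
  deg : ℕ
  odd : Odd deg
  z : B
  mem : z ∈ Gr B (deg + 1)
  closed : Dd B z = 0

/-- The image of an even cocycle. -/
def OddCocycle.map {B C : Type} [GCDGA B] [GCDGA C] (c : OddCocycle B) (f : B →ₐ[ℚ] C)
    (hf : IsDGAHom f) : OddCocycle C where
  deg := c.deg
  odd := c.odd
  z := f c.z
  mem := hf.2 _ _ c.mem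
  closed := by rw [← hf.1, c.closed, map_zero]

/-- The extension `B ⊗ Λ(w)` with `dw = z`; the pair `(a, b)` stands for `a + b w`. -/
@[ext] structure Adj (B : Type) [GCDGA B] (c : OddCocycle B) where
  fst : B
  snd : B

namespace Adj

variable {B : Type} [GCDGA B] {c : OddCocycle B}

theorem z_comm (c : OddCocycle B) (b : B) : c.z * b = b * c.z := even_comm c.mem c.odd.add_one b

theorem sgn_z (c : OddCocycle B) : sgn B c.z = c.z := sgn_of_even c.mem c.odd.add_one

instance : Zero (Adj B c) := ⟨⟨0, 0⟩⟩
instance : One (Adj B c) := ⟨⟨1, 0⟩⟩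
instance : Add (Adj B c) := ⟨fun u v => ⟨u.1 + v.1, u.2 + v.2⟩⟩
instance : Neg (Adj B c) := ⟨fun u => ⟨-u.1, -u.2⟩⟩
instance : Mul (Adj B c) := ⟨fun u v => ⟨u.1 * v.1, u.1 * v.2 + u.2 * sgn B v.1⟩⟩
instance : SMul ℚ (Adj B c) := ⟨fun q u => ⟨q • u.1, q • u.2⟩⟩

@[simp] theorem zero_fst : (0 : Adj B c).1 = 0 := rfl
@[simp] theorem zero_snd : (0 : Adj B c).2 = 0 := rfl
@[simp] theorem one_fst : (1 : Adj B c).1 = 1 := rfl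
@[simp] theorem one_snd : (1 : Adj B c).2 = 0 := rfl
@[simp] theorem add_fst (u v : Adj B c) : (u + v).1 = u.1 + v.1 := rfl
@[simp] theorem add_snd (u v : Adj B c) : (u + v).2 = u.2 + v.2 := rfl
@[simp] theorem neg_fst (u : Adj B c) : (-u).1 = -u.1 := rfl
@[simp] theorem neg_snd (u : Adj B c) : (-u).2 = -u.2 := rfl
@[simp] theorem mul_fst (u v : Adj B c) : (u * v).1 = u.1 * v.1 := rfl
@[simp] theorem mul_snd (u v : Adj B c) : (u * v).2 = u.1 * v.2 + u.2 * sgn B v.1 := rfl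
@[simp] theorem smul_fst (q : ℚ) (u : Adj B c) : (q • u).1 = q • u.1 := rfl
@[simp] theorem smul_snd (q : ℚ) (u : Adj B c) : (q • u).2 = q • u.2 := rfl

instance : Ring (Adj B c) where
  add_assoc u v w := by ext <;> simp [add_assoc]
  zero_add u := by ext <;> simp
  add_zero u := by ext <;> simp
  add_comm u v := by ext <;> simp [add_comm]
  nsmul := nsmulRec
  zsmul := zsmulRec
  neg_add_cancel u := by ext <;> simp
  mul_assoc u v w := by ext <;> simp [mul_assoc, mul_add, add_mul, add_assoc]
  one_mul u := by ext <;> simp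
  mul_one u := by ext <;> simp
  zero_mul u := by ext <;> simp
  mul_zero u := by ext <;> simp
  left_distrib u v w := by ext <;> simp [mul_add]; abel
  right_distrib u v w := by ext <;> simp [add_mul]; abel

instance : Module ℚ (Adj B c) where
  one_smul u := by ext <;> simp
  mul_smul p q u := by ext <;> simp [mul_smul]
  smul_zero q := by ext <;> simp
  smul_add q u v := by ext <;> simp
  add_smul p q u := by ext <;> simp [add_smul]
  zero_smul u := by ext <;> simp

instance : Algebra ℚ (Adj B c) :=
  Algebra.ofModule (fun q u v => by ext <;> simp) (fun q u v => by ext <;> simp)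

/-- The base, as a linear map. -/
def inlL (B : Type) [GCDGA B] (c : OddCocycle B) : B →ₗ[ℚ] Adj B c where
  toFun a := ⟨a, 0⟩
  map_add' a b := by ext <;> simp
  map_smul' q a := by ext <;> simp

/-- The multiples of the new generator, as a linear map. -/
def inrL (B : Type) [GCDGA B] (c : OddCocycle B) : B →ₗ[ℚ] Adj B c where
  toFun a := ⟨0, a⟩
  map_add' a b := by ext <;> simp
  map_smul' q a := by ext <;> simp

/-- First coordinate, as a linear map. -/
def fstL (B : Type) [GCDGA B] (c : OddCocycle B) : Adj B c →ₗ[ℚ] B where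
  toFun u := u.1
  map_add' _ _ := rfl
  map_smul' _ _ := rfl

/-- Second coordinate, as a linear map. -/
def sndL (B : Type) [GCDGA B] (c : OddCocycle B) : Adj B c →ₗ[ℚ] B where
  toFun u := u.2
  map_add' _ _ := rfl
  map_smul' _ _ := rfl

/-- The shifted grading. -/
def shGr (B : Type) [GCDGA B] (n i : ℕ) : Submodule ℚ B := if n ≤ i then Gr B (i - n) else ⊥

theorem shGr_add {n k : ℕ} : shGr B n (k + n) = Gr B k := by simp [shGr]

theorem mem_shGr {n i : ℕ} {b : B} : b ∈ shGr B n i ↔ (∃ k, k + n = i ∧ b ∈ Gr B k) ∨ b = 0 := by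
  constructor
  · intro h
    unfold shGr at h
    split_ifs at h with hn
    · exact Or.inl ⟨i - n, by omega, h⟩
    · exact Or.inr h
  · rintro (⟨k, rfl, h⟩ | rfl)
    · rwa [shGr_add]
    · exact zero_mem _

/-- The shifted projections. -/
def shPr (B : Type) [GCDGA B] (n i : ℕ) : B →ₗ[ℚ] B := if n ≤ i then pr B (i - n) else 0

/-- The grading of `Adj B c`. -/
def gr (B : Type) [GCDGA B] (c : OddCocycle B) (i : ℕ) : Submodule ℚ (Adj B c) :=
  (Gr B i).comap (fstL B c) ⊓ (shGr B c.deg i).comap (sndL B c)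

theorem mem_gr {i : ℕ} {u : Adj B c} : u ∈ gr B c i ↔ u.1 ∈ Gr B i ∧ u.2 ∈ shGr B c.deg i :=
  Iff.rfl

theorem shGr_mul_left {n i j : ℕ} {a b : B} (ha : a ∈ Gr B i) (hb : b ∈ shGr B n j) :
    a * b ∈ shGr B n (i + j) := by
  rcases mem_shGr.1 hb with ⟨k, rfl, h⟩ | rfl
  · rw [← add_assoc, shGr_add]; exact mul_mem_Gr ha h
  · simp

theorem shGr_mul_right {n i j : ℕ} {a b : B} (ha : a ∈ shGr B n i) (hb : b ∈ Gr B j) :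
    a * b ∈ shGr B n (i + j) := by
  rcases mem_shGr.1 ha with ⟨k, rfl, h⟩ | rfl
  · rw [add_right_comm, shGr_add]; exact mul_mem_Gr h hb
  · simp

/-- The differential of `Adj B c`. -/
def dL (B : Type) [GCDGA B] (c : OddCocycle B) : Adj B c →ₗ[ℚ] Adj B c where
  toFun u := ⟨Dd B u.1 + sgn B u.2 * c.z, Dd B u.2⟩
  map_add' u v := by ext <;> simp [add_mul]; abel
  map_smul' q u := by ext <;> simp

instance : GCDGA (Adj B c) where
  grading := gr B c
  gradedAlgebra := by
    refine gradedOfProj _ (fun n => inlL B c ∘ₗ pr B n ∘ₗ fstL B c +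
      inrL B c ∘ₗ shPr B c.deg n ∘ₗ sndL B c) ⟨one_mem_Gr, zero_mem (shGr B c.deg 0)⟩ ?_ ?_ ?_ ?_
    · rintro i j a b ⟨ha, ha'⟩ ⟨hb, hb'⟩
      exact ⟨mul_mem_Gr ha hb, add_mem (shGr_mul_left ha hb') (shGr_mul_right ha' (sgn_mem hb))⟩
    · rintro n x ⟨h, h'⟩
      ext
      · simpa [inlL, inrL, fstL, sndL] using pr_of_mem h
      · rcases mem_shGr.1 h' with ⟨k, rfl, hk⟩ | h0
        · simpa [inlL, inrL, fstL, sndL, shPr] using pr_of_mem hk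
        · have h0 : x.2 = 0 := h0
          simp [inlL, inrL, fstL, sndL, h0]
    · rintro m n hmn x ⟨h, h'⟩
      ext
      · simpa [inlL, inrL, fstL, sndL] using pr_of_ne h hmn
      · rcases mem_shGr.1 h' with ⟨k, rfl, hk⟩ | h0
        · simp only [inlL, inrL, fstL, sndL, shPr]
          split_ifs with hm
          · simpa using pr_of_ne (a := x.2) hk (show m - c.deg ≠ k by omega)
          · simp
        · have h0 : x.2 = 0 := h0
          simp [inlL, inrL, fstL, sndL, h0]
    · intro x
      have h1 : ∀ a : B, inlL B c a ∈ ⨆ n, gr B c n := fun a => by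
        induction a using Gr_induction with
        | add a b ha hb => rw [map_add]; exact add_mem ha hb
        | hom n a ha => exact Submodule.mem_iSup_of_mem n (mem_gr.2 ⟨ha, zero_mem _⟩)
      have h2 : ∀ a : B, inrL B c a ∈ ⨆ n, gr B c n := fun a => by
        induction a using Gr_induction with
        | add a b ha hb => rw [map_add]; exact add_mem ha hb
        | hom n a ha =>
          refine Submodule.mem_iSup_of_mem (n + c.deg) (mem_gr.2 ⟨zero_mem _, ?_⟩)
          rw [shGr_add]; exact ha
      have : x = inlL B c x.1 + inrL B c x.2 := by ext <;> simp [inlL, inrL]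
      rw [this]
      exact add_mem (h1 _) (h2 _)
  grading_comm := by
    rintro i j a b ⟨ha, ha'⟩ ⟨hb, hb'⟩
    replace ha : a.1 ∈ Gr B i := ha
    replace hb : b.1 ∈ Gr B j := hb
    ext
    · simpa using Gr_comm ha hb
    · simp only [mul_snd, smul_snd]
      rw [sgn_of_mem ha, sgn_of_mem hb]
      have e1 : a.1 * b.2 = ((-1 : ℚ) ^ (i * j)) • (b.2 * ((-1 : ℚ) ^ i) • a.1) := by
        rcases mem_shGr.1 hb' with ⟨k, rfl, hk⟩ | h0
        · replace hk : b.2 ∈ Gr B k := hk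
          rw [Gr_comm ha hk, mul_smul_comm, smul_smul, mul_add, pow_add, mul_assoc]
          congr 1
          rcases Nat.even_or_odd i with hi | hi
          · simp [hi.neg_one_pow, (hi.mul_right c.deg).neg_one_pow]
          · simp [hi.neg_one_pow, (hi.mul c.odd).neg_one_pow]
        · have h0 : b.2 = 0 := h0
          simp [h0]
      have e2 : a.2 * ((-1 : ℚ) ^ j) • b.1 = ((-1 : ℚ) ^ (i * j)) • (b.1 * a.2) := by
        rcases mem_shGr.1 ha' with ⟨k, rfl, hk⟩ | h0
        · replace hk : a.2 ∈ Gr B k := hk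
          rw [mul_smul_comm, Gr_comm hk hb, smul_smul, add_mul, pow_add, mul_comm]
          congr 2
          rcases Nat.even_or_odd j with hi | hi
          · simp [hi.neg_one_pow, (hi.mul_left c.deg).neg_one_pow]
          · simp [hi.neg_one_pow, (c.odd.mul hi).neg_one_pow]
        · have h0 : a.2 = 0 := h0
          simp [h0]
      rw [e1, e2, smul_add, add_comm]
  d := dL B c
  d_sq u := by
    ext
    · simp [dL, Dd_mul, Dd_sgn, c.closed]
    · simp [dL]
  d_grading := by
    rintro i a ⟨ha, ha'⟩
    refine ⟨add_mem (Dd_mem ha) ?_, ?_⟩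
    · rcases mem_shGr.1 ha' with ⟨k, rfl, hk⟩ | h0
      · rw [add_assoc]; exact mul_mem_Gr (sgn_mem hk) c.mem
      · have h0 : a.2 = 0 := h0
        simp [h0]
    · rcases mem_shGr.1 ha' with ⟨k, rfl, hk⟩ | h0
      · exact mem_shGr.2 (Or.inl ⟨k + 1, by omega, Dd_mem hk⟩)
      · have h0 : a.2 = 0 := h0
        simp [h0, dL, sndL]
  d_leibniz := by
    rintro i a b ⟨ha, ha'⟩
    replace ha : a.1 ∈ Gr B i := ha
    have e : sgn B a.2 = -(((-1 : ℚ) ^ i) • a.2) := by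
      rcases mem_shGr.1 ha' with ⟨k, rfl, hk⟩ | h0
      · replace hk : a.2 ∈ Gr B k := hk
        rw [sgn_of_mem hk, pow_add, c.odd.neg_one_pow]; simp
      · have h0 : a.2 = 0 := h0
        simp [h0]
    have e' : ((-1 : ℚ) ^ i) • a.2 = -sgn B a.2 := by rw [e, neg_neg]
    ext
    · simp only [dL, LinearMap.coe_mk, AddHom.coe_mk, mul_fst, mul_snd, add_fst, smul_fst]
      rw [← smul_mul_assoc, ← sgn_of_mem ha]
      simp only [Dd_mul, map_add, map_mul, sgn_sgn, mul_add, add_mul, mul_assoc, z_comm]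
      abel
    · simp only [dL, LinearMap.coe_mk, AddHom.coe_mk, mul_fst, mul_snd, add_snd, smul_snd]
      rw [smul_add, ← smul_mul_assoc, ← smul_mul_assoc, ← sgn_of_mem ha, e']
      simp only [Dd_mul, map_add, map_mul, sgn_sgn, mul_add, add_mul, mul_assoc, z_comm, sgn_z,
        Dd_sgn]
      simp only [neg_mul, mul_neg]
      abel

theorem Dd_fst (u : Adj B c) : (Dd (Adj B c) u).1 = Dd B u.1 + sgn B u.2 * c.z := rfl
theorem Dd_snd (u : Adj B c) : (Dd (Adj B c) u).2 = Dd B u.2 := rfl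

/-- The inclusion of the base. -/
def inl (B : Type) [GCDGA B] (c : OddCocycle B) : B →ₐ[ℚ] Adj B c :=
  AlgHom.ofLinearMap (inlL B c) rfl (fun a b => by ext <;> simp [inlL])

@[simp] theorem inl_fst (a : B) : (inl B c a).1 = a := rfl
@[simp] theorem inl_snd (a : B) : (inl B c a).2 = 0 := rfl

/-- The new generator. -/
def w (B : Type) [GCDGA B] (c : OddCocycle B) : Adj B c := ⟨0, 1⟩

@[simp] theorem w_fst : (w B c).1 = 0 := rfl
@[simp] theorem w_snd : (w B c).2 = 1 := rfl

theorem inl_dga : IsDGAHom (inl B c) := by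
  refine ⟨fun a => ?_, fun i a ha => mem_gr.2 ⟨ha, zero_mem _⟩⟩
  ext <;> simp [Dd_fst, Dd_snd]

theorem w_mem : w B c ∈ Gr (Adj B c) c.deg :=
  mem_gr.2 ⟨zero_mem _, mem_shGr.2 (Or.inl ⟨0, zero_add _, one_mem_Gr⟩)⟩

theorem Dd_w : Dd (Adj B c) (w B c) = inl B c c.z := by
  ext <;> simp [Dd_fst, Dd_snd]

theorem eq_inl_add (u : Adj B c) : u = inl B c u.1 + inl B c u.2 * w B c := by
  ext <;> simp

theorem adjoin_eq_top {s : Set B} (hs : Algebra.adjoin ℚ s = ⊤) :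
    Algebra.adjoin ℚ (inl B c '' s ∪ {w B c}) = ⊤ := by
  rw [eq_top_iff]
  intro u _
  have h : ∀ a, inl B c a ∈ Algebra.adjoin ℚ (inl B c '' s ∪ {w B c}) := fun a => by
    have : inl B c a ∈ (Algebra.adjoin ℚ s).map (inl B c) := ⟨a, by rw [hs]; trivial, rfl⟩
    rw [AlgHom.map_adjoin] at this
    exact Algebra.adjoin_mono Set.subset_union_left this
  rw [eq_inl_add u]
  exact add_mem (h _) (mul_mem (h _) (Algebra.subset_adjoin (Or.inr rfl)))

variable {C : Type} [GCDGA C]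

/-- The universal property of `Adj B c` among graded algebras. -/
def lift (f : B →ₐ[ℚ] C) (hf : GrHom f) (v : C) (hv : v ∈ Gr C c.deg) : Adj B c →ₐ[ℚ] C :=
  AlgHom.ofLinearMap
    (f.toLinearMap ∘ₗ fstL B c + LinearMap.mulRight ℚ v ∘ₗ f.toLinearMap ∘ₗ sndL B c)
    (by simp [fstL, sndL]) (by
      intro u u'
      simp only [fstL, sndL, LinearMap.add_apply, LinearMap.comp_apply, LinearMap.coe_mk,
        AddHom.coe_mk, AlgHom.toLinearMap_apply, LinearMap.mulRight_apply, mul_fst, mul_snd,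
        map_mul, map_add, hf.sgn]
      have h1 : v * f u'.1 = sgn C (f u'.1) * v := odd_comm hv c.odd _
      have h2 : v * (f u'.2 * v) = 0 := by
        rw [← mul_assoc, odd_comm hv c.odd, mul_assoc, odd_sq hv c.odd, mul_zero]
      simp only [mul_add, add_mul, mul_assoc, h1, h2, mul_zero, add_zero]
      abel)

theorem lift_apply (f : B →ₐ[ℚ] C) (hf : GrHom f) (v : C) (hv : v ∈ Gr C c.deg) (u : Adj B c) :
    lift f hf v hv u = f u.1 + f u.2 * v := rfl

theorem lift_inl (f : B →ₐ[ℚ] C) (hf : GrHom f) (v : C) (hv : v ∈ Gr C c.deg) (b : B) :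
    lift f hf v hv (inl B c b) = f b := by simp [lift_apply]

theorem lift_w (f : B →ₐ[ℚ] C) (hf : GrHom f) (v : C) (hv : v ∈ Gr C c.deg) :
    lift f hf v hv (w B c) = v := by simp [lift_apply]

theorem lift_gr (f : B →ₐ[ℚ] C) (hf : GrHom f) (v : C) (hv : v ∈ Gr C c.deg) :
    GrHom (lift f hf v hv) := by
  rintro i u ⟨h, h'⟩
  rw [lift_apply]
  refine add_mem (hf i _ h) ?_
  rcases mem_shGr.1 h' with ⟨k, rfl, hk⟩ | h0
  · exact mul_mem_Gr (hf k _ hk) hv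
  · have h0 : u.2 = 0 := h0
    simp [h0]

theorem lift_dga (f : B →ₐ[ℚ] C) (hf : IsDGAHom f) (v : C) (hv : v ∈ Gr C c.deg)
    (hd : Dd C v = f c.z) : IsDGAHom (lift f hf.gr v hv) := by
  refine ⟨fun u => ?_, lift_gr f hf.gr v hv⟩
  rw [lift_apply, lift_apply, Dd_fst, Dd_snd, map_add, map_add, Dd_mul, hd, map_mul, hf.1, hf.1,
    hf.gr.sgn]
  abel

/-- Functoriality of `Adj`. -/
def map (f : B →ₐ[ℚ] C) (hf : IsDGAHom f) (c : OddCocycle B) : Adj B c →ₐ[ℚ] Adj C (c.map f hf) :=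
  lift ((inl C _).comp f) (inl_dga.comp hf).gr (w C (c.map f hf)) w_mem

theorem map_apply (f : B →ₐ[ℚ] C) (hf : IsDGAHom f) (u : Adj B c) :
    map f hf c u = ⟨f u.1, f u.2⟩ := by
  have h : map f hf c u = inl C _ (f u.1) + inl C _ (f u.2) * w C _ := rfl
  rw [h]; ext <;> simp

theorem map_dga (f : B →ₐ[ℚ] C) (hf : IsDGAHom f) : IsDGAHom (map f hf c) :=
  lift_dga _ (inl_dga.comp hf) _ _ Dd_w

theorem map_surjAcyc (f : B →ₐ[ℚ] C) (hf : IsDGAHom f) (hs : SurjAcyc f) :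
    SurjAcyc (map f hf c) := by
  refine ⟨fun v => ?_, fun u hu hdu => ?_⟩
  · obtain ⟨a, ha⟩ := hs.1 v.1
    obtain ⟨b, hb⟩ := hs.1 v.2
    exact ⟨⟨a, b⟩, by rw [map_apply, ha, hb]⟩
  · rw [map_apply] at hu
    have h1 : f u.1 = 0 := congrArg Adj.fst hu
    have h2 : f u.2 = 0 := congrArg Adj.snd hu
    have d1 : Dd B u.1 + sgn B u.2 * c.z = 0 := congrArg Adj.fst hdu
    have d2 : Dd B u.2 = 0 := congrArg Adj.snd hdu
    obtain ⟨k, hk, hdk⟩ := hs.2 _ h2 d2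
    obtain ⟨l, hl, hdl⟩ := hs.2 (u.1 - sgn B k * c.z)
      (by rw [map_sub, map_mul, hf.gr.sgn, hk, h1]; simp)
      (by rw [map_sub, Dd_mul, c.closed, Dd_sgn, hdk, mul_zero, add_zero, neg_mul,
        sub_neg_eq_add, d1])
    refine ⟨⟨l, k⟩, by rw [map_apply, hl, hk]; rfl, ?_⟩
    ext
    · rw [Dd_fst, hdl]; simp
    · rw [Dd_snd, hdk]

theorem not_exact_mul_w {t : B} (ht : ∀ b, t ≠ Dd B b) (u : Adj B c) :
    inl B c t * w B c ≠ Dd (Adj B c) u := by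
  intro h
  have := congrArg Adj.snd h
  rw [Dd_snd] at this
  simp only [mul_snd, inl_fst, w_snd, inl_snd, mul_one, zero_mul, add_zero] at this
  exact ht _ this

end Adj

/-! ### Free graded-commutative algebras -/

/-- The family `g`, with degrees `deg`, freely generates `A` as a graded-commutative algebra. -/
def FreeOn {A : Type} [GCDGA A] {ι : Type} (g : ι → A) (deg : ι → ℕ) : Prop :=
  (∀ i, g i ∈ Gr A (deg i)) ∧ Algebra.adjoin ℚ (Set.range g) = ⊤ ∧
    ∀ (B : Type) [GCDGA B] (c : ι → B), (∀ i, c i ∈ Gr B (deg i)) →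
      ∃ f : A →ₐ[ℚ] B, GrHom f ∧ ∀ i, f (g i) = c i

theorem algHom_ext_gens {A B : Type} [GCDGA A] [GCDGA B] {ι : Type} {g : ι → A}
    (hg : Algebra.adjoin ℚ (Set.range g) = ⊤) {f f' : A →ₐ[ℚ] B} (h : ∀ i, f (g i) = f' (g i)) :
    f = f' :=
  AlgHom.ext_of_adjoin_eq_top hg (by rintro _ ⟨i, rfl⟩; exact h i)

/-- Two algebras free on generators of the same degrees are isomorphic. -/
theorem FreeOn.exists_iso {A B : Type} [GCDGA A] [GCDGA B] {ι : Type} {g : ι → A} {g' : ι → B}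
    {deg : ι → ℕ} (h : FreeOn g deg) (h' : FreeOn g' deg) :
    ∃ f : A →ₐ[ℚ] B, GrHom f ∧ (∀ i, f (g i) = g' i) ∧ Function.Bijective f := by
  obtain ⟨f, hf, hfg⟩ := h.2.2 B g' h'.1
  obtain ⟨f', hf', hfg'⟩ := h'.2.2 A g h.1
  refine ⟨f, hf, hfg, Function.bijective_iff_has_inverse.2 ⟨f', ?_, ?_⟩⟩
  · intro a
    have : f'.comp f = AlgHom.id ℚ A := algHom_ext_gens h.2.1 (by simp [hfg, hfg'])
    exact DFunLike.congr_fun this a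
  · intro a
    have : f.comp f' = AlgHom.id ℚ B := algHom_ext_gens h'.2.1 (by simp [hfg, hfg'])
    exact DFunLike.congr_fun this a

theorem surjAcyc_of_bijective {A B : Type} [GCDGA A] [GCDGA B] {f : A →ₐ[ℚ] B}
    (hf : Function.Bijective f) : SurjAcyc f := by
  refine ⟨hf.2, fun a ha _ => ⟨0, map_zero f, ?_⟩⟩
  rw [map_zero, hf.1 (ha.trans (map_zero f).symm)]

theorem Adj.freeOn {B : Type} [GCDGA B] (c : OddCocycle B) {ι : Type} {g : ι → B} {deg : ι → ℕ}
    (h : FreeOn g deg) :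
    FreeOn (fun i : Option ι => i.elim (Adj.w B c) (fun i => Adj.inl B c (g i)))
      (fun i => i.elim c.deg deg) := by
  refine ⟨?_, ?_, fun C _ v hv => ?_⟩
  · rintro (_ | i)
    · exact Adj.w_mem
    · exact Adj.inl_dga.2 _ _ (h.1 i)
  · rw [eq_top_iff, ← Adj.adjoin_eq_top (c := c) h.2.1]
    refine Algebra.adjoin_mono ?_
    rintro _ (⟨_, ⟨i, rfl⟩, rfl⟩ | rfl)
    · exact ⟨some i, rfl⟩
    · exact ⟨none, rfl⟩
  · obtain ⟨f, hf, hfg⟩ := h.2.2 C (fun i => v (some i)) (fun i => hv (some i))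
    refine ⟨Adj.lift f hf (v none) (hv none), Adj.lift_gr _ _ _ _, ?_⟩
    rintro (_ | i)
    · exact Adj.lift_w _ _ _ _
    · exact (Adj.lift_inl _ _ _ _ _).trans (hfg i)

theorem Adj.map_inl {B C : Type} [GCDGA B] [GCDGA C] {c : OddCocycle B} (f : B →ₐ[ℚ] C)
    (hf : IsDGAHom f) (b : B) : Adj.map f hf c (Adj.inl B c b) = Adj.inl C _ (f b) :=
  Adj.lift_inl _ _ _ _ _

theorem Adj.map_w {B C : Type} [GCDGA B] [GCDGA C] {c : OddCocycle B} (f : B →ₐ[ℚ] C)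
    (hf : IsDGAHom f) : Adj.map f hf c (Adj.w B c) = Adj.w C _ :=
  Adj.lift_w _ _ _ _

/-- Parallel iterated extensions of the source and the target of `f` by odd generators killing
the cocycles `c k` and `f (c k)`. -/
structure KExt {R R' : Type} [GCDGA R] [GCDGA R'] (f : R →ₐ[ℚ] R') {n : ℕ}
    (c : Fin n → OddCocycle R) where
  M : Type
  [instM : GCDGA M]
  M' : Type
  [instM' : GCDGA M']
  i : R →ₐ[ℚ] M
  i' : R' →ₐ[ℚ] M'
  F : M →ₐ[ℚ] M'
  i_dga : IsDGAHom i
  i'_dga : IsDGAHom i'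
  F_dga : IsDGAHom F
  F_i : ∀ a, F (i a) = i' (f a)
  F_surjAcyc : SurjAcyc f → SurjAcyc F
  w : Fin n → M
  w_mem : ∀ k, w k ∈ Gr M (c k).deg
  Dd_w : ∀ k, Dd M (w k) = i (c k).z
  gen : ∀ s : Set R, Algebra.adjoin ℚ s = ⊤ → Algebra.adjoin ℚ (i '' s ∪ Set.range w) = ⊤
  lift : ∀ (B : Type) [GCDGA B] (g : R →ₐ[ℚ] B), GrHom g → ∀ v : Fin n → B,
    (∀ k, v k ∈ Gr B (c k).deg) →
      ∃ h : M →ₐ[ℚ] B, GrHom h ∧ (∀ a, h (i a) = g a) ∧ ∀ k, h (w k) = v k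
  not_exact : ∀ t : R', (∀ b, t ≠ Dd R' b) →
    ∀ b, i' t * (List.ofFn fun k => F (w k)).prod ≠ Dd M' b

attribute [instance] KExt.instM KExt.instM'

theorem exists_kExt : ∀ (n : ℕ) {R R' : Type} [GCDGA R] [GCDGA R'] (f : R →ₐ[ℚ] R'),
    IsDGAHom f → ∀ c : Fin n → OddCocycle R, Nonempty (KExt f c) := by
  intro n
  induction n with
  | zero =>
    intro R R' _ _ f hf c
    refine ⟨{ M := R, M' := R', i := AlgHom.id ℚ R, i' := AlgHom.id ℚ R', F := f
              i_dga := isDGAHom_id R, i'_dga := isDGAHom_id R', F_dga := hf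
              F_i := fun _ => rfl, F_surjAcyc := id
              w := fun k => k.elim0, w_mem := fun k => k.elim0, Dd_w := fun k => k.elim0
              gen := fun s hs => ?_, lift := fun B _ g hg v _ => ?_, not_exact := ?_ }⟩
    · rw [eq_top_iff, ← hs]
      exact Algebra.adjoin_mono fun a ha => Or.inl ⟨a, ha, rfl⟩
    · exact ⟨g, hg, fun _ => rfl, fun k => k.elim0⟩
    · intro t ht b; simpa using ht b
  | succ n ih =>
    intro R R' _ _ f hf c
    obtain ⟨E⟩ := ih (Adj.map f hf (c 0)) (Adj.map_dga f hf)
      (fun k => (c k.succ).map (Adj.inl R (c 0)) Adj.inl_dga)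
    refine ⟨{ M := E.M, M' := E.M', i := E.i.comp (Adj.inl _ _), i' := E.i'.comp (Adj.inl _ _)
              F := E.F
              i_dga := E.i_dga.comp Adj.inl_dga, i'_dga := E.i'_dga.comp Adj.inl_dga
              F_dga := E.F_dga, F_i := fun a => ?_
              F_surjAcyc := fun h => E.F_surjAcyc (Adj.map_surjAcyc f hf h)
              w := Fin.cons (E.i (Adj.w _ _)) E.w, w_mem := fun k => ?_, Dd_w := fun k => ?_
              gen := fun s hs => ?_, lift := fun B _ g hg v hv => ?_, not_exact := ?_ }⟩
    · simp only [AlgHom.comp_apply]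
      rw [E.F_i, Adj.map_inl]
    · refine Fin.cases ?_ (fun k => ?_) k
      · exact E.i_dga.2 _ _ Adj.w_mem
      · exact E.w_mem k
    · refine Fin.cases ?_ (fun k => ?_) k
      · simp only [Fin.cons_zero]; rw [← E.i_dga.1, Adj.Dd_w]; rfl
      · exact E.Dd_w k
    · rw [eq_top_iff, ← E.gen _ (Adj.adjoin_eq_top (c := c 0) hs)]
      refine Algebra.adjoin_mono ?_
      rintro _ (⟨_, ⟨a, ha, rfl⟩ | rfl, rfl⟩ | ⟨k, rfl⟩)
      · exact Or.inl ⟨a, ha, rfl⟩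
      · exact Or.inr ⟨0, rfl⟩
      · exact Or.inr ⟨k.succ, by simp⟩
    · obtain ⟨h, h1, h2, h3⟩ := E.lift B (Adj.lift g hg (v 0) (hv 0)) (Adj.lift_gr _ _ _ _)
        (fun k => v k.succ) (fun k => hv k.succ)
      refine ⟨h, h1, fun a => ?_, fun k => ?_⟩
      · exact (h2 _).trans (Adj.lift_inl _ _ _ _ _)
      · refine Fin.cases ?_ (fun k => ?_) k
        · exact (h2 _).trans (Adj.lift_w _ _ _ _)
        · exact h3 k
    · intro t ht b
      have := E.not_exact _ (Adj.not_exact_mul_w (c := (c 0).map f hf) ht) b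
      rw [List.ofFn_succ, List.prod_cons]
      simp only [Fin.cons_zero, Fin.cons_succ, AlgHom.comp_apply]
      rw [E.F_i, Adj.map_w, ← mul_assoc, ← map_mul]
      exact this

theorem KExt.freeOn {R R' : Type} [GCDGA R] [GCDGA R'] {f : R →ₐ[ℚ] R'} {n : ℕ}
    {c : Fin n → OddCocycle R} (E : KExt f c) {ι : Type} {g : ι → R} {deg : ι → ℕ}
    (h : FreeOn g deg) :
    FreeOn (Sum.elim (fun i => E.i (g i)) E.w) (Sum.elim deg fun k => (c k).deg) := by
  refine ⟨?_, ?_, fun C _ v hv => ?_⟩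
  · rintro (i | k)
    · exact E.i_dga.2 _ _ (h.1 i)
    · exact E.w_mem k
  · rw [eq_top_iff, ← E.gen _ h.2.1]
    refine Algebra.adjoin_mono ?_
    rintro _ (⟨_, ⟨i, rfl⟩, rfl⟩ | ⟨k, rfl⟩)
    · exact ⟨Sum.inl i, rfl⟩
    · exact ⟨Sum.inr k, rfl⟩
  · obtain ⟨f, hf, hfg⟩ := h.2.2 C (fun i => v (Sum.inl i)) (fun i => hv (Sum.inl i))
    obtain ⟨k, hk, hki, hkw⟩ := E.lift C f hf (fun k => v (Sum.inr k)) (fun k => hv (Sum.inr k))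
    refine ⟨k, hk, ?_⟩
    rintro (i | j)
    · exact (hki _).trans (hfg i)
    · exact hkw j

/-! ### Polynomial algebras in two even variables -/

/-- The polynomial algebra on two variables of even degrees `e 0`, `e 1`. -/
def Poly (e : Fin 2 → ℕ) (_ : ∀ i, Even (e i)) : Type := MvPolynomial (Fin 2) ℚ

namespace Poly

variable {e : Fin 2 → ℕ} {he : ∀ i, Even (e i)}

instance : CommRing (Poly e he) := inferInstanceAs (CommRing (MvPolynomial (Fin 2) ℚ))
instance : Algebra ℚ (Poly e he) := inferInstanceAs (Algebra ℚ (MvPolynomial (Fin 2) ℚ))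

theorem eq_zero_of_odd {n : ℕ} (hn : Odd n) {p : MvPolynomial (Fin 2) ℚ}
    (hp : MvPolynomial.IsWeightedHomogeneous e p n) (he : ∀ i, Even (e i)) : p = 0 := by
  by_contra h
  obtain ⟨d, hd⟩ := MvPolynomial.ne_zero_iff.1 h
  have := hp hd
  rw [Finsupp.weight_apply, Finsupp.sum_fintype _ _ (by simp), Fin.sum_univ_two] at this
  rw [← this] at hn
  exact (Nat.not_odd_iff_even.2 (((he 0).mul_left _).add ((he 1).mul_left _))) hn

instance : GCDGA (Poly e he) where
  grading n := (MvPolynomial.weightedHomogeneousSubmodule ℚ e n :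
    Submodule ℚ (MvPolynomial (Fin 2) ℚ))
  gradedAlgebra := MvPolynomial.weightedGradedAlgebra ℚ e
  grading_comm i j a b ha hb := by
    rcases Nat.even_or_odd (i * j) with h | h
    · rw [h.neg_one_pow, one_smul, mul_comm]
    · have : a = 0 := eq_zero_of_odd (Nat.odd_mul.1 h).1 ha he
      rw [this]; simp
  d := 0
  d_sq _ := rfl
  d_grading _ _ _ := zero_mem _
  d_leibniz _ _ _ _ := by simp

/-- The variables. -/
def X (e : Fin 2 → ℕ) (he : ∀ i, Even (e i)) (i : Fin 2) : Poly e he :=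
  (MvPolynomial.X i : MvPolynomial (Fin 2) ℚ)

theorem Dd_eq (p : Poly e he) : Dd (Poly e he) p = 0 := rfl

theorem X_mem (i : Fin 2) : X e he i ∈ Gr (Poly e he) (e i) :=
  MvPolynomial.isWeightedHomogeneous_X ℚ e i

theorem adjoin_X : Algebra.adjoin ℚ (Set.range (X e he)) = ⊤ := MvPolynomial.adjoin_range_X

theorem induction {P : Poly e he → Prop} (c : ∀ q : ℚ, P (algebraMap ℚ _ q))
    (add : ∀ p q, P p → P q → P (p + q)) (mul : ∀ p i, P p → P (p * X e he i)) (p : Poly e he) :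
    P p := MvPolynomial.induction_on p c add mul

theorem exists_lift {B : Type} [GCDGA B] (v : Fin 2 → B) (hv : ∀ i, v i ∈ Gr B (e i)) :
    ∃ f : Poly e he →ₐ[ℚ] B, GrHom f ∧ ∀ i, f (X e he i) = v i := by
  have hc : ∀ a ∈ Set.range v, ∀ b ∈ Set.range v, a * b = b * a := by
    rintro _ ⟨i, rfl⟩ b _
    exact even_comm (hv i) (he i) b
  let inst : CommRing (Algebra.adjoin ℚ (Set.range v)) :=
    { (inferInstance : Ring (Algebra.adjoin ℚ (Set.range v))) with
      mul_comm := (Algebra.isMulCommutative_adjoin ℚ hc).is_comm.comm }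
  let u : Fin 2 → Algebra.adjoin ℚ (Set.range v) :=
    fun i => ⟨v i, Algebra.subset_adjoin ⟨i, rfl⟩⟩
  let f : MvPolynomial (Fin 2) ℚ →ₐ[ℚ] B :=
    (Algebra.adjoin ℚ (Set.range v)).val.comp (MvPolynomial.aeval u)
  have hf : ∀ i, f (MvPolynomial.X i) = v i := fun i => by simp [f, u]
  refine ⟨f, fun n p hp => ?_, hf⟩
  have key : ∀ (d : Fin 2 →₀ ℕ) (c : ℚ),
      f (MvPolynomial.monomial d c) = c • (v 0 ^ d 0 * v 1 ^ d 1) := fun d c => by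
    have h : MvPolynomial.monomial d c =
        c • (MvPolynomial.X 0 ^ d 0 * MvPolynomial.X 1 ^ d 1 : MvPolynomial (Fin 2) ℚ) := by
      rw [MvPolynomial.monomial_eq, Finsupp.prod_fintype _ _ (by simp), Fin.prod_univ_two,
        MvPolynomial.smul_eq_C_mul]
    rw [h, map_smul, map_mul, map_pow, map_pow, hf, hf]
  have main : ∀ P : MvPolynomial (Fin 2) ℚ, MvPolynomial.IsWeightedHomogeneous e P n →
      f P ∈ Gr B n := fun P hP => by
    rw [MvPolynomial.as_sum P, map_sum]
    refine Submodule.sum_mem _ fun d hd => ?_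
    have hw := hP (MvPolynomial.mem_support_iff.1 hd)
    rw [Finsupp.weight_apply, Finsupp.sum_fintype _ _ (by simp), Fin.sum_univ_two] at hw
    rw [key, ← hw]
    exact Submodule.smul_mem _ _ (mul_mem_Gr (SetLike.pow_mem_graded _ (hv 0))
      (SetLike.pow_mem_graded _ (hv 1)))
  exact main p hp

theorem freeOn : FreeOn (X e he) e :=
  ⟨X_mem, adjoin_X, fun _ _ v hv => exists_lift v hv⟩

end Poly

/-! ### Finite-dimensional algebras defined by a quadratic form -/

/-- A nondegenerate symmetric bilinear form on the span of two even generators, compatible with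
the degrees. -/
structure QForm (e : Fin 2 → ℕ) where
  even : ∀ i, Even (e i)
  D : ℕ
  b11 : ℚ
  b12 : ℚ
  b22 : ℚ
  h11 : b11 ≠ 0 → e 0 + e 0 = D
  h12 : b12 ≠ 0 → e 0 + e 1 = D
  h22 : b22 ≠ 0 → e 1 + e 1 = D
  nondeg : b11 * b22 - b12 * b12 ≠ 0

theorem QForm.even_D {e : Fin 2 → ℕ} (b : QForm e) : Even b.D := by
  by_cases h : b.b12 = 0
  · by_cases h' : b.b11 = 0
    · exact absurd (by rw [h, h']; ring) b.nondeg
    · rw [← b.h11 h']; exact Even.add (b.even 0) (b.even 0)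
  · rw [← b.h12 h]; exact Even.add (b.even 0) (b.even 1)

/-- The algebra `ℚ ⊕ X ⊕ ℚτ` with product on `X` given by the form `b`. -/
@[ext] structure QAlg {e : Fin 2 → ℕ} (b : QForm e) where
  c : ℚ
  p : ℚ
  q : ℚ
  t : ℚ

namespace QAlg

variable {e : Fin 2 → ℕ} {b : QForm e}

instance : Zero (QAlg b) := ⟨⟨0, 0, 0, 0⟩⟩
instance : One (QAlg b) := ⟨⟨1, 0, 0, 0⟩⟩
instance : Add (QAlg b) := ⟨fun u v => ⟨u.c + v.c, u.p + v.p, u.q + v.q, u.t + v.t⟩⟩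
instance : Neg (QAlg b) := ⟨fun u => ⟨-u.c, -u.p, -u.q, -u.t⟩⟩
instance : Mul (QAlg b) := ⟨fun u v => ⟨u.c * v.c, u.c * v.p + u.p * v.c, u.c * v.q + u.q * v.c,
  u.c * v.t + u.t * v.c + b.b11 * (u.p * v.p) + b.b12 * (u.p * v.q + u.q * v.p) +
    b.b22 * (u.q * v.q)⟩⟩
instance : SMul ℚ (QAlg b) := ⟨fun r u => ⟨r * u.c, r * u.p, r * u.q, r * u.t⟩⟩

@[simp] theorem zero_c : (0 : QAlg b).c = 0 := rfl
@[simp] theorem zero_p : (0 : QAlg b).p = 0 := rfl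
@[simp] theorem zero_q : (0 : QAlg b).q = 0 := rfl
@[simp] theorem zero_t : (0 : QAlg b).t = 0 := rfl
@[simp] theorem one_c : (1 : QAlg b).c = 1 := rfl
@[simp] theorem one_p : (1 : QAlg b).p = 0 := rfl
@[simp] theorem one_q : (1 : QAlg b).q = 0 := rfl
@[simp] theorem one_t : (1 : QAlg b).t = 0 := rfl
@[simp] theorem add_c (u v : QAlg b) : (u + v).c = u.c + v.c := rfl
@[simp] theorem add_p (u v : QAlg b) : (u + v).p = u.p + v.p := rfl
@[simp] theorem add_q (u v : QAlg b) : (u + v).q = u.q + v.q := rfl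
@[simp] theorem add_t (u v : QAlg b) : (u + v).t = u.t + v.t := rfl
@[simp] theorem neg_c (u : QAlg b) : (-u).c = -u.c := rfl
@[simp] theorem neg_p (u : QAlg b) : (-u).p = -u.p := rfl
@[simp] theorem neg_q (u : QAlg b) : (-u).q = -u.q := rfl
@[simp] theorem neg_t (u : QAlg b) : (-u).t = -u.t := rfl
@[simp] theorem mul_c (u v : QAlg b) : (u * v).c = u.c * v.c := rfl
@[simp] theorem mul_p (u v : QAlg b) : (u * v).p = u.c * v.p + u.p * v.c := rfl
@[simp] theorem mul_q (u v : QAlg b) : (u * v).q = u.c * v.q + u.q * v.c := rfl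
@[simp] theorem mul_t (u v : QAlg b) : (u * v).t = u.c * v.t + u.t * v.c + b.b11 * (u.p * v.p) +
    b.b12 * (u.p * v.q + u.q * v.p) + b.b22 * (u.q * v.q) := rfl
@[simp] theorem smul_c (r : ℚ) (u : QAlg b) : (r • u).c = r * u.c := rfl
@[simp] theorem smul_p (r : ℚ) (u : QAlg b) : (r • u).p = r * u.p := rfl
@[simp] theorem smul_q (r : ℚ) (u : QAlg b) : (r • u).q = r * u.q := rfl
@[simp] theorem smul_t (r : ℚ) (u : QAlg b) : (r • u).t = r * u.t := rfl

instance : CommRing (QAlg b) where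
  add_assoc u v w := by ext <;> simp [add_assoc]
  zero_add u := by ext <;> simp
  add_zero u := by ext <;> simp
  add_comm u v := by ext <;> simp [add_comm]
  nsmul := nsmulRec
  zsmul := zsmulRec
  neg_add_cancel u := by ext <;> simp
  mul_assoc u v w := by ext <;> simp <;> ring
  one_mul u := by ext <;> simp
  mul_one u := by ext <;> simp
  zero_mul u := by ext <;> simp
  mul_zero u := by ext <;> simp
  left_distrib u v w := by ext <;> simp <;> ring
  right_distrib u v w := by ext <;> simp <;> ring
  mul_comm u v := by ext <;> simp <;> ring

instance : Module ℚ (QAlg b) where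
  one_smul u := by ext <;> simp
  mul_smul p q u := by ext <;> simp [mul_assoc]
  smul_zero q := by ext <;> simp
  smul_add q u v := by ext <;> simp [mul_add]
  add_smul p q u := by ext <;> simp [add_mul]
  zero_smul u := by ext <;> simp

instance : Algebra ℚ (QAlg b) :=
  Algebra.ofModule (fun q u v => by ext <;> simp <;> ring) (fun q u v => by ext <;> simp <;> ring)

/-- The grading. -/
def gr (b : QForm e) (n : ℕ) : Submodule ℚ (QAlg b) where
  carrier := {u | (n ≠ 0 → u.c = 0) ∧ (n ≠ e 0 → u.p = 0) ∧ (n ≠ e 1 → u.q = 0) ∧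
    (n ≠ b.D → u.t = 0)}
  zero_mem' := by simp
  add_mem' := by
    rintro u v ⟨h1, h2, h3, h4⟩ ⟨k1, k2, k3, k4⟩
    exact ⟨fun h => by simp [h1 h, k1 h], fun h => by simp [h2 h, k2 h],
      fun h => by simp [h3 h, k3 h], fun h => by simp [h4 h, k4 h]⟩
  smul_mem' := by
    rintro r u ⟨h1, h2, h3, h4⟩
    exact ⟨fun h => by simp [h1 h], fun h => by simp [h2 h],
      fun h => by simp [h3 h], fun h => by simp [h4 h]⟩

theorem mem_gr {n : ℕ} {u : QAlg b} : u ∈ gr b n ↔ (n ≠ 0 → u.c = 0) ∧ (n ≠ e 0 → u.p = 0) ∧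
    (n ≠ e 1 → u.q = 0) ∧ (n ≠ b.D → u.t = 0) := Iff.rfl

/-- The projections. -/
def proj (b : QForm e) (n : ℕ) : QAlg b →ₗ[ℚ] QAlg b where
  toFun u := ⟨if n = 0 then u.c else 0, if n = e 0 then u.p else 0, if n = e 1 then u.q else 0,
    if n = b.D then u.t else 0⟩
  map_add' u v := by ext <;> simp <;> split_ifs <;> simp
  map_smul' r u := by ext <;> simp

theorem mul_eq_zero_aux {i j k l : ℕ} {x y : ℚ} (h : i ≠ k → x = 0) (h' : j ≠ l → y = 0)
    (hn : i + j ≠ k + l) : x * y = 0 := by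
  by_cases hi : i = k
  · rw [h' (by omega), mul_zero]
  · rw [h hi, zero_mul]

theorem mul_eq_zero_aux' {i j k l D : ℕ} {x y β : ℚ} (h : i ≠ k → x = 0) (h' : j ≠ l → y = 0)
    (hβ : β ≠ 0 → k + l = D) (hn : i + j ≠ D) : β * (x * y) = 0 := by
  by_cases hb : β = 0
  · rw [hb, zero_mul]
  · rw [mul_eq_zero_aux h h' (by rw [hβ hb]; exact hn), mul_zero]

theorem gr_mul {i j : ℕ} {u v : QAlg b} (hu : u ∈ gr b i) (hv : v ∈ gr b j) :
    u * v ∈ gr b (i + j) := by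
  obtain ⟨h1, h2, h3, h4⟩ := hu
  obtain ⟨k1, k2, k3, k4⟩ := hv
  refine ⟨fun h => mul_eq_zero_aux h1 k1 h, fun h => ?_, fun h => ?_, fun h => ?_⟩
  · rw [mul_p, mul_eq_zero_aux h1 k2 (by omega), mul_eq_zero_aux h2 k1 (by omega), add_zero]
  · rw [mul_q, mul_eq_zero_aux h1 k3 (by omega), mul_eq_zero_aux h3 k1 (by omega), add_zero]
  · rw [mul_t, mul_eq_zero_aux h1 k4 (by omega), mul_eq_zero_aux h4 k1 (by omega),
      mul_eq_zero_aux' h2 k2 b.h11 h, mul_add, mul_eq_zero_aux' h2 k3 b.h12 h,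
      mul_eq_zero_aux' h3 k2 (fun hb => (add_comm _ _).trans (b.h12 hb)) h,
      mul_eq_zero_aux' h3 k3 b.h22 h]
    simp

theorem eq_zero_of_odd {n : ℕ} (hn : Odd n) {u : QAlg b} (hu : u ∈ gr b n) : u = 0 := by
  have h : ∀ k, Even k → n ≠ k := fun k hk h => Nat.not_odd_iff_even.2 hk (h ▸ hn)
  ext
  · exact hu.1 (h _ Even.zero)
  · exact hu.2.1 (h _ (b.even 0))
  · exact hu.2.2.1 (h _ (b.even 1))
  · exact hu.2.2.2 (h _ b.even_D)

instance : GCDGA (QAlg b) where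
  grading := gr b
  gradedAlgebra := by
    refine gradedOfProj _ (proj b) ⟨by simp, by simp, by simp, by simp⟩
      (fun i j u v hu hv => gr_mul hu hv) ?_ ?_ ?_
    · rintro n u ⟨h1, h2, h3, h4⟩
      ext <;> simp only [proj, LinearMap.coe_mk, AddHom.coe_mk] <;> split_ifs with h
      · rfl
      · exact (h1 h).symm
      · rfl
      · exact (h2 h).symm
      · rfl
      · exact (h3 h).symm
      · rfl
      · exact (h4 h).symm
    · rintro m n hmn u ⟨h1, h2, h3, h4⟩
      ext <;> simp only [proj, LinearMap.coe_mk, AddHom.coe_mk] <;> split_ifs with h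
      · exact h1 (by omega)
      · rfl
      · exact h2 (by omega)
      · rfl
      · exact h3 (by omega)
      · rfl
      · exact h4 (by omega)
      · rfl
    · intro u
      have : u = ⟨u.c, 0, 0, 0⟩ + ⟨0, u.p, 0, 0⟩ + ⟨0, 0, u.q, 0⟩ + ⟨0, 0, 0, u.t⟩ := by
        ext <;> simp
      rw [this]
      refine add_mem (add_mem (add_mem ?_ ?_) ?_) ?_
      · exact Submodule.mem_iSup_of_mem 0 (mem_gr.2 (by simp))
      · exact Submodule.mem_iSup_of_mem (e 0) (mem_gr.2 (by simp))
      · exact Submodule.mem_iSup_of_mem (e 1) (mem_gr.2 (by simp))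
      · exact Submodule.mem_iSup_of_mem b.D (mem_gr.2 (by simp))
  grading_comm i j u v hu hv := by
    rcases Nat.even_or_odd (i * j) with h | h
    · rw [h.neg_one_pow, one_smul, mul_comm]
    · rw [eq_zero_of_odd (Nat.odd_mul.1 h).1 hu]; simp
  d := 0
  d_sq _ := rfl
  d_grading _ _ _ := zero_mem _
  d_leibniz _ _ _ _ := by simp

theorem Dd_eq (u : QAlg b) : Dd (QAlg b) u = 0 := rfl

/-- The generators. -/
def x (b : QForm e) : Fin 2 → QAlg b := ![⟨0, 1, 0, 0⟩, ⟨0, 0, 1, 0⟩]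

/-- The top class. -/
def τ (b : QForm e) : QAlg b := ⟨0, 0, 0, 1⟩

theorem x_mem (i : Fin 2) : x b i ∈ Gr (QAlg b) (e i) := by
  fin_cases i <;> exact mem_gr.2 (by simp [x])

theorem τ_mem : τ b ∈ Gr (QAlg b) b.D := mem_gr.2 (by simp [τ])

theorem τ_not_exact (u : QAlg b) : τ b ≠ Dd (QAlg b) u := by
  rw [Dd_eq]; intro h; simpa [τ] using congrArg QAlg.t h

theorem x00 : x b 0 * x b 0 = b.b11 • τ b := by ext <;> simp [x, τ]
theorem x01 : x b 0 * x b 1 = b.b12 • τ b := by ext <;> simp [x, τ]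
theorem x11 : x b 1 * x b 1 = b.b22 • τ b := by ext <;> simp [x, τ]
theorem x_mul_τ (i : Fin 2) : x b i * τ b = 0 := by fin_cases i <;> ext <;> simp [x, τ]

end QAlg

/-! ### The complete intersections defined by quadratic forms -/

theorem Adj.sgn_eq {B : Type} [GCDGA B] {c : OddCocycle B} (u : Adj B c) :
    sgn (Adj B c) u = ⟨sgn B u.1, -sgn B u.2⟩ := by
  conv_lhs => rw [Adj.eq_inl_add u]
  rw [map_add, map_mul, ← Adj.inl_dga.gr.sgn, ← Adj.inl_dga.gr.sgn, sgn_of_odd Adj.w_mem c.odd]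
  ext <;> simp

/-- The quadratic polynomial with given coefficients. -/
def quad {R : Type} [Ring R] [Algebra ℚ R] (x : Fin 2 → R) (c : Fin 3 → ℚ) : R :=
  c 0 • (x 0 * x 0) + c 1 • (x 0 * x 1) + c 2 • (x 1 * x 1)

theorem map_quad {R R' : Type} [Ring R] [Algebra ℚ R] [Ring R'] [Algebra ℚ R'] (f : R →ₐ[ℚ] R')
    (x : Fin 2 → R) (c : Fin 3 → ℚ) : f (quad x c) = quad (f ∘ x) c := by
  simp [quad]

/-- The value of a form on a quadratic polynomial. -/
def QForm.ev {e : Fin 2 → ℕ} (b : QForm e) (c : Fin 3 → ℚ) : ℚ :=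
  c 0 * b.b11 + c 1 * b.b12 + c 2 * b.b22

variable {e : Fin 2 → ℕ}

theorem QAlg.quad_x (b : QForm e) (c : Fin 3 → ℚ) : quad (QAlg.x b) c = b.ev c • QAlg.τ b := by
  rw [quad, QAlg.x00, QAlg.x01, QAlg.x11, smul_smul, smul_smul, smul_smul, ← add_smul, ← add_smul,
    QForm.ev]

theorem Poly.sgn_eq {he : ∀ i, Even (e i)} (p : Poly e he) : sgn (Poly e he) p = p := by
  have h : sgn (Poly e he) = AlgHom.id ℚ _ := algHom_ext_gens Poly.adjoin_X fun i =>
    sgn_of_even (Poly.X_mem i) (he i)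
  rw [h]; rfl

instance {he : ∀ i, Even (e i)} : IsDomain (Poly e he) :=
  inferInstanceAs (IsDomain (MvPolynomial (Fin 2) ℚ))
instance {he : ∀ i, Even (e i)} : UniqueFactorizationMonoid (Poly e he) :=
  inferInstanceAs (UniqueFactorizationMonoid (MvPolynomial (Fin 2) ℚ))

/-- The map from the polynomial algebra to the algebra of a form. -/
def polyToQ (b : QForm e) : Poly e b.even →ₐ[ℚ] QAlg b :=
  (Poly.exists_lift (QAlg.x b) QAlg.x_mem).choose

theorem polyToQ_gr (b : QForm e) : GrHom (polyToQ b) :=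
  (Poly.exists_lift (QAlg.x b) QAlg.x_mem).choose_spec.1

theorem polyToQ_X (b : QForm e) (i : Fin 2) : polyToQ b (Poly.X e b.even i) = QAlg.x b i :=
  (Poly.exists_lift (QAlg.x b) QAlg.x_mem).choose_spec.2 i

theorem polyToQ_dga (b : QForm e) : IsDGAHom (polyToQ b) :=
  ⟨fun _ => map_zero _, polyToQ_gr b⟩

theorem polyToQ_quad (b : QForm e) (c : Fin 3 → ℚ) :
    polyToQ b (quad (Poly.X e b.even) c) = b.ev c • QAlg.τ b := by
  rw [map_quad, ← QAlg.quad_x]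
  congr 1
  ext1 i
  exact polyToQ_X b i

theorem QForm.exists_ev_one (b : QForm e) : ∃ c, b.ev c = 1 := by
  by_cases h : b.b12 = 0
  · have h1 : b.b11 ≠ 0 := fun h' => b.nondeg (by rw [h, h']; ring)
    exact ⟨![b.b11⁻¹, 0, 0], by simp [QForm.ev, h1]⟩
  · exact ⟨![0, b.b12⁻¹, 0], by simp [QForm.ev, h]⟩

/-- An ideal containing all quadrics killed by the form contains all cubics. -/
theorem QForm.cubic_mem (b : QForm e) {I : Ideal (Poly e b.even)}
    (hI : ∀ c, b.ev c = 0 → quad (Poly.X e b.even) c ∈ I) (i j k : Fin 2) :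
    Poly.X e b.even i * (Poly.X e b.even j * Poly.X e b.even k) ∈ I := by
  have m1 := hI ![b.b12, -b.b11, 0] (by simp [QForm.ev]; ring)
  have m2 := hI ![b.b22, 0, -b.b11] (by simp [QForm.ev]; ring)
  have m3 := hI ![0, b.b22, -b.b12] (by simp [QForm.ev]; ring)
  simp only [quad, Algebra.smul_def, Matrix.cons_val, map_neg, map_zero] at m1 m2 m3
  set x := Poly.X e b.even 0
  set y := Poly.X e b.even 1
  set B11 := algebraMap ℚ (Poly e b.even) b.b11 with h11
  set B12 := algebraMap ℚ (Poly e b.even) b.b12 with h12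
  set B22 := algebraMap ℚ (Poly e b.even) b.b22 with h22
  have hδ : ∀ p, (B11 * B22 - B12 * B12) * p ∈ I → p ∈ I := fun p hp => by
    have := I.mul_mem_left (algebraMap ℚ (Poly e b.even) (b.b11 * b.b22 - b.b12 * b.b12)⁻¹) hp
    rwa [h11, h12, h22, ← map_mul, ← map_mul, ← map_sub, ← mul_assoc, ← map_mul,
      inv_mul_cancel₀ b.nondeg, map_one, one_mul] at this
  have a1 : x * (x * x) ∈ I := hδ _ (by
    convert I.add_mem (I.mul_mem_left (B11 * x) m2) (I.mul_mem_left (-B12 * x - B11 * y) m1) using 1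
    ring)
  have a2 : x * (x * y) ∈ I := hδ _ (by
    convert I.add_mem (I.mul_mem_left (B11 * x) m3) (I.mul_mem_left (-B12 * y) m1) using 1
    ring)
  have a3 : x * (y * y) ∈ I := hδ _ (by
    convert I.add_mem (I.mul_mem_left (B12 * x) m3) (I.mul_mem_left (-B22 * y) m1) using 1
    ring)
  have a4 : y * (y * y) ∈ I := hδ _ (by
    convert I.add_mem (I.mul_mem_left (B12 * y + B22 * x) m3)
      (I.mul_mem_left (-B22 * y) m2) using 1
    ring)
  fin_cases i <;> fin_cases j <;> fin_cases k
  · exact a1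
  · exact a2
  · exact (by simpa [mul_left_comm, mul_comm] using a2)
  · exact a3
  · exact (show y * (x * x) ∈ I by rw [mul_left_comm, mul_comm y x]; exact a2)
  · exact (show y * (x * y) ∈ I by rw [mul_left_comm]; exact a3)
  · exact (show y * (y * x) ∈ I by rw [mul_comm y x, mul_left_comm]; exact a3)
  · exact a4

/-- Data presenting the algebra of a form as a complete intersection of two quadrics. -/
structure Regular (b : QForm e) where
  c₁ : Fin 3 → ℚ
  c₂ : Fin 3 → ℚ
  ev₁ : b.ev c₁ = 0
  ev₂ : b.ev c₂ = 0
  span : ∀ c, b.ev c = 0 → ∃ u v : ℚ, c = u • c₁ + v • c₂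
  z₁ : OddCocycle (Poly e b.even)
  z₂ : OddCocycle (Poly e b.even)
  hz₁ : z₁.z = quad (Poly.X e b.even) c₁
  hz₂ : z₂.z = quad (Poly.X e b.even) c₂

namespace Regular

variable {b : QForm e} (D : Regular b)

theorem quad_add {R : Type} [Ring R] [Algebra ℚ R] (x : Fin 2 → R) (c c' : Fin 3 → ℚ) :
    quad x (c + c') = quad x c + quad x c' := by
  simp only [quad, Pi.add_apply, add_smul]; abel

theorem quad_smul {R : Type} [Ring R] [Algebra ℚ R] (x : Fin 2 → R) (r : ℚ) (c : Fin 3 → ℚ) :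
    quad x (r • c) = r • quad x c := by
  simp only [quad, Pi.smul_apply, smul_add, smul_smul, smul_eq_mul]

theorem quad_mem (c : Fin 3 → ℚ) (hc : b.ev c = 0) :
    quad (Poly.X e b.even) c ∈ Ideal.span {D.z₁.z, D.z₂.z} := by
  obtain ⟨u, v, rfl⟩ := D.span c hc
  rw [quad_add, quad_smul, quad_smul, ← D.hz₁, ← D.hz₂, Algebra.smul_def, Algebra.smul_def]
  exact Ideal.mem_span_pair.2 ⟨_, _, rfl⟩

theorem polyToQ_z₁ : polyToQ b D.z₁.z = 0 := by rw [D.hz₁, polyToQ_quad, D.ev₁, zero_smul]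
theorem polyToQ_z₂ : polyToQ b D.z₂.z = 0 := by rw [D.hz₂, polyToQ_quad, D.ev₂, zero_smul]

theorem mem_of_polyToQ {p : Poly e b.even} (hp : polyToQ b p = 0) :
    p ∈ Ideal.span {D.z₁.z, D.z₂.z} := by
  set I := Ideal.span {D.z₁.z, D.z₂.z} with hI
  obtain ⟨γ, hγ⟩ := b.exists_ev_one
  let X := Poly.X e b.even
  have hX3 := b.cubic_mem D.quad_mem
  have hXt : ∀ i, X i * quad X γ ∈ I := fun i => by
    rw [quad, mul_add, mul_add, mul_smul_comm, mul_smul_comm, mul_smul_comm,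
      Algebra.smul_def, Algebra.smul_def, Algebra.smul_def]
    exact add_mem (add_mem (I.mul_mem_left _ (hX3 _ _ _)) (I.mul_mem_left _ (hX3 _ _ _)))
      (I.mul_mem_left _ (hX3 _ _ _))
  have hq : ∀ c, quad X c - b.ev c • quad X γ ∈ I := fun c => by
    have := D.quad_mem (c + (-b.ev c) • γ) (by
      have h : b.ev (c + (-b.ev c) • γ) = b.ev c + (-b.ev c) * b.ev γ := by
        simp only [QForm.ev, Pi.add_apply, Pi.smul_apply, smul_eq_mul]; ring
      rw [h, hγ]; ring)
    rw [quad_add, quad_smul, neg_smul, ← sub_eq_add_neg] at this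
    exact this
  have hXX : ∀ i j, ∃ s : ℚ, X i * X j - s • quad X γ ∈ I := by
    have h0 := hq ![1, 0, 0]
    have h1 := hq ![0, 1, 0]
    have h2 := hq ![0, 0, 1]
    simp only [quad, Matrix.cons_val, zero_smul, one_smul, add_zero, zero_add] at h0 h1 h2
    intro i j
    fin_cases i <;> fin_cases j
    · exact ⟨_, h0⟩
    · exact ⟨_, h1⟩
    · exact ⟨_, by rw [mul_comm]; exact h1⟩
    · exact ⟨_, h2⟩
  have key : ∀ p : Poly e b.even, ∃ u v w s : ℚ,
      p - (algebraMap ℚ _ u + v • X 0 + w • X 1 + s • quad X γ) ∈ I := by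
    intro p
    induction p using Poly.induction with
    | c q => exact ⟨q, 0, 0, 0, by simp⟩
    | add p q hp hq =>
      obtain ⟨u, v, w, s, h⟩ := hp
      obtain ⟨u', v', w', s', h'⟩ := hq
      refine ⟨u + u', v + v', w + w', s + s', ?_⟩
      convert add_mem h h' using 1
      simp only [map_add, add_smul]; ring
    | mul p i hp =>
      obtain ⟨u, v, w, s, h⟩ := hp
      obtain ⟨s0, h0⟩ := hXX 0 i
      obtain ⟨s1, h1⟩ := hXX 1 i
      have e1 := I.mul_mem_right (X i) h
      have e2 := I.mul_mem_left (algebraMap ℚ _ v) h0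
      have e3 := I.mul_mem_left (algebraMap ℚ _ w) h1
      have e4 := I.mul_mem_left (algebraMap ℚ _ s) (hXt i)
      have e5 := add_mem (add_mem (add_mem e1 e2) e3) e4
      have hu : p * X i - (u • X i + (v * s0 + w * s1) • quad X γ) ∈ I := by
        convert e5 using 1
        simp only [Algebra.smul_def, map_add, map_mul]; ring
      fin_cases i
      · exact ⟨0, u, 0, _, by simpa using hu⟩
      · exact ⟨0, 0, u, _, by simpa using hu⟩
  have hI0 : ∀ q ∈ I, polyToQ b q = 0 := fun q hq => by
    obtain ⟨c, d, rfl⟩ := Ideal.mem_span_pair.1 hq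
    rw [map_add, map_mul, map_mul, D.polyToQ_z₁, D.polyToQ_z₂]; simp
  obtain ⟨u, v, w, s, h⟩ := key p
  have h0 := hI0 _ h
  rw [map_sub, hp, zero_sub, neg_eq_zero, map_add, map_add, map_add, map_smul, map_smul, map_smul,
    polyToQ_X, polyToQ_X, polyToQ_quad, hγ, AlgHom.commutes, Algebra.algebraMap_eq_smul_one] at h0
  have hu : u = 0 := by simpa [QAlg.x, QAlg.τ] using congrArg QAlg.c h0
  have hv : v = 0 := by simpa [QAlg.x, QAlg.τ] using congrArg QAlg.p h0
  have hw : w = 0 := by simpa [QAlg.x, QAlg.τ] using congrArg QAlg.q h0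
  have hs : s = 0 := by simpa [QAlg.x, QAlg.τ] using congrArg QAlg.t h0
  simpa [hu, hv, hw, hs] using h

theorem X_relPrime {he : ∀ i, Even (e i)} : IsRelPrime (Poly.X e he 0) (Poly.X e he 1) := by
  have h0 : Prime (MvPolynomial.X 0 : MvPolynomial (Fin 2) ℚ) := MvPolynomial.X_prime
  refine (Irreducible.isRelPrime_iff_not_dvd (show Irreducible (Poly.X e he 0) from
    h0.irreducible)).2 fun h => ?_
  have h : (MvPolynomial.X 0 : MvPolynomial (Fin 2) ℚ) ∣ MvPolynomial.X 1 := h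
  rw [MvPolynomial.X_dvd_X] at h
  simp at h

theorem z_relPrime : IsRelPrime D.z₁.z D.z₂.z := by
  intro d h1 h2
  have hd : ∀ p ∈ Ideal.span {D.z₁.z, D.z₂.z}, d ∣ p := fun p hp => by
    obtain ⟨u, v, rfl⟩ := Ideal.mem_span_pair.1 hp
    exact dvd_add (h1.mul_left _) (h2.mul_left _)
  have hX3 := b.cubic_mem D.quad_mem
  have hr : IsRelPrime (Poly.X e b.even 0 ^ 3) (Poly.X e b.even 1 ^ 3) := X_relPrime.pow
  refine hr ?_ ?_
  · rw [pow_succ', pow_two]; exact hd _ (hX3 0 0 0)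
  · rw [pow_succ', pow_two]; exact hd _ (hX3 1 1 1)

theorem z₁_ne_zero : D.z₁.z ≠ 0 := fun h0 => by
  have := D.z_relPrime (h0 ▸ dvd_zero _) dvd_rfl
  have := this.map (polyToQ b)
  rw [D.polyToQ_z₂, isUnit_zero_iff] at this
  simpa using congrArg QAlg.c this

theorem syzygy {p q : Poly e b.even} (h : p * D.z₁.z + q * D.z₂.z = 0) :
    ∃ k, q = k * D.z₁.z ∧ p = -(k * D.z₂.z) := by
  have h1 : D.z₁.z ∣ q * D.z₂.z := ⟨-p, by linear_combination h⟩
  obtain ⟨k, hk⟩ := D.z_relPrime.dvd_of_dvd_mul_right h1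
  refine ⟨k, by rw [hk, mul_comm], ?_⟩
  rw [← sub_eq_zero]
  refine (mul_eq_zero.1 (?_ : D.z₁.z * (p - -(k * D.z₂.z)) = 0)).resolve_left D.z₁_ne_zero
  rw [hk] at h; linear_combination h

/-- The Koszul algebra of the two quadrics. -/
abbrev Kos : Type := Adj (Adj (Poly e b.even) D.z₁) (D.z₂.map (Adj.inl _ D.z₁) Adj.inl_dga)

/-- The resolution of the algebra of a form by the Koszul algebra. -/
def kosToQ : D.Kos →ₐ[ℚ] QAlg b :=
  Adj.lift (Adj.lift (polyToQ b) (polyToQ_gr b) 0 (zero_mem _)) (Adj.lift_gr _ _ _ _) 0 (zero_mem _)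

theorem kosToQ_apply (u : D.Kos) : D.kosToQ u = polyToQ b u.1.1 := by
  rw [kosToQ, Adj.lift_apply, Adj.lift_apply]; simp

theorem kosToQ_dga : IsDGAHom D.kosToQ :=
  Adj.lift_dga _ (Adj.lift_dga _ (polyToQ_dga b) _ _ (by rw [map_zero, D.polyToQ_z₁])) _ _ (by
    rw [map_zero]
    exact (D.polyToQ_z₂.symm.trans (Adj.lift_inl _ _ _ _ _).symm))

theorem kos_Dd (a p q r : Poly e b.even) : Dd D.Kos ⟨⟨a, p⟩, ⟨q, r⟩⟩ =
    ⟨⟨p * D.z₁.z + q * D.z₂.z, -(r * D.z₂.z)⟩, ⟨r * D.z₁.z, 0⟩⟩ := by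
  have h1 : ∀ a p, Dd (Adj (Poly e b.even) D.z₁) ⟨a, p⟩ = ⟨p * D.z₁.z, 0⟩ := fun a p => by
    ext
    · rw [Adj.Dd_fst, Poly.Dd_eq, Poly.sgn_eq, zero_add]
    · rw [Adj.Dd_snd, Poly.Dd_eq]
  ext1
  · rw [Adj.Dd_fst, h1, Adj.sgn_eq, Poly.sgn_eq, Poly.sgn_eq]
    change _ + _ * Adj.inl _ D.z₁ D.z₂.z = _
    ext
    · simp
    · simp [Poly.sgn_eq]
  · rw [Adj.Dd_snd, h1]

theorem kosToQ_surjAcyc : SurjAcyc D.kosToQ := by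
  constructor
  · intro u
    have hs : Function.Surjective (polyToQ b) := fun u => by
      obtain ⟨γ, hγ⟩ := b.exists_ev_one
      refine ⟨algebraMap ℚ _ u.c + u.p • Poly.X e b.even 0 + u.q • Poly.X e b.even 1 +
        u.t • quad (Poly.X e b.even) γ, ?_⟩
      rw [map_add, map_add, map_add, map_smul, map_smul, map_smul,
        polyToQ_X, polyToQ_X, polyToQ_quad, hγ, AlgHom.commutes, Algebra.algebraMap_eq_smul_one]
      ext <;> simp [QAlg.x, QAlg.τ]
    obtain ⟨p, rfl⟩ := hs u
    exact ⟨⟨⟨p, 0⟩, 0⟩, D.kosToQ_apply _⟩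
  · rintro ⟨⟨a, p⟩, ⟨q, r⟩⟩ h0 hd
    rw [kosToQ_apply] at h0
    rw [kos_Dd] at hd
    have h1 := congrArg (fun u : D.Kos => u.1.1) hd
    have h3 := congrArg (fun u : D.Kos => u.2.1) hd
    obtain ⟨k, hq, hp⟩ := D.syzygy h1
    obtain ⟨u, v, ha⟩ := Ideal.mem_span_pair.1 (D.mem_of_polyToQ h0)
    have hr : r = 0 := (mul_eq_zero.1 h3).resolve_right D.z₁_ne_zero
    refine ⟨⟨⟨0, u⟩, ⟨v, k⟩⟩, ?_, ?_⟩
    · rw [kosToQ_apply, map_zero]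
    · rw [kos_Dd, ha, ← hp, ← hq, hr]

end Regular

/-! ### The graded tensor product of two cdga's -/

open TensorProduct in
/-- The graded tensor product of two graded algebras. -/
abbrev TA (A B : Type) [GCDGA A] [GCDGA B] : Type := GradedTensorProduct ℚ (Gr A) (Gr B)

namespace TA

variable {A B A' B' C : Type} [GCDGA A] [GCDGA B] [GCDGA A'] [GCDGA B'] [GCDGA C]

/-- Pure tensors. -/
def tm (a : A) (b : B) : TA A B := GradedTensorProduct.tmul ℚ a b

theorem tm_add (a : A) (b b' : B) : tm a (b + b') = tm a b + tm a b' := by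
  rw [tm, GradedTensorProduct.tmul, TensorProduct.tmul_add, map_add]; rfl

theorem add_tm (a a' : A) (b : B) : tm (a + a') b = tm a b + tm a' b := by
  rw [tm, GradedTensorProduct.tmul, TensorProduct.add_tmul, map_add]; rfl

theorem smul_tm (c : ℚ) (a : A) (b : B) : tm (c • a) b = c • tm a b := by
  rw [tm, GradedTensorProduct.tmul, ← TensorProduct.smul_tmul', map_smul]; rfl

theorem tm_smul (c : ℚ) (a : A) (b : B) : tm a (c • b) = c • tm a b := by
  rw [tm, GradedTensorProduct.tmul, TensorProduct.tmul_smul, map_smul]; rfl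

@[simp] theorem tm_zero (a : A) : tm a (0 : B) = 0 := by simp [tm]

@[simp] theorem zero_tm (b : B) : tm (0 : A) b = 0 := by simp [tm]

theorem neg_tm (a : A) (b : B) : tm (-a) b = -tm a b := by
  rw [← neg_one_smul ℚ a, smul_tm, neg_one_smul]

theorem tm_mul {i j : ℕ} (a : A) {b : B} {a' : A} (b' : B) (hb : b ∈ Gr B j) (ha : a' ∈ Gr A i) :
    tm a b * tm a' b' = ((-1 : ℚ) ^ (j * i)) • tm (a * a') (b * b') := by
  have := GradedTensorProduct.tmul_coe_mul_coe_tmul (R := ℚ) (Gr A) (Gr B) a ⟨b, hb⟩ ⟨a', ha⟩ b'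
  rw [Units.smul_def, ← Int.cast_smul_eq_zsmul ℚ] at this
  simpa [tm] using this

/-- Maps on the tensor product. -/
def lmap (f : A →ₗ[ℚ] A') (g : B →ₗ[ℚ] B') : TA A B →ₗ[ℚ] TA A' B' :=
  (GradedTensorProduct.of ℚ (Gr A') (Gr B')).toLinearMap ∘ₗ TensorProduct.map f g ∘ₗ
    (GradedTensorProduct.of ℚ (Gr A) (Gr B)).symm.toLinearMap

@[simp] theorem lmap_tm (f : A →ₗ[ℚ] A') (g : B →ₗ[ℚ] B') (a : A) (b : B) :
    lmap f g (tm a b) = tm (f a) (g b) := rfl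

theorem ind {p : TA A B → Prop} (pure : ∀ a b, p (tm a b)) (add : ∀ s t, p s → p t → p (s + t))
    (t : TA A B) : p t := by
  have : ∀ s : TensorProduct ℚ A B, p (GradedTensorProduct.of ℚ (Gr A) (Gr B) s) := by
    intro s
    induction s using TensorProduct.induction_on with
    | zero => rw [map_zero, ← tm_zero (A := A) (B := B) 0]; exact pure 0 0
    | tmul a b => exact pure a b
    | add s t hs ht => rw [map_add]; exact add _ _ hs ht
  exact this ((GradedTensorProduct.of ℚ (Gr A) (Gr B)).symm t)

theorem hom_ind {p : TA A B → Prop}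
    (pure : ∀ i j, ∀ a ∈ Gr A i, ∀ b ∈ Gr B j, p (tm a b))
    (add : ∀ s t, p s → p t → p (s + t)) (t : TA A B) : p t := by
  induction t using ind with
  | add s t hs ht => exact add s t hs ht
  | pure a b =>
    induction a using Gr_induction with
    | add a a' h h' => rw [add_tm]; exact add _ _ h h'
    | hom i a ha =>
      induction b using Gr_induction with
      | add b b' h h' => rw [tm_add]; exact add _ _ h h'
      | hom j b hb => exact pure i j a ha b hb

/-- The grading of the tensor product. -/
def gr (A B : Type) [GCDGA A] [GCDGA B] (n : ℕ) : Submodule ℚ (TA A B) :=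
  Submodule.span ℚ {t | ∃ i j, i + j = n ∧ ∃ a ∈ Gr A i, ∃ b ∈ Gr B j, t = tm a b}

theorem tm_mem {i j : ℕ} {a : A} {b : B} (ha : a ∈ Gr A i) (hb : b ∈ Gr B j) :
    tm a b ∈ gr A B (i + j) :=
  Submodule.subset_span ⟨i, j, rfl, a, ha, b, hb, rfl⟩

/-- The differential of the tensor product. -/
def dT (A B : Type) [GCDGA A] [GCDGA B] : TA A B →ₗ[ℚ] TA A B :=
  lmap (Dd A) LinearMap.id + lmap (sgn A).toLinearMap (Dd B)

theorem dT_tm (a : A) (b : B) : dT A B (tm a b) = tm (Dd A a) b + tm (sgn A a) (Dd B b) := rfl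

/-- The projections to the homogeneous components of the tensor product. -/
def proj (A B : Type) [GCDGA A] [GCDGA B] (n : ℕ) : TA A B →ₗ[ℚ] TA A B :=
  ∑ p ∈ Finset.HasAntidiagonal.antidiagonal n, lmap (pr A p.1) (pr B p.2)

theorem proj_tm (n : ℕ) {i j : ℕ} {a : A} {b : B} (ha : a ∈ Gr A i) (hb : b ∈ Gr B j) :
    proj A B n (tm a b) = if i + j = n then tm a b else 0 := by
  simp only [proj, LinearMap.sum_apply, lmap_tm]
  split_ifs with h
  · rw [Finset.sum_eq_single (i, j), pr_of_mem ha, pr_of_mem hb]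
    · rintro ⟨k, l⟩ _ hne
      by_cases hk : k = i
      · subst hk
        have hl : l ≠ j := fun hl => hne (by rw [hl])
        rw [pr_of_ne hb hl, tm_zero]
      · rw [pr_of_ne ha hk, zero_tm]
    · intro h'; exact absurd (Finset.HasAntidiagonal.mem_antidiagonal.2 h) h'
  · refine Finset.sum_eq_zero ?_
    rintro ⟨k, l⟩ hkl
    rw [Finset.HasAntidiagonal.mem_antidiagonal] at hkl
    by_cases hk : k = i
    · subst hk
      have hl : l ≠ j := by rintro rfl; exact h hkl
      rw [pr_of_ne hb hl, tm_zero]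
    · rw [pr_of_ne ha hk, zero_tm]

theorem one_mem : (1 : TA A B) ∈ gr A B 0 := by
  have := tm_mem (one_mem_Gr (A := A)) (one_mem_Gr (A := B))
  rwa [add_zero] at this

theorem gr_mul (i j : ℕ) (s t : TA A B) (hs : s ∈ gr A B i) (ht : t ∈ gr A B j) :
    s * t ∈ gr A B (i + j) := by
  induction hs using Submodule.span_induction with
  | zero => rw [zero_mul]; exact zero_mem _
  | add x y _ _ hx hy => rw [add_mul]; exact add_mem hx hy
  | smul c x _ hx => rw [smul_mul_assoc]; exact Submodule.smul_mem _ _ hx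
  | mem x hx =>
    obtain ⟨k, l, rfl, a, ha, b, hb, rfl⟩ := hx
    induction ht using Submodule.span_induction with
    | zero => rw [mul_zero]; exact zero_mem _
    | add x y _ _ hx hy => rw [mul_add]; exact add_mem hx hy
    | smul c x _ hx => rw [mul_smul_comm]; exact Submodule.smul_mem _ _ hx
    | mem x hx =>
      obtain ⟨k', l', rfl, a', ha', b', hb', rfl⟩ := hx
      rw [tm_mul a b' hb ha']
      refine Submodule.smul_mem _ _ ?_
      have := tm_mem (mul_mem_Gr ha ha') (mul_mem_Gr hb hb')
      rwa [show k + k' + (l + l') = k + l + (k' + l') by ring] at this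

/-- The grading on the tensor product is an algebra grading. -/
@[reducible] def gradedAlg (A B : Type) [GCDGA A] [GCDGA B] : GradedAlgebra (gr A B) :=
  gradedOfProj (gr A B) (proj A B) one_mem gr_mul
    (fun n x hx => by
      induction hx using Submodule.span_induction with
      | zero => rw [map_zero]
      | add x y _ _ hx hy => rw [map_add, hx, hy]
      | smul c x _ hx => rw [map_smul, hx]
      | mem x hx =>
        obtain ⟨k, l, hkl, a, ha, b, hb, rfl⟩ := hx
        rw [proj_tm n ha hb, if_pos hkl])
    (fun m n hmn x hx => by
      induction hx using Submodule.span_induction with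
      | zero => rw [map_zero]
      | add x y _ _ hx hy => rw [map_add, hx, hy, add_zero]
      | smul c x _ hx => rw [map_smul, hx, smul_zero]
      | mem x hx =>
        obtain ⟨k, l, hkl, a, ha, b, hb, rfl⟩ := hx
        rw [proj_tm m ha hb, if_neg (by omega)])
    (fun x => by
      induction x using hom_ind with
      | add s t hs ht => exact add_mem hs ht
      | pure i j a ha b hb => exact Submodule.mem_iSup_of_mem (i + j) (tm_mem ha hb))

theorem gr_comm (i j : ℕ) (s t : TA A B) (hs : s ∈ gr A B i) (ht : t ∈ gr A B j) :
    s * t = ((-1 : ℚ) ^ (i * j)) • (t * s) := by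
  induction hs using Submodule.span_induction with
  | zero => simp
  | add x y _ _ hx hy => rw [add_mul x y, hx, hy, mul_add t, smul_add]
  | smul c x _ hx => rw [smul_mul_assoc, hx, mul_smul_comm, smul_comm]
  | mem x hx =>
    obtain ⟨k, l, rfl, a, ha, b, hb, rfl⟩ := hx
    induction ht using Submodule.span_induction with
    | zero => simp
    | add x y _ _ hx hy => rw [mul_add, hx, hy, add_mul x y, smul_add]
    | smul c x _ hx => rw [mul_smul_comm, hx, smul_mul_assoc, smul_comm]
    | mem x hx =>
      obtain ⟨k', l', rfl, a', ha', b', hb', rfl⟩ := hx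
      rw [tm_mul a b' hb ha', tm_mul a' b hb' ha, Gr_comm ha ha', Gr_comm hb hb', smul_tm, tm_smul,
        smul_smul, smul_smul, smul_smul]
      congr 1
      have h2 : ((-1 : ℚ) ^ (l' * k)) * (-1) ^ (l' * k) = 1 := by
        rw [← mul_pow]; simp
      rw [add_mul, mul_add, mul_add, pow_add, pow_add, pow_add, mul_comm k l']
      linear_combination (-(-1 : ℚ) ^ (l * k') * (-1) ^ (k * k') * (-1) ^ (l * l')) * h2

theorem dT_dT (t : TA A B) : dT A B (dT A B t) = 0 := by
  induction t using ind with
  | add s t hs ht => rw [map_add, map_add, hs, ht, add_zero]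
  | pure a b =>
    rw [dT_tm, map_add, dT_tm, dT_tm]
    simp [Dd_sgn, neg_tm]

theorem dT_gr (n : ℕ) (t : TA A B) (ht : t ∈ gr A B n) : dT A B t ∈ gr A B (n + 1) := by
  induction ht using Submodule.span_induction with
  | zero => rw [map_zero]; exact zero_mem _
  | add x y _ _ hx hy => rw [map_add]; exact add_mem hx hy
  | smul c x _ hx => rw [map_smul]; exact Submodule.smul_mem _ _ hx
  | mem x hx =>
    obtain ⟨k, l, rfl, a, ha, b, hb, rfl⟩ := hx
    rw [dT_tm]
    have h1 := tm_mem (Dd_mem ha) hb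
    rw [show k + 1 + l = k + l + 1 by ring] at h1
    have h2 := tm_mem (sgn_mem ha) (Dd_mem hb)
    rw [← add_assoc] at h2
    exact add_mem h1 h2

theorem dT_leibniz (n : ℕ) (s t : TA A B) (hs : s ∈ gr A B n) :
    dT A B (s * t) = dT A B s * t + ((-1 : ℚ) ^ n) • (s * dT A B t) := by
  induction hs using Submodule.span_induction with
  | zero => simp
  | add x y _ _ hx hy => simp only [add_mul, map_add, hx, hy, smul_add]; abel
  | smul c x _ hx => simp only [smul_mul_assoc, map_smul, hx, smul_add]; rw [smul_comm]
  | mem x hx =>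
    obtain ⟨k, l, rfl, a, ha, b, hb, rfl⟩ := hx
    induction t using hom_ind with
    | add x y hx hy => simp only [mul_add, map_add, hx, hy, smul_add]; abel
    | pure k' l' a' ha' b' hb' =>
      rw [tm_mul a b' hb ha', map_smul, dT_tm, dT_tm, dT_tm, add_mul, mul_add,
        tm_mul _ _ hb ha', tm_mul _ _ (Dd_mem hb) ha', tm_mul _ _ hb (Dd_mem ha'),
        tm_mul _ _ hb (sgn_mem ha'), Dd_mul, Dd_mul, map_mul, sgn_of_mem ha, sgn_of_mem ha',
        sgn_of_mem hb]
      simp only [add_tm, tm_add, smul_tm, tm_smul, smul_mul_assoc, mul_smul_comm, smul_add,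
        smul_smul]
      have h2 : ∀ n : ℕ, ((-1 : ℚ) ^ n) * (-1) ^ n = 1 := fun n => by
        rw [← mul_pow]; simp
      have e1 : ((-1 : ℚ) ^ (k + l)) * (-1) ^ (l * (k' + 1)) = (-1) ^ (l * k') * (-1) ^ k := by
        rw [pow_add, mul_add, pow_add, mul_one]
        linear_combination ((-1 : ℚ) ^ k * (-1) ^ (l * k')) * h2 l
      have e3 : ((-1 : ℚ) ^ (k + l)) * ((-1) ^ k' * (-1) ^ (l * k')) =
          (-1 : ℚ) ^ (l * k') * ((-1) ^ k * (-1) ^ k' * (-1) ^ l) := by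
        rw [pow_add]; ring
      simp only [e1, e3, mul_comm, mul_left_comm, mul_assoc]
      module

end TA

instance instGCDGATA (A B : Type) [GCDGA A] [GCDGA B] : GCDGA (TA A B) where
  grading := TA.gr A B
  gradedAlgebra := TA.gradedAlg A B
  grading_comm := TA.gr_comm
  d := TA.dT A B
  d_sq := TA.dT_dT
  d_grading := TA.dT_gr
  d_leibniz := TA.dT_leibniz

namespace TA

variable {A B A' B' C : Type} [GCDGA A] [GCDGA B] [GCDGA A'] [GCDGA B'] [GCDGA C]

theorem Dd_tm (a : A) (b : B) :
    Dd (TA A B) (tm a b) = tm (Dd A a) b + tm (sgn A a) (Dd B b) := rfl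

theorem tm_mem_Gr {i j : ℕ} {a : A} {b : B} (ha : a ∈ Gr A i) (hb : b ∈ Gr B j) :
    tm a b ∈ Gr (TA A B) (i + j) := tm_mem ha hb

/-- The inclusion of the left factor. -/
def inl : A →ₐ[ℚ] TA A B := GradedTensorProduct.includeLeft (Gr A) (Gr B)

/-- The inclusion of the right factor. -/
def inr : B →ₐ[ℚ] TA A B := GradedTensorProduct.includeRight (Gr A) (Gr B)

theorem inl_apply (a : A) : (inl a : TA A B) = tm a 1 := rfl

theorem inr_apply (b : B) : (inr b : TA A B) = tm 1 b := rfl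

theorem tm_eq (a : A) (b : B) : tm a b = inl a * inr b :=
  (GradedTensorProduct.tmul_one_mul_one_tmul (R := ℚ) (Gr A) (Gr B) a b).symm

theorem inl_dga : IsDGAHom (inl : A →ₐ[ℚ] TA A B) := by
  refine ⟨fun a => ?_, fun i a ha => ?_⟩
  · rw [inl_apply, inl_apply, Dd_tm, Dd_one, tm_zero, add_zero]
  · have := tm_mem_Gr ha (one_mem_Gr (A := B))
    rwa [add_zero] at this

theorem inr_dga : IsDGAHom (inr : B →ₐ[ℚ] TA A B) := by
  refine ⟨fun a => ?_, fun i a ha => ?_⟩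
  · rw [inr_apply, inr_apply, Dd_tm, Dd_one, zero_tm, zero_add, map_one]
  · have := tm_mem_Gr (one_mem_Gr (A := A)) ha
    rwa [zero_add] at this

/-- The universal property of the tensor product. -/
def lift (f : A →ₐ[ℚ] C) (g : B →ₐ[ℚ] C) (hf : GrHom f) (hg : GrHom g) : TA A B →ₐ[ℚ] C :=
  GradedTensorProduct.lift (Gr A) (Gr B) f g (fun i j a b => by
    rw [Units.smul_def, ← Int.cast_smul_eq_zsmul ℚ, Gr_comm (hf i a a.2) (hg j b b.2), mul_comm j]
    simp)

theorem lift_tm (f : A →ₐ[ℚ] C) (g : B →ₐ[ℚ] C) (hf : GrHom f) (hg : GrHom g) (a : A) (b : B) :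
    lift f g hf hg (tm a b) = f a * g b := rfl

theorem lift_inl (f : A →ₐ[ℚ] C) (g : B →ₐ[ℚ] C) (hf : GrHom f) (hg : GrHom g) (a : A) :
    lift f g hf hg (inl a) = f a := by
  rw [inl_apply, lift_tm, map_one, mul_one]

theorem lift_inr (f : A →ₐ[ℚ] C) (g : B →ₐ[ℚ] C) (hf : GrHom f) (hg : GrHom g) (b : B) :
    lift f g hf hg (inr b) = g b := by
  rw [inr_apply, lift_tm, map_one, one_mul]


theorem adjoin_eq_top {s : Set A} {t : Set B} (hs : Algebra.adjoin ℚ s = ⊤)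
    (ht : Algebra.adjoin ℚ t = ⊤) :
    Algebra.adjoin ℚ ((inl : A →ₐ[ℚ] TA A B) '' s ∪ inr '' t) = ⊤ := by
  refine eq_top_iff.2 fun x _ => ?_
  induction x using ind with
  | add x y hx hy => exact add_mem (hx trivial) (hy trivial)
  | pure a b =>
    rw [tm_eq]
    refine mul_mem (Algebra.adjoin_mono Set.subset_union_left ?_)
      (Algebra.adjoin_mono Set.subset_union_right ?_)
    · rw [← AlgHom.map_adjoin, hs]; exact ⟨a, trivial, rfl⟩
    · rw [← AlgHom.map_adjoin, ht]; exact ⟨b, trivial, rfl⟩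

theorem algHom_ext {h k : TA A B →ₐ[ℚ] C} (hl : ∀ a, h (inl a) = k (inl a))
    (hr : ∀ b, h (inr b) = k (inr b)) : h = k := by
  refine AlgHom.ext fun x => ?_
  induction x using ind with
  | add x y hx hy => rw [map_add, map_add, hx, hy]
  | pure a b => rw [tm_eq, map_mul, map_mul, hl, hr]

theorem lift_gr (f : A →ₐ[ℚ] C) (g : B →ₐ[ℚ] C) (hf : GrHom f) (hg : GrHom g) :
    GrHom (lift f g hf hg) := by
  intro n x hx
  have hx' : x ∈ gr A B n := hx
  clear hx
  induction hx' using Submodule.span_induction with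
  | zero => rw [map_zero]; exact zero_mem _
  | add x y hx' hy' hx hy => rw [map_add]; exact add_mem hx hy
  | smul c x hx' hx => rw [map_smul]; exact Submodule.smul_mem _ _ hx
  | mem x hx =>
    obtain ⟨k, l, rfl, a, ha, b, hb, rfl⟩ := hx
    rw [lift_tm]
    exact mul_mem_Gr (hf k a ha) (hg l b hb)

theorem lift_dga {f : A →ₐ[ℚ] C} {g : B →ₐ[ℚ] C} (hf : IsDGAHom f) (hg : IsDGAHom g) :
    IsDGAHom (lift f g hf.gr hg.gr) := by
  refine ⟨fun x => ?_, lift_gr _ _ _ _⟩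
  induction x using ind with
  | add x y hx hy => simp only [map_add, hx, hy]
  | pure a b =>
    rw [Dd_tm, map_add, lift_tm, lift_tm, lift_tm, Dd_mul, hf.1, hg.1, hf.gr.sgn]

/-- The tensor product of two morphisms. -/
def map (f : A →ₐ[ℚ] A') (g : B →ₐ[ℚ] B') (hf : GrHom f) (hg : GrHom g) :
    TA A B →ₐ[ℚ] TA A' B' :=
  lift (inl.comp f) (inr.comp g) (inl_dga.gr.comp hf) (inr_dga.gr.comp hg)

theorem map_tm (f : A →ₐ[ℚ] A') (g : B →ₐ[ℚ] B') (hf : GrHom f) (hg : GrHom g) (a : A) (b : B) :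
    map f g hf hg (tm a b) = tm (f a) (g b) := by
  rw [tm_eq (f a)]; rfl

theorem map_dga {f : A →ₐ[ℚ] A'} {g : B →ₐ[ℚ] B'} (hf : IsDGAHom f) (hg : IsDGAHom g) :
    IsDGAHom (map f g hf.gr hg.gr) :=
  lift_dga (inl_dga.comp hf) (inr_dga.comp hg)

end TA

/-- An acyclic differential on a vector space is contractible. -/
theorem exists_linear_contraction {M : Type*} [AddCommGroup M] [Module ℚ M] (d : M →ₗ[ℚ] M)
    (hdd : ∀ k, d (d k) = 0) (hrange : ∀ k, d k = 0 → k ∈ LinearMap.range d) :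
    ∃ η : M →ₗ[ℚ] M, ∀ k, d (η k) + η (d k) = k := by
  obtain ⟨σ, hσ⟩ := d.rangeRestrict.exists_rightInverse_of_surjective d.range_rangeRestrict
  have hdσ : ∀ z, d (σ z) = z := fun z => congrArg Subtype.val (LinearMap.congr_fun hσ z)
  let e : M →ₗ[ℚ] M := LinearMap.id - σ ∘ₗ d.rangeRestrict
  have he : ∀ k, e k ∈ LinearMap.range d := fun k => hrange _ (by
    change d (k - σ (d.rangeRestrict k)) = 0
    rw [map_sub, hdσ]; exact sub_self _)
  refine ⟨σ ∘ₗ e.codRestrict (LinearMap.range d) he, fun k => ?_⟩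
  change d (σ _) + σ _ = k
  rw [hdσ]
  change (k - σ (d.rangeRestrict k)) + _ = k
  have : e.codRestrict (LinearMap.range d) he (d k) = d.rangeRestrict k := by
    apply Subtype.ext
    change d k - σ (d.rangeRestrict (d k)) = d k
    have : d.rangeRestrict (d k) = 0 := Subtype.ext (hdd k)
    rw [this, map_zero, sub_zero]
  rw [this, sub_add_cancel]

/-- A contraction of the kernel of a surjective morphism with acyclic kernel. -/
theorem exists_contraction {A B : Type} [GCDGA A] [GCDGA B] {f : A →ₐ[ℚ] B} (hf : IsDGAHom f)
    (h : SurjAcyc f) : ∃ H N : A →ₗ[ℚ] A, ∃ s : B →ₗ[ℚ] A, (∀ a, N a = a - s (f a)) ∧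
      (∀ a, f (N a) = 0) ∧ (∀ a, f (H (N a)) = 0) ∧
      ∀ a, f a = 0 → Dd A (H a) + H (Dd A a) = a := by
  obtain ⟨s, hs⟩ := f.toLinearMap.exists_rightInverse_of_surjective (LinearMap.range_eq_top.2 h.1)
  have hs' : ∀ b, f (s b) = b := fun b => LinearMap.congr_fun hs b
  set K := LinearMap.ker f.toLinearMap with hK
  have hK' : ∀ a, a ∈ K ↔ f a = 0 := fun a => Iff.rfl
  let N : A →ₗ[ℚ] A := LinearMap.id - s ∘ₗ f.toLinearMap
  have hN : ∀ a, N a = a - s (f a) := fun a => rfl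
  have hfN : ∀ a, f (N a) = 0 := fun a => by rw [hN, map_sub, hs', sub_self]
  let d : K →ₗ[ℚ] K := (Dd A).restrict (fun a ha => by
    rw [hK'] at ha ⊢; rw [hf.1, ha, map_zero])
  have hd : ∀ k, ((d k : K) : A) = Dd A k := fun k => rfl
  obtain ⟨η, hη⟩ := exists_linear_contraction d (fun k => Subtype.ext (Dd_Dd k.1)) fun k hk => by
    obtain ⟨l, hl, hdl⟩ := h.2 k.1 k.2 (congrArg Subtype.val hk)
    exact ⟨⟨l, hl⟩, Subtype.ext hdl⟩
  let H : A →ₗ[ℚ] A := K.subtype ∘ₗ η ∘ₗ N.codRestrict K hfN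
  have hNK : ∀ k : K, N.codRestrict K hfN k = k := fun k => Subtype.ext (by
    change k.1 - s (f k.1) = k.1
    rw [(hK' _).1 k.2, map_zero, sub_zero])
  refine ⟨H, N, s, hN, hfN, fun a => (η _).2, fun a ha => ?_⟩
  have h1 := congrArg Subtype.val (hη ⟨a, ha⟩)
  have h2 : H a = (η ⟨a, ha⟩ : K) := by
    change ((η (N.codRestrict K hfN _) : K) : A) = _
    rw [hNK ⟨a, ha⟩]
  have h3 : H (Dd A a) = (η (d ⟨a, ha⟩) : K) := by
    change ((η (N.codRestrict K hfN _) : K) : A) = _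
    rw [← hNK (d ⟨a, ha⟩)]; rfl
  rw [h2, h3]; exact h1

namespace TA

variable {A B A' B' C : Type} [GCDGA A] [GCDGA B] [GCDGA A'] [GCDGA B'] [GCDGA C]

theorem surj_map {f : A →ₐ[ℚ] A'} {g : B →ₐ[ℚ] B'} (hf : GrHom f) (hg : GrHom g)
    (hfs : Function.Surjective f) (hgs : Function.Surjective g) :
    Function.Surjective (map f g hf hg) := by
  intro x
  induction x using ind with
  | add x y hx hy =>
    obtain ⟨x, rfl⟩ := hx
    obtain ⟨y, rfl⟩ := hy
    exact ⟨x + y, map_add _ _ _⟩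
  | pure a b =>
    obtain ⟨a, rfl⟩ := hfs a
    obtain ⟨b, rfl⟩ := hgs b
    exact ⟨tm a b, map_tm _ _ _ _ _ _⟩

theorem sub_tm (a a' : A) (b : B) : tm (a - a') b = tm a b - tm a' b := by
  rw [sub_eq_add_neg, add_tm, neg_tm, sub_eq_add_neg]

theorem tm_sub (a : A) (b b' : B) : tm a (b - b') = tm a b - tm a b' := by
  rw [sub_eq_add_neg, tm_add, ← neg_one_smul ℚ b', tm_smul, neg_one_smul, sub_eq_add_neg]

theorem map_id_right_surjAcyc {f : A →ₐ[ℚ] A'} (hf : IsDGAHom f) (h : SurjAcyc f) :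
    SurjAcyc (map f (AlgHom.id ℚ B) hf.gr (isDGAHom_id B).gr) := by
  refine ⟨surj_map _ _ h.1 Function.surjective_id, fun t ht hdt => ?_⟩
  obtain ⟨H₀, N, s, hN, hfN, hfH, hH⟩ := exists_contraction hf h
  let σ := (sgn A).toLinearMap
  have hσ : ∀ a, σ a = sgn A a := fun a => rfl
  let H : A →ₗ[ℚ] A := (1 / 2 : ℚ) • (H₀ - σ ∘ₗ H₀ ∘ₗ σ)
  have Hdef : ∀ a, H a = (1 / 2 : ℚ) • (H₀ a - sgn A (H₀ (sgn A a))) := fun a => rfl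
  have hσk : ∀ a, f a = 0 → f (sgn A a) = 0 := fun a ha => by rw [hf.gr.sgn, ha, map_zero]
  have hdk : ∀ a, f a = 0 → f (Dd A a) = 0 := fun a ha => by rw [hf.1, ha, map_zero]
  have hNk : ∀ a, f a = 0 → N a = a := fun a ha => by rw [hN, ha, map_zero, sub_zero]
  have hfH0 : ∀ a, f a = 0 → f (H₀ a) = 0 := fun a ha => by rw [← hNk a ha, hfH]
  have hfH1 : ∀ a, f a = 0 → f (H a) = 0 := fun a ha => by
    rw [Hdef, map_smul, map_sub, hf.gr.sgn, hfH0 a ha, hfH0 _ (hσk a ha)]; simp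
  have hH1 : ∀ a, f a = 0 → Dd A (H a) + H (Dd A a) = a := by
    intro a ha
    have e1 := hH a ha
    have e2 := congrArg (sgn A) (hH (sgn A a) (hσk a ha))
    rw [map_add, sgn_sgn, Dd_sgn, sgn_Dd] at e2
    rw [Hdef, Hdef, map_smul, map_sub, ← smul_add]
    have : Dd A (H₀ a) - Dd A (sgn A (H₀ (sgn A a))) +
        (H₀ (Dd A a) - sgn A (H₀ (sgn A (Dd A a)))) = (2 : ℚ) • a := by
      rw [map_neg, map_neg] at e2
      linear_combination (norm := module) e1 + e2
    rw [this, smul_smul]; norm_num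
  have hHσ : ∀ a, H (sgn A a) = -sgn A (H a) := fun a => by
    rw [Hdef, Hdef, map_smul, map_sub, sgn_sgn, sgn_sgn, ← smul_neg, neg_sub]
  have hNt : lmap N LinearMap.id t = t := by
    have key : ∀ t : TA A B, lmap N LinearMap.id t =
        t - lmap s LinearMap.id (map f (AlgHom.id ℚ B) hf.gr (isDGAHom_id B).gr t) := by
      intro t
      induction t using ind with
      | add x y hx hy => simp only [map_add, hx, hy]; abel
      | pure a b => rw [map_tm, lmap_tm, lmap_tm, hN, sub_tm]; rfl
    rw [key, ht, map_zero, sub_zero]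
  refine ⟨lmap H LinearMap.id (lmap N LinearMap.id t), ?_, ?_⟩
  · clear ht hdt hNt
    induction t using ind with
    | add x y hx hy => simp only [map_add, hx, hy, add_zero]
    | pure a b => rw [lmap_tm, lmap_tm, map_tm, hfH1 _ (hfN a), zero_tm]
  · have key : ∀ t : TA A B, Dd _ (lmap H LinearMap.id (lmap N LinearMap.id t)) +
        lmap H LinearMap.id (Dd _ (lmap N LinearMap.id t)) = lmap N LinearMap.id t := by
      intro t
      induction t using ind with
      | add x y hx hy =>
        simp only [map_add]
        linear_combination (norm := module) hx + hy
      | pure a b =>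
        simp only [lmap_tm, Dd_tm, map_add, LinearMap.id_apply, hHσ]
        have := congrArg (fun z => tm z b) (hH1 (N a) (hfN a))
        simp only [add_tm] at this
        rw [neg_tm]
        linear_combination (norm := module) this
    have := key t
    rw [hNt, hdt, map_zero, add_zero] at this
    rw [hNt]; exact this

theorem map_id_left_surjAcyc {g : B →ₐ[ℚ] B'} (hg : IsDGAHom g) (h : SurjAcyc g) :
    SurjAcyc (map (AlgHom.id ℚ A) g (isDGAHom_id A).gr hg.gr) := by
  refine ⟨surj_map _ _ Function.surjective_id h.1, fun t ht hdt => ?_⟩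
  obtain ⟨H, N, s, hN, hfN, hfH, hH⟩ := exists_contraction hg h
  have hNt : lmap LinearMap.id N t = t := by
    have key : ∀ t : TA A B, lmap LinearMap.id N t =
        t - lmap LinearMap.id s (map (AlgHom.id ℚ A) g (isDGAHom_id A).gr hg.gr t) := by
      intro t
      induction t using ind with
      | add x y hx hy => simp only [map_add, hx, hy]; abel
      | pure a b => rw [map_tm, lmap_tm, lmap_tm, hN, tm_sub]; rfl
    rw [key, ht, map_zero, sub_zero]
  refine ⟨lmap (sgn A).toLinearMap H (lmap LinearMap.id N t), ?_, ?_⟩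
  · clear ht hdt hNt
    induction t using ind with
    | add x y hx hy => simp only [map_add, hx, hy, add_zero]
    | pure a b => rw [lmap_tm, lmap_tm, map_tm, hfH, tm_zero]
  · have key : ∀ t : TA A B, Dd _ (lmap (sgn A).toLinearMap H (lmap LinearMap.id N t)) +
        lmap (sgn A).toLinearMap H (Dd _ (lmap LinearMap.id N t)) = lmap LinearMap.id N t := by
      intro t
      induction t using ind with
      | add x y hx hy =>
        simp only [map_add]
        linear_combination (norm := module) hx + hy
      | pure a b =>
        simp only [lmap_tm, Dd_tm, map_add, LinearMap.id_apply, AlgHom.toLinearMap_apply, sgn_sgn,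
          Dd_sgn, neg_tm]
        have := congrArg (tm a) (hH (N b) (hfN b))
        simp only [tm_add] at this
        linear_combination (norm := module) this
    have := key t
    rw [hNt, hdt, map_zero, add_zero] at this
    rw [hNt]; exact this

theorem map_surjAcyc {f : A →ₐ[ℚ] A'} {g : B →ₐ[ℚ] B'} (hf : IsDGAHom f) (hg : IsDGAHom g)
    (hfs : SurjAcyc f) (hgs : SurjAcyc g) : SurjAcyc (map f g hf.gr hg.gr) := by
  have h := (map_id_right_surjAcyc (B := B') hf hfs).comp (map_id_left_surjAcyc (A := A) hg hgs)
    (map_dga (isDGAHom_id A) hg)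
  have e : map f g hf.gr hg.gr = (map f (AlgHom.id ℚ B') hf.gr (isDGAHom_id B').gr).comp
      (map (AlgHom.id ℚ A) g (isDGAHom_id A).gr hg.gr) := by
    refine AlgHom.ext fun x => ?_
    induction x using ind with
    | add x y hx hy => rw [map_add, map_add, hx, hy]
    | pure a b => rw [AlgHom.comp_apply, map_tm, map_tm, map_tm]; rfl
  rw [e]; exact h

end TA

/-! ### Tensor powers of a surjective morphism with acyclic kernel -/

/-- The ground field as a cdga concentrated in degree zero. -/
def Ground : Type := ℚ

instance : CommRing Ground := inferInstanceAs (CommRing ℚ)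

instance : Algebra ℚ Ground := inferInstanceAs (Algebra ℚ ℚ)

/-- The grading of the ground field. -/
def Ground.gr (n : ℕ) : Submodule ℚ Ground := if n = 0 then ⊤ else ⊥

theorem Ground.mem_gr {n : ℕ} {x : Ground} : x ∈ Ground.gr n ↔ n = 0 ∨ x = 0 := by
  unfold gr; split_ifs with h <;> simp [h]

/-- The projections of the ground field to its homogeneous components. -/
def Ground.proj (n : ℕ) : Ground →ₗ[ℚ] Ground := if n = 0 then LinearMap.id else 0

instance : GCDGA Ground where
  grading := Ground.gr
  gradedAlgebra := gradedOfProj Ground.gr Ground.proj (Ground.mem_gr.2 (Or.inl rfl))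
    (fun i j a b ha hb => by
      rw [Ground.mem_gr] at *
      rcases ha with rfl | rfl
      · rcases hb with rfl | rfl
        · exact Or.inl rfl
        · exact Or.inr (mul_zero _)
      · exact Or.inr (zero_mul _))
    (fun n x hx => by
      rw [Ground.mem_gr] at hx
      rcases hx with rfl | rfl
      · simp [Ground.proj]
      · exact map_zero _)
    (fun m n hmn x hx => by
      rw [Ground.mem_gr] at hx
      rcases hx with rfl | rfl
      · simp [Ground.proj, hmn]
      · exact map_zero _)
    (fun x => Submodule.mem_iSup_of_mem 0 (Ground.mem_gr.2 (Or.inl rfl)))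
  grading_comm i j a b ha hb := by
    rw [Ground.mem_gr] at ha hb
    rcases ha with rfl | rfl
    · simp [mul_comm]
    · simp
  d := 0
  d_sq _ := rfl
  d_grading _ _ _ := zero_mem _
  d_leibniz _ _ _ _ := by simp

theorem Ground.mem_Gr {n : ℕ} {x : Ground} : x ∈ Gr Ground n ↔ n = 0 ∨ x = 0 := Ground.mem_gr

/-- The `r`-fold tensor power of a morphism. -/
structure TensorData {A A' : Type} [GCDGA A] [GCDGA A'] (φ : A →ₐ[ℚ] A') (r : ℕ) where
  T : Type
  T' : Type
  [instT : GCDGA T]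
  [instT' : GCDGA T']
  TP : TensorPower A r T
  ι' : Fin r → (A' →ₐ[ℚ] T')
  ι'_dga : ∀ j, IsDGAHom (ι' j)
  Φ : T →ₐ[ℚ] T'
  Φ_dga : IsDGAHom Φ
  Φ_surjAcyc : SurjAcyc Φ
  Φ_ι : ∀ j a, Φ (TP.ι j a) = ι' j (φ a)
  gen : Algebra.adjoin ℚ (⋃ j, Set.range (TP.ι j)) = ⊤
  functional : ∀ l : A' →ₗ[ℚ] ℚ, (∀ a, l (Dd A' a) = 0) → ∃ L : T' →ₗ[ℚ] ℚ,
    (∀ t, L (Dd T' t) = 0) ∧ ∀ top : A', L (List.ofFn fun j => ι' j top).prod = l top ^ r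

attribute [instance] TensorData.instT TensorData.instT'

/-- The empty tensor power. -/
def TensorData.zero {A A' : Type} [GCDGA A] [GCDGA A'] (φ : A →ₐ[ℚ] A') : TensorData φ 0 where
  T := Ground
  T' := Ground
  TP :=
    { ι := fun j => j.elim0
      ι_dga := fun j => j.elim0
      coprod := fun B _ f _ => by
        let g : Ground →ₐ[ℚ] B := (Algebra.ofId ℚ B : ℚ →ₐ[ℚ] B)
        refine ⟨g, ⟨⟨fun a => ?_, fun i a ha => ?_⟩, fun j => j.elim0⟩, fun k _ => ?_⟩
        · exact (map_zero g).trans (Dd_algebraMap (A := B) (a : ℚ)).symm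
        · rcases Ground.mem_Gr.1 ha with rfl | rfl
          · have key : ∀ c : ℚ, algebraMap ℚ B c ∈ Gr B 0 := fun c => by
              rw [Algebra.algebraMap_eq_smul_one]
              exact Submodule.smul_mem _ _ one_mem_Gr
            exact key a
          · rw [map_zero]; exact zero_mem _
        · exact Subsingleton.elim (α := ℚ →ₐ[ℚ] B) k g }
  ι' := fun j => j.elim0
  ι'_dga := fun j => j.elim0
  Φ := AlgHom.id ℚ Ground
  Φ_dga := isDGAHom_id _
  Φ_surjAcyc := ⟨Function.surjective_id, fun a ha _ => ⟨0, rfl, by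
    rw [map_zero]; exact ha.symm⟩⟩
  Φ_ι := fun j => j.elim0
  gen := by
    refine eq_top_iff.2 fun x _ => ?_
    exact Subalgebra.algebraMap_mem _ (x : ℚ)
  functional := fun l _ => ⟨(LinearMap.id : ℚ →ₗ[ℚ] ℚ), fun t => rfl, fun top => by
    rw [List.ofFn_zero, List.prod_nil, pow_zero]; rfl⟩

/-- Adding a tensor factor. -/
def TensorData.succ {A A' : Type} [GCDGA A] [GCDGA A'] {φ : A →ₐ[ℚ] A'} {r : ℕ}
    (D : TensorData φ r) (hφ : IsDGAHom φ) (h : SurjAcyc φ) : TensorData φ (r + 1) where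
  T := TA A D.T
  T' := TA A' D.T'
  TP :=
    { ι := Fin.cons TA.inl fun j => TA.inr.comp (D.TP.ι j)
      ι_dga := Fin.cases TA.inl_dga fun j => TA.inr_dga.comp (D.TP.ι_dga j)
      coprod := fun B _ f hf => by
        obtain ⟨g, ⟨hg, hgf⟩, huniq⟩ := D.TP.coprod B (fun j => f j.succ) (fun j => hf j.succ)
        refine ⟨TA.lift (f 0) g (hf 0).gr hg.gr, ⟨TA.lift_dga (hf 0) hg, ?_⟩, ?_⟩
        · refine Fin.cases ?_ fun j => ?_
          · exact AlgHom.ext fun a => TA.lift_inl _ _ (hf 0).gr hg.gr _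
          · refine AlgHom.ext fun a => ?_
            exact (TA.lift_inr _ _ (hf 0).gr hg.gr _).trans (AlgHom.congr_fun (hgf j) a)
        · rintro k ⟨hk, hkf⟩
          have := huniq (k.comp TA.inr) ⟨hk.comp TA.inr_dga, fun j => hkf j.succ⟩
          refine TA.algHom_ext (fun a => ?_) fun b => ?_
          · rw [TA.lift_inl]; exact AlgHom.congr_fun (hkf 0) a
          · rw [TA.lift_inr]; exact AlgHom.congr_fun this b }
  ι' := Fin.cons TA.inl fun j => TA.inr.comp (D.ι' j)
  ι'_dga := Fin.cases TA.inl_dga fun j => TA.inr_dga.comp (D.ι'_dga j)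
  Φ := TA.map φ D.Φ hφ.gr D.Φ_dga.gr
  Φ_dga := TA.map_dga hφ D.Φ_dga
  Φ_surjAcyc := TA.map_surjAcyc hφ D.Φ_dga h D.Φ_surjAcyc
  Φ_ι := Fin.cases (fun a => TA.lift_inl _ _ _ _ _) fun j a =>
    (TA.lift_inr _ _ _ _ _).trans (congrArg TA.inr (D.Φ_ι j a))
  gen := by
    have := TA.adjoin_eq_top (A := A) (B := D.T) (Algebra.adjoin_univ ℚ A) D.gen
    rw [eq_top_iff, ← this]
    refine Algebra.adjoin_mono (Set.union_subset ?_ ?_)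
    · rintro _ ⟨a, _, rfl⟩
      exact Set.mem_iUnion.2 ⟨0, a, rfl⟩
    · rintro _ ⟨b, hb, rfl⟩
      obtain ⟨j, a, rfl⟩ := Set.mem_iUnion.1 hb
      exact Set.mem_iUnion.2 ⟨j.succ, a, rfl⟩
  functional := fun l hl => by
    obtain ⟨L, hL, hLtop⟩ := D.functional l hl
    refine ⟨LinearMap.mul' ℚ ℚ ∘ₗ TensorProduct.map l L ∘ₗ
      (GradedTensorProduct.of ℚ (Gr A') (Gr D.T')).symm.toLinearMap, fun t => ?_, fun top => ?_⟩
    · induction t using TA.ind with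
      | add x y hx hy => simp only [map_add, hx, hy, add_zero]
      | pure a b =>
        rw [TA.Dd_tm, map_add]
        change l (Dd A' a) * L b + l (sgn A' a) * L (Dd D.T' b) = 0
        rw [hl, hL, zero_mul, mul_zero, add_zero]
    · rw [List.ofFn_succ, List.prod_cons]
      have : (List.ofFn fun j : Fin r => (Fin.cons TA.inl (fun j => TA.inr.comp (D.ι' j)) :
          Fin (r + 1) → (A' →ₐ[ℚ] TA A' D.T')) j.succ top).prod =
          TA.inr (List.ofFn fun j => D.ι' j top).prod := by
        rw [map_list_prod, List.map_ofFn]; rfl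
      rw [this]
      change (LinearMap.mul' ℚ ℚ ∘ₗ TensorProduct.map l L ∘ₗ
        (GradedTensorProduct.of ℚ (Gr A') (Gr D.T')).symm.toLinearMap) (TA.inl _ * TA.inr _) = _
      rw [← TA.tm_eq]
      change l top * L _ = _
      rw [hLtop, pow_succ']

theorem nonempty_tensorData {A A' : Type} [GCDGA A] [GCDGA A'] {φ : A →ₐ[ℚ] A'}
    (hφ : IsDGAHom φ) (h : SurjAcyc φ) (r : ℕ) : Nonempty (TensorData φ r) := by
  induction r with
  | zero => exact ⟨TensorData.zero φ⟩
  | succ r ih => exact ih.map fun D => D.succ hφ h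

/-- A non-exact cocycle is detected by a functional vanishing on boundaries. -/
theorem exists_functional {A : Type} [GCDGA A] {a : A} (h : ∀ b, a ≠ Dd A b) :
    ∃ l : A →ₗ[ℚ] ℚ, (∀ b, l (Dd A b) = 0) ∧ l a ≠ 0 := by
  have ha : a ∉ LinearMap.range (Dd A) := fun ⟨b, hb⟩ => h b hb.symm
  obtain ⟨l, hl, hl'⟩ := Submodule.exists_le_ker_of_notMem ha
  exact ⟨l, fun b => hl' ⟨b, rfl⟩, hl⟩

theorem TensorData.prod_not_exact {A A' : Type} [GCDGA A] [GCDGA A'] {φ : A →ₐ[ℚ] A'} {r : ℕ}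
    (D : TensorData φ r) {top : A'} (h : ∀ b, top ≠ Dd A' b) (t : D.T') :
    (List.ofFn fun j => D.ι' j top).prod ≠ Dd D.T' t := by
  intro ht
  obtain ⟨l, hl, hl'⟩ := exists_functional h
  obtain ⟨L, hL, hLtop⟩ := D.functional l hl
  have := hLtop top
  rw [ht, hL] at this
  exact pow_ne_zero r hl' this.symm

/-! ### Homotopy retractions -/

section Prod

variable {A B : Type} [GCDGA A] [GCDGA B]

/-- The product of two cdga's. -/
instance instGCDGAProd : GCDGA (A × B) where
  grading n := (Gr A n).prod (Gr B n)
  gradedAlgebra := gradedOfProj (fun n => (Gr A n).prod (Gr B n))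
    (fun n => (pr A n).prodMap (pr B n)) ⟨one_mem_Gr, one_mem_Gr⟩
    (fun i j a b ha hb => ⟨mul_mem_Gr ha.1 hb.1, mul_mem_Gr ha.2 hb.2⟩)
    (fun n x hx => Prod.ext (pr_of_mem hx.1) (pr_of_mem hx.2))
    (fun m n hmn x hx => Prod.ext (pr_of_ne hx.1 hmn) (pr_of_ne hx.2 hmn))
    (fun x => by
      have h1 : ((x.1, 0) : A × B) ∈ ⨆ n, (Gr A n).prod (Gr B n) := by
        induction x.1 using Gr_induction with
        | add a a' h h' =>
          have := add_mem h h'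
          rwa [Prod.mk_add_mk, add_zero] at this
        | hom i a ha => exact Submodule.mem_iSup_of_mem i ⟨ha, zero_mem _⟩
      have h2 : ((0, x.2) : A × B) ∈ ⨆ n, (Gr A n).prod (Gr B n) := by
        induction x.2 using Gr_induction with
        | add a a' h h' =>
          have := add_mem h h'
          rwa [Prod.mk_add_mk, add_zero] at this
        | hom i a ha => exact Submodule.mem_iSup_of_mem i ⟨zero_mem _, ha⟩
      have := add_mem h1 h2
      rwa [Prod.mk_add_mk, add_zero, zero_add] at this)
  grading_comm i j a b ha hb := Prod.ext (Gr_comm ha.1 hb.1) (Gr_comm ha.2 hb.2)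
  d := (Dd A).prodMap (Dd B)
  d_sq a := Prod.ext (Dd_Dd a.1) (Dd_Dd a.2)
  d_grading i a ha := ⟨Dd_mem ha.1, Dd_mem ha.2⟩
  d_leibniz i a b ha := Prod.ext (GCDGA.d_leibniz i a.1 b.1 ha.1) (GCDGA.d_leibniz i a.2 b.2 ha.2)

theorem Dd_prod (x : A × B) : Dd (A × B) x = (Dd A x.1, Dd B x.2) := rfl

theorem pr_prod (n : ℕ) (x : A × B) : pr (A × B) n x = (pr A n x.1, pr B n x.2) := by
  have h1 : (pr (A × B) n x).1 = pr A n x.1 :=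
    GrHom.pr (f := AlgHom.fst ℚ A B) (fun i a ha => ha.1) n x
  have h2 : (pr (A × B) n x).2 = pr B n x.2 :=
    GrHom.pr (f := AlgHom.snd ℚ A B) (fun i a ha => ha.2) n x
  exact Prod.ext h1 h2

end Prod

theorem quasiIso_of_surjAcyc {A B : Type} [GCDGA A] [GCDGA B] {f : A →ₐ[ℚ] B}
    (hf : IsDGAHom f) (h : SurjAcyc f) : QuasiIso f := by
  refine ⟨fun b hb => ?_, fun a ha ⟨c, hc⟩ => ?_⟩
  · obtain ⟨a, rfl⟩ := h.1 b
    obtain ⟨k, hk, hdk⟩ := h.2 (Dd A a) (by rw [hf.1, hb]) (Dd_Dd a)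
    exact ⟨a - k, by rw [map_sub, hdk, sub_self], 0, by rw [map_sub, hk]; simp⟩
  · obtain ⟨c, rfl⟩ := h.1 c
    obtain ⟨k, _, hdk⟩ := h.2 (a - Dd A c) (by rw [map_sub, hc, hf.1, sub_self])
      (by rw [map_sub, ha, Dd_Dd, sub_zero])
    exact ⟨c + k, by rw [map_add, hdk]; abel⟩

/-- A projection through which a surjective quasi-isomorphism factors has a homotopy retraction. -/
theorem nonempty_htpyRetraction {T Q Q' : Type} [GCDGA T] [GCDGA Q] [GCDGA Q'] {ρ : T →ₐ[ℚ] Q}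
    {φ : T →ₐ[ℚ] Q'} (hρ : IsDGAHom ρ) (hρs : Function.Surjective ρ) (hφ : IsDGAHom φ)
    (h : SurjAcyc φ) (hle : LinearMap.ker ρ.toLinearMap ≤ LinearMap.ker φ.toLinearMap) :
    Nonempty (HtpyRetraction ρ) := by
  let ψL : Q →ₗ[ℚ] Q' := descend ρ hρs φ.toLinearMap hle
  have hψL : ∀ t, ψL (ρ t) = φ t := descend_apply ρ hρs φ.toLinearMap hle
  let ψ : Q →ₐ[ℚ] Q' := AlgHom.ofLinearMap ψL
    (by rw [← map_one ρ, hψL, map_one])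
    (fun a b => by
      obtain ⟨a, rfl⟩ := hρs a
      obtain ⟨b, rfl⟩ := hρs b
      rw [← map_mul, hψL, hψL, hψL, map_mul])
  have hψ : ∀ t, ψ (ρ t) = φ t := hψL
  have hψd : IsDGAHom ψ := by
    refine ⟨fun a => ?_, fun i a ha => ?_⟩
    · obtain ⟨a, rfl⟩ := hρs a
      rw [← hρ.1, hψ, hψ, hφ.1]
    · obtain ⟨t, rfl⟩ := hρs a
      rw [← pr_of_mem ha, ← hρ.gr.pr, hψ]
      exact hφ.2 i _ (pr_mem i t)
  let S : Subalgebra ℚ (T × Q) :=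
    AlgHom.equalizer (φ.comp (AlgHom.fst ℚ T Q)) (ψ.comp (AlgHom.snd ℚ T Q))
  have hS : ∀ x : T × Q, x ∈ S ↔ φ x.1 = ψ x.2 := fun x => Iff.rfl
  let _ : GCDGA S := subGCDGA S
    (fun n x hx => by
      rw [hS] at hx ⊢
      rw [pr_prod, hφ.gr.pr, hψd.gr.pr, hx])
    (fun x hx => by
      rw [hS] at hx ⊢
      rw [Dd_prod, hφ.1, hψd.1, hx])
  have hdS : ∀ x : S, ((Dd S x : S) : T × Q) = (Dd T x.1.1, Dd Q x.1.2) := fun x => rfl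
  have hgS : ∀ n, ∀ x : S, x ∈ Gr S n ↔ x.1.1 ∈ Gr T n ∧ x.1.2 ∈ Gr Q n := fun n x => Iff.rfl
  let j : T →ₐ[ℚ] S := ((AlgHom.id ℚ T).prod ρ).codRestrict S fun t => (hψ t).symm
  let q : S →ₐ[ℚ] Q := (AlgHom.snd ℚ T Q).comp S.val
  let τ : S →ₐ[ℚ] T := (AlgHom.fst ℚ T Q).comp S.val
  have hq : IsDGAHom q := ⟨fun a => rfl, fun i a ha => ha.2⟩
  have hqs : Function.Surjective q := fun s => by
    obtain ⟨t, ht⟩ := h.1 (ψ s)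
    exact ⟨⟨(t, s), ht⟩, rfl⟩
  refine ⟨{ C := S, j := j, q := q, τ := τ, j_dga := ?_, q_dga := hq,
            τ_dga := ⟨fun a => rfl, fun i a ha => ha.1⟩
            q_surj := hqs, q_quasi := quasiIso_of_surjAcyc hq ⟨hqs, ?_⟩
            hqj := rfl, hτj := rfl }⟩
  · refine ⟨fun a => Subtype.ext (Prod.ext rfl (hρ.1 a)), fun i a ha => ⟨ha, hρ.2 i a ha⟩⟩
  · rintro ⟨⟨t, s⟩, hts⟩ hs hd
    have hs' : s = 0 := hs
    subst hs'
    have hts' : φ t = 0 := hts.trans (map_zero ψ)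
    have hdt : Dd T t = 0 := congrArg (fun x : S => x.1.1) hd
    obtain ⟨k, hk, hdk⟩ := h.2 t hts' hdt
    exact ⟨⟨(k, 0), hk.trans (map_zero ψ).symm⟩, rfl,
      Subtype.ext (Prod.ext hdk (map_zero (Dd Q)))⟩

/-- A morphism with a homotopy retraction is injective in cohomology. -/
theorem HtpyRetraction.exact_of_eq_zero {T Q : Type} [GCDGA T] [GCDGA Q] {ρ : T →ₐ[ℚ] Q}
    (R : HtpyRetraction ρ) {t : T} (hρ : ρ t = 0) (hd : Dd T t = 0) : ∃ b, t = Dd T b := by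
  have h1 : R.q (R.j t) = 0 := (AlgHom.congr_fun R.hqj t).trans hρ
  obtain ⟨e, he⟩ := R.q_quasi.2 (R.j t) (by rw [← R.j_dga.1, hd, map_zero])
    ⟨0, by rw [h1, map_zero]⟩
  refine ⟨R.τ e, ?_⟩
  have h2 : R.τ (R.j t) = t := AlgHom.congr_fun R.hτj t
  rw [← h2, he, R.τ_dga.1]

/-! ### Stability of submodules under projections and the differential -/

section Stable

variable {A : Type} [GCDGA A]

theorem pr_mul_of_mem (n : ℕ) {i : ℕ} {a : A} (ha : a ∈ Gr A i) (b : A) :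
    pr A n (a * b) = if i ≤ n then a * pr A (n - i) b else 0 := by
  induction b using Gr_induction with
  | add b b' h h' => rw [mul_add, map_add, h, h', map_add]; split_ifs <;> simp [mul_add]
  | hom j b hb =>
    by_cases h : n = i + j
    · subst h
      rw [pr_of_mem (mul_mem_Gr ha hb), if_pos (Nat.le_add_right _ _), Nat.add_sub_cancel_left,
        pr_of_mem hb]
    · rw [pr_of_ne (mul_mem_Gr ha hb) h]
      split_ifs with h'
      · rw [pr_of_ne hb (by omega), mul_zero]
      · rfl

/-- Submodules spanned by their homogeneous elements. -/
def PrStable (P : Submodule ℚ A) : Prop := ∀ n, ∀ a ∈ P, pr A n a ∈ P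

theorem prStable_span {s : Set A} (hs : ∀ a ∈ s, ∃ n, a ∈ Gr A n) :
    PrStable (Submodule.span ℚ s) := by
  intro n a ha
  induction ha using Submodule.span_induction with
  | zero => rw [map_zero]; exact zero_mem _
  | add x y _ _ hx hy => rw [map_add]; exact add_mem hx hy
  | smul c x _ hx => rw [map_smul]; exact Submodule.smul_mem _ _ hx
  | mem x hx =>
    obtain ⟨i, hi⟩ := hs x hx
    by_cases h : n = i
    · subst h; rw [pr_of_mem hi]; exact Submodule.subset_span hx
    · rw [pr_of_ne hi h]; exact zero_mem _

theorem PrStable.mul {P Q : Submodule ℚ A} (hP : PrStable P) (hQ : PrStable Q) :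
    PrStable (P * Q) := by
  intro n x hx
  induction hx using Submodule.mul_induction_on' with
  | add x _ y _ hx hy => rw [map_add]; exact add_mem hx hy
  | mem_mul_mem a ha b hb =>
    obtain ⟨N, hN⟩ := exists_sum_pr a
    rw [hN, Finset.sum_mul, map_sum]
    refine Submodule.sum_mem _ fun i _ => ?_
    rw [pr_mul_of_mem n (pr_mem i a)]
    split_ifs
    · exact Submodule.mul_mem_mul (hP i a ha) (hQ _ b hb)
    · exact zero_mem _

theorem prStable_one : PrStable (1 : Submodule ℚ A) := by
  rw [Submodule.one_eq_span]
  exact prStable_span fun a ha => ⟨0, by rw [Set.mem_singleton_iff.1 ha]; exact one_mem_Gr⟩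

theorem PrStable.pow {P : Submodule ℚ A} (hP : PrStable P) (n : ℕ) : PrStable (P ^ n) := by
  induction n with
  | zero => rw [pow_zero]; exact prStable_one
  | succ n ih => rw [pow_succ]; exact ih.mul hP

theorem PrStable.iSup {ι : Sort*} {P : ι → Submodule ℚ A} (h : ∀ i, PrStable (P i)) :
    PrStable (⨆ i, P i) := by
  intro n a ha
  have : (⨆ i, P i) ≤ (⨆ i, P i).comap (pr A n) :=
    iSup_le fun i a ha => Submodule.mem_iSup_of_mem i (h i n a ha)
  exact this ha

theorem prStable_of_le_Gr {P : Submodule ℚ A} {n : ℕ} (h : P ≤ Gr A n) : PrStable P := by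
  intro m a ha
  by_cases hm : m = n
  · subst hm; rw [pr_of_mem (h ha)]; exact ha
  · rw [pr_of_ne (h ha) hm]; exact zero_mem _

theorem PrStable.sgn {P : Submodule ℚ A} (hP : PrStable P) {a : A} (ha : a ∈ P) :
    RHT.sgn A a ∈ P := by
  obtain ⟨N, hN⟩ := exists_sum_pr a
  rw [hN, map_sum]
  refine Submodule.sum_mem _ fun i _ => ?_
  rw [sgn_of_mem (pr_mem i a)]
  exact Submodule.smul_mem _ _ (hP i a ha)

theorem prStable_ker {B : Type} [GCDGA B] {f : A →ₐ[ℚ] B} (hf : GrHom f) :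
    PrStable (LinearMap.ker f.toLinearMap) := by
  intro n a ha
  have ha' : f a = 0 := ha
  change f (pr A n a) = 0
  rw [hf.pr, ha', map_zero]

theorem dStable_pow {P : Submodule ℚ A} (hP : PrStable P) (hd : ∀ a ∈ P, Dd A a ∈ P) (n : ℕ) :
    ∀ a ∈ P ^ n, Dd A a ∈ P ^ n := by
  induction n with
  | zero =>
    intro a ha
    rw [pow_zero, Submodule.mem_one] at ha
    obtain ⟨c, rfl⟩ := ha
    rw [Dd_algebraMap]; exact zero_mem _
  | succ n ih =>
    intro x hx
    rw [pow_succ] at hx ⊢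
    induction hx using Submodule.mul_induction_on' with
    | add x _ y _ hx hy => rw [map_add]; exact add_mem hx hy
    | mem_mul_mem a ha b hb =>
      rw [Dd_mul]
      exact add_mem (Submodule.mul_mem_mul (ih a ha) hb)
        (Submodule.mul_mem_mul ((hP.pow n).sgn ha) (hd b hb))

theorem prStable_adjoin {s : Set A} (hs : ∀ a ∈ s, ∃ n, a ∈ Gr A n) :
    PrStable (Subalgebra.toSubmodule (Algebra.adjoin ℚ s)) := by
  rw [Algebra.adjoin_eq_span]
  refine prStable_span fun a ha => ?_
  induction ha using Submonoid.closure_induction with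
  | mem x hx => exact hs x hx
  | one => exact ⟨0, one_mem_Gr⟩
  | mul x y _ _ hx hy =>
    obtain ⟨i, hi⟩ := hx
    obtain ⟨j, hj⟩ := hy
    exact ⟨i + j, mul_mem_Gr hi hj⟩

end Stable

/-! ### The higher topological complexity in terms of a tensor power -/

section TC

variable {A : Type} [GCDGA A] {r : ℕ}

namespace TensorPower

variable {T : Type} [GCDGA T] (TP : TensorPower A r T)

theorem mu_dga : IsDGAHom TP.mu :=
  (TP.coprod A (fun _ => AlgHom.id ℚ A) (fun _ => isDGAHom_id A)).choose_spec.1.1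

theorem mu_ι (j : Fin r) (a : A) : TP.mu (TP.ι j a) = a :=
  AlgHom.congr_fun
    ((TP.coprod A (fun _ => AlgHom.id ℚ A) (fun _ => isDGAHom_id A)).choose_spec.1.2 j) a

theorem eq_mu {f : T →ₐ[ℚ] A} (hf : IsDGAHom f) (h : ∀ j a, f (TP.ι j a) = a) : f = TP.mu :=
  (TP.coprod A (fun _ => AlgHom.id ℚ A) (fun _ => isDGAHom_id A)).choose_spec.2 f
    ⟨hf, fun j => AlgHom.ext (h j)⟩

theorem mem_kerMu {t : T} : t ∈ TP.kerMu ↔ TP.mu t = 0 := Iff.rfl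

theorem mul_kerMu_pow (k : ℕ) (t : T) {s : T} (hs : s ∈ TP.kerMu ^ (k + 1)) :
    t * s ∈ TP.kerMu ^ (k + 1) := by
  rw [pow_succ'] at hs ⊢
  induction hs using Submodule.mul_induction_on' with
  | add x _ y _ hx hy => rw [mul_add]; exact add_mem hx hy
  | mem_mul_mem a ha b hb =>
    rw [← mul_assoc]
    refine Submodule.mul_mem_mul ?_ hb
    rw [mem_kerMu] at ha ⊢
    rw [map_mul, ha, mul_zero]

theorem kerMu_pow_mul (k : ℕ) (t : T) {s : T} (hs : s ∈ TP.kerMu ^ (k + 1)) :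
    s * t ∈ TP.kerMu ^ (k + 1) := by
  rw [pow_succ] at hs ⊢
  induction hs using Submodule.mul_induction_on' with
  | add x _ y _ hx hy => rw [add_mul]; exact add_mem hx hy
  | mem_mul_mem a ha b hb =>
    rw [mul_assoc]
    refine Submodule.mul_mem_mul ha ?_
    rw [mem_kerMu] at hb ⊢
    rw [map_mul, hb, zero_mul]

theorem kerMu_pow_le {k l : ℕ} (h : k + 1 ≤ l) : TP.kerMu ^ l ≤ TP.kerMu ^ (k + 1) := by
  obtain ⟨i, rfl⟩ := Nat.exists_eq_add_of_le h
  rw [pow_add, Submodule.mul_le]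
  exact fun a ha b _ => TP.kerMu_pow_mul k b ha

end TensorPower

theorem nonempty_TCWitness {A' : Type} [GCDGA A'] {φ : A →ₐ[ℚ] A'} (D : TensorData φ r) {N : ℕ}
    (h : D.TP.kerMu ^ (N + 1) ≤ LinearMap.ker D.Φ.toLinearMap) : Nonempty (TCWitness A r N) := by
  have hpr : PrStable D.TP.kerMu := prStable_ker D.TP.mu_dga.gr
  have hd : ∀ a ∈ D.TP.kerMu, Dd D.T a ∈ D.TP.kerMu := fun a ha => by
    rw [TensorPower.mem_kerMu] at ha ⊢
    rw [D.TP.mu_dga.1, ha, map_zero]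
  obtain ⟨Q, _, ρ, hρ, hρs, hker⟩ := exists_quotient (D.TP.kerMu ^ (N + 1))
    (fun a b hb => D.TP.mul_kerMu_pow N a hb) (fun a b hb => D.TP.kerMu_pow_mul N a hb)
    (hpr.pow _) (dStable_pow hpr hd _)
  exact ⟨{ T := D.T, TP := D.TP, Q := Q, ρ := ρ, ρ_dga := hρ, ρ_surj := hρs, ρ_ker := hker
           retr := nonempty_htpyRetraction hρ hρs D.Φ_dga D.Φ_surjAcyc (hker ▸ h) }⟩

theorem lt_of_TCWitness {T : Type} [GCDGA T] (TP : TensorPower A r T) {N n : ℕ} {ω : T}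
    (hω : ω ∈ TP.kerMu ^ N) (hd : Dd T ω = 0) (hne : ∀ b, ω ≠ Dd T b) (w : TCWitness A r n) :
    N ≤ n := by
  by_contra! hlt
  obtain ⟨T₂, TP₂, Q, ρ, hρ, hρs, hker, ⟨R⟩⟩ := w
  obtain ⟨g, ⟨hg, hgι⟩, _⟩ := TP.coprod T₂ TP₂.ι TP₂.ι_dga
  obtain ⟨k, ⟨hk, hkι⟩, _⟩ := TP₂.coprod T TP.ι TP.ι_dga
  have hkg : k.comp g = AlgHom.id ℚ T := by
    obtain ⟨_, _, huniq⟩ := TP.coprod T TP.ι TP.ι_dga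
    rw [huniq (AlgHom.id ℚ T) ⟨isDGAHom_id T, fun j => rfl⟩]
    refine huniq _ ⟨hk.comp hg, fun j => ?_⟩
    rw [AlgHom.comp_assoc, hgι, hkι]
  have hmu : TP₂.mu.comp g = TP.mu := TP.eq_mu (TP₂.mu_dga.comp hg) fun j a => by
    have : g (TP.ι j a) = TP₂.ι j a := AlgHom.congr_fun (hgι j) a
    rw [AlgHom.comp_apply, this, TP₂.mu_ι]
  have hmap : (TP.kerMu ^ N).map g.toLinearMap ≤ TP₂.kerMu ^ N := by
    rw [Submodule.map_pow]
    refine pow_le_pow_left' ?_ N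
    rintro _ ⟨t, ht, rfl⟩
    exact (AlgHom.congr_fun hmu t).trans ht
  have h1 : g ω ∈ TP₂.kerMu ^ (n + 1) := TP₂.kerMu_pow_le hlt (hmap ⟨ω, hω, rfl⟩)
  rw [← hker] at h1
  obtain ⟨b, hb⟩ := R.exact_of_eq_zero h1 (by rw [← hg.1, hd, map_zero])
  refine hne (k b) ?_
  rw [← hk.1, ← hb]
  exact (AlgHom.congr_fun hkg ω).symm

theorem TC_eq_of {A' : Type} [GCDGA A'] {φ : A →ₐ[ℚ] A'} (D : TensorData φ r) {N : ℕ}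
    (h : D.TP.kerMu ^ (N + 1) ≤ LinearMap.ker D.Φ.toLinearMap) {ω : D.T}
    (hω : ω ∈ D.TP.kerMu ^ N) (hd : Dd D.T ω = 0) (hne : ∀ b, ω ≠ Dd D.T b) : TC A r = N := by
  refine le_antisymm (Nat.sInf_le (nonempty_TCWitness D h)) ?_
  refine le_csInf ⟨N, nonempty_TCWitness D h⟩ ?_
  rintro n ⟨w⟩
  exact lt_of_TCWitness D.TP hω hd hne w

end TC

/-! ### Word length -/

/-- A submodule of a direct sum which is itself spanned by pieces is compatible with the sum. -/
theorem mem_of_mem_iSup_of_le {ι A : Type} [AddCommGroup A] [Module ℚ A]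
    {L P : ι → Submodule ℚ A} (hL : iSupIndep L) (hP : ∀ k, P k ≤ L k) {a : A} (ha : a ∈ ⨆ k, P k)
    {j : ι} (haj : a ∈ L j) : a ∈ P j := by
  have h1 : a ∈ P j ⊔ ⨆ (k) (_ : k ≠ j), P k := by
    refine (iSup_le fun k => ?_ : ⨆ k, P k ≤ _) ha
    by_cases hk : k = j
    · subst hk; exact le_sup_left
    · exact le_sup_of_le_right (le_iSup₂_of_le k hk le_rfl)
  obtain ⟨p, hp, q, hq, rfl⟩ := Submodule.mem_sup.1 h1
  have hq1 : q ∈ L j := by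
    have := sub_mem haj (hP j hp)
    rwa [add_sub_cancel_left] at this
  have hq2 : q ∈ ⨆ (k) (_ : k ≠ j), L k := (iSup₂_mono fun k _ => hP k) hq
  rw [Submodule.disjoint_def.1 (hL j) q hq1 hq2, add_zero]
  exact hp

theorem adjoin_le_iSup_pow {A : Type} [Ring A] [Algebra ℚ A] (P : Submodule ℚ A) :
    Subalgebra.toSubmodule (Algebra.adjoin ℚ (P : Set A)) ≤ ⨆ k : ℕ, P ^ k := by
  intro a ha'
  have ha : a ∈ Algebra.adjoin ℚ (P : Set A) := ha'
  clear ha'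
  induction ha using Algebra.adjoin_induction with
  | mem x hx => exact Submodule.mem_iSup_of_mem 1 (by rwa [pow_one])
  | algebraMap q =>
    exact Submodule.mem_iSup_of_mem 0 (by rw [pow_zero]; exact Submodule.mem_one.2 ⟨q, rfl⟩)
  | add x y _ _ hx hy => exact add_mem hx hy
  | mul x y _ _ hx hy =>
    have h : (⨆ k : ℕ, P ^ k) * (⨆ k : ℕ, P ^ k) ≤ ⨆ k : ℕ, P ^ k := by
      rw [Submodule.iSup_mul]
      refine iSup_le fun i => ?_
      rw [Submodule.mul_iSup]
      refine iSup_le fun j => ?_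
      rw [← pow_add]
      exact le_iSup (fun k : ℕ => P ^ k) _
    exact h (Submodule.mul_mem_mul hx hy)

namespace MinimalSullivan

variable {A : Type} [GCDGA A] (S : MinimalSullivan A)

theorem Veven_sup_Vodd : S.Veven ⊔ S.Vodd = S.lam 1 := by
  rw [S.lam_one]
  refine le_antisymm (sup_le (iSup_le fun n => le_iSup S.V _) (iSup_le fun n => le_iSup S.V _))
    (iSup_le fun n => ?_)
  rcases Nat.even_or_odd' n with ⟨k, rfl | rfl⟩
  · exact le_sup_of_le_left (le_iSup (fun n => S.V (2 * n)) k)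
  · exact le_sup_of_le_right (le_iSup (fun n => S.V (2 * n + 1)) k)

theorem prStable_V (n : ℕ) : PrStable (S.V n) := prStable_of_le_Gr (S.V_le n)

theorem prStable_Veven : PrStable S.Veven := PrStable.iSup fun _ => S.prStable_V _

theorem prStable_Vodd : PrStable S.Vodd := PrStable.iSup fun _ => S.prStable_V _

theorem prStable_lam_one : PrStable (S.lam 1) := by
  rw [S.lam_one]; exact PrStable.iSup fun _ => S.prStable_V _

theorem mem_V {n : ℕ} {a : A} (ha : a ∈ S.lam 1) (hn : a ∈ Gr A n) : a ∈ S.V n := by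
  rw [S.lam_one] at ha
  exact mem_of_mem_iSup_of_le (DirectSum.Decomposition.isInternal (Gr A)).submodule_iSupIndep
    S.V_le ha hn

theorem Veven_odd {n : ℕ} (hn : Odd n) {a : A} (ha : a ∈ S.Veven) (h : a ∈ Gr A n) : a = 0 := by
  have h1 : S.Veven ≤ LinearMap.ker (pr A n) := by
    refine iSup_le fun k a ha => ?_
    exact pr_of_ne (S.V_le _ ha) (by rintro rfl; exact Nat.not_odd_iff_even.2 (even_two_mul k) hn)
  rw [← pr_of_mem h]; exact h1 ha

theorem Vodd_even {n : ℕ} (hn : Even n) {a : A} (ha : a ∈ S.Vodd) (h : a ∈ Gr A n) : a = 0 := by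
  have h1 : S.Vodd ≤ LinearMap.ker (pr A n) := by
    refine iSup_le fun k a ha => ?_
    exact pr_of_ne (S.V_le _ ha)
      (by rintro rfl; exact Nat.not_even_iff_odd.2 (odd_two_mul_add_one k) hn)
  rw [← pr_of_mem h]; exact h1 ha

theorem disjoint_Veven_Vodd : Disjoint S.Veven S.Vodd := by
  rw [Submodule.disjoint_def]
  intro a ha hb
  obtain ⟨s, hs⟩ := exists_sum_pr a
  rw [hs]
  refine Finset.sum_eq_zero fun i _ => ?_
  rcases Nat.even_or_odd i with hi | hi
  · exact S.Vodd_even hi (S.prStable_Vodd i a hb) (pr_mem i a)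
  · exact S.Veven_odd hi (S.prStable_Veven i a ha) (pr_mem i a)

variable {S}

theorem adjoin_lam_one (hpure : S.Pure) : Algebra.adjoin ℚ (S.lam 1 : Set A) = ⊤ := by
  let s : Set A := ⋃ n, (S.V n : Set A)
  let A0 := Algebra.adjoin ℚ s
  have hVA : ∀ n, S.V n ≤ Subalgebra.toSubmodule A0 := fun n v hv =>
    Algebra.subset_adjoin (Set.mem_iUnion.2 ⟨n, hv⟩)
  have hpr : PrStable (Subalgebra.toSubmodule A0) := prStable_adjoin fun a ha => by
    obtain ⟨n, hn⟩ := Set.mem_iUnion.1 ha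
    exact ⟨n, S.V_le n hn⟩
  have hE : Algebra.adjoin ℚ (S.Veven : Set A) ≤ A0 :=
    Algebra.adjoin_le ((iSup_le fun n => hVA _ : S.Veven ≤ Subalgebra.toSubmodule A0))
  have hd : ∀ a ∈ A0, Dd A a ∈ A0 := by
    intro a ha
    induction ha using Algebra.adjoin_induction with
    | mem x hx =>
      obtain ⟨n, hn⟩ := Set.mem_iUnion.1 hx
      rcases Nat.even_or_odd' n with ⟨k, rfl | rfl⟩
      · rw [hpure.1 x (Submodule.mem_iSup_of_mem k hn)]; exact zero_mem _
      · exact hE (hpure.2 x (Submodule.mem_iSup_of_mem k hn))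
    | algebraMap q => rw [Dd_algebraMap]; exact zero_mem _
    | add x y _ _ hx hy => rw [map_add]; exact add_mem hx hy
    | mul x y hx' hy' hx hy =>
      rw [Dd_mul]
      exact add_mem (mul_mem hx hy') (mul_mem (hpr.sgn hx') hy)
  let _ : GCDGA A0 := subGCDGA A0 hpr hd
  have hval : GrHom A0.val := fun i a ha => ha
  obtain ⟨g, ⟨hg, hgV⟩, _⟩ := S.free A0
    (fun n => (S.V n).subtype.codRestrict (Subalgebra.toSubmodule A0) fun v => hVA n v.2)
    fun n v => S.V_le n v.2
  have hid : A0.val.comp g = AlgHom.id ℚ A := by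
    obtain ⟨_, _, huniq⟩ := S.free A (fun n => (S.V n).subtype) fun n v => S.V_le n v.2
    rw [huniq (AlgHom.id ℚ A) ⟨fun _ _ h => h, fun _ _ => rfl⟩]
    refine huniq _ ⟨fun i a ha => hval i _ (hg i a ha), fun n v => ?_⟩
    rw [AlgHom.comp_apply, hgV]; rfl
  rw [eq_top_iff]
  intro a _
  have h1 : a ∈ A0 := by
    have := AlgHom.congr_fun hid a
    rw [AlgHom.id_apply] at this
    rw [← this]; exact (g a).2
  refine Algebra.adjoin_mono (Set.iUnion_subset fun n => ?_) h1
  rw [S.lam_one]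
  exact le_iSup S.V n

variable (S) in
theorem lam_one_pow_le (k : ℕ) : S.lam 1 ^ k ≤ S.lam k := by
  induction k with
  | zero => rw [pow_zero, S.lam_zero]
  | succ k ih => rw [pow_succ]; exact (mul_le_mul' ih le_rfl).trans (S.lam_mul k 1)

theorem lam_eq (hpure : S.Pure) (k : ℕ) : S.lam k = S.lam 1 ^ k := by
  refine le_antisymm (fun a ha => ?_) (S.lam_one_pow_le k)
  refine mem_of_mem_iSup_of_le S.lam_internal.submodule_iSupIndep S.lam_one_pow_le ?_ ha
  refine adjoin_le_iSup_pow _ ?_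
  rw [adjoin_lam_one hpure]; trivial

theorem Dd_lam (hpure : S.Pure) (hcof : S.Coformal) (k : ℕ) :
    ∀ a ∈ S.lam k, Dd A a ∈ S.lam (k + 1) := by
  have h1 : ∀ a ∈ S.lam 1, Dd A a ∈ S.lam 2 := by
    have : S.lam 1 ≤ (S.lam 2).comap (Dd A) := by
      rw [S.lam_one]; exact iSup_le fun n v hv => hcof n v hv
    exact this
  induction k with
  | zero =>
    intro a ha
    rw [S.lam_zero, Submodule.mem_one] at ha
    obtain ⟨c, rfl⟩ := ha
    rw [Dd_algebraMap]; exact zero_mem _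
  | succ k ih =>
    intro x hx
    rw [lam_eq hpure, pow_succ] at hx
    induction hx using Submodule.mul_induction_on' with
    | add x _ y _ hx hy => rw [map_add]; exact add_mem hx hy
    | mem_mul_mem a ha b hb =>
      rw [Dd_mul]
      refine add_mem ?_ ?_
      · rw [lam_eq hpure, pow_succ]
        exact Submodule.mul_mem_mul (lam_eq hpure _ ▸ ih a (lam_eq hpure k ▸ ha)) hb
      · rw [lam_eq hpure, show k + 1 + 1 = k + 2 from rfl, pow_add]
        exact Submodule.mul_mem_mul ((S.prStable_lam_one.pow k).sgn ha)
          (lam_eq hpure 2 ▸ h1 b hb)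

end MinimalSullivan

/-! ### The rational category -/

section Cat

variable {A : Type} [GCDGA A] {S : MinimalSullivan A}

/-- The ideal of words of length at least `n`. -/
def lamGe (S : MinimalSullivan A) (n : ℕ) : Submodule ℚ A := ⨆ k, ⨆ (_ : n < k), S.lam k

theorem lam_le_lamGe {n k : ℕ} (h : n < k) : S.lam k ≤ lamGe S n := le_iSup₂_of_le k h le_rfl

theorem lamGe_mul (n : ℕ) (a b : A) (hb : b ∈ lamGe S n) :
    a * b ∈ lamGe S n ∧ b * a ∈ lamGe S n := by
  have ha : a ∈ ⨆ k, S.lam k := by rw [S.lam_internal.submodule_iSup_eq_top]; trivial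
  constructor
  · have h := Submodule.mul_mem_mul ha hb
    refine (?_ : (⨆ k, S.lam k) * lamGe S n ≤ _) h
    simp only [lamGe, Submodule.iSup_mul, Submodule.mul_iSup, iSup_le_iff]
    exact fun i hi j => (S.lam_mul j i).trans (lam_le_lamGe (by omega))
  · have h := Submodule.mul_mem_mul hb ha
    refine (?_ : lamGe S n * (⨆ k, S.lam k) ≤ _) h
    simp only [lamGe, Submodule.iSup_mul, Submodule.mul_iSup, iSup_le_iff]
    exact fun i j hj => (S.lam_mul _ _).trans (lam_le_lamGe (by omega))

theorem nonempty_catWitness (hpure : S.Pure) (hcof : S.Coformal) {A' : Type} [GCDGA A']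
    {φ : A →ₐ[ℚ] A'} (hφ : IsDGAHom φ) (h : SurjAcyc φ) {n : ℕ}
    (hk : ∀ k, n < k → ∀ a ∈ S.lam k, φ a = 0) : Nonempty (CatWitness A S n) := by
  have hpr : PrStable (lamGe S n) := PrStable.iSup fun k => PrStable.iSup fun _ => by
    rw [MinimalSullivan.lam_eq hpure]; exact S.prStable_lam_one.pow k
  have hd : ∀ a ∈ lamGe S n, Dd A a ∈ lamGe S n := by
    have : lamGe S n ≤ (lamGe S n).comap (Dd A) := iSup₂_le fun k hk a ha =>
      lam_le_lamGe (by omega) (MinimalSullivan.Dd_lam hpure hcof k a ha)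
    exact this
  obtain ⟨Q, _, π, hπ, hπs, hker⟩ := exists_quotient (lamGe S n)
    (fun a b hb => (lamGe_mul n a b hb).1) (fun a b hb => (lamGe_mul n a b hb).2) hpr hd
  refine ⟨{ Q := Q, π := π, π_dga := hπ, π_surj := hπs, π_ker := hker
            retr := nonempty_htpyRetraction hπ hπs hφ h ?_ }⟩
  rw [hker]
  exact iSup₂_le fun k hk' a ha => hk k hk' a ha

theorem cat_eq_of (hpure : S.Pure) (hcof : S.Coformal) {A' : Type} [GCDGA A']
    {φ : A →ₐ[ℚ] A'} (hφ : IsDGAHom φ) (h : SurjAcyc φ) {m : ℕ}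
    (hk : ∀ k, m < k → ∀ a ∈ S.lam k, φ a = 0) {ω : A} (hω : ω ∈ S.lam m) (hd : Dd A ω = 0)
    (hne : ∀ b, ω ≠ Dd A b) : cat A S = m := by
  refine le_antisymm (Nat.sInf_le (nonempty_catWitness hpure hcof hφ h hk)) ?_
  refine le_csInf ⟨m, nonempty_catWitness hpure hcof hφ h hk⟩ ?_
  rintro n ⟨w⟩
  by_contra! hlt
  obtain ⟨Q, π, hπ, hπs, hker, ⟨R⟩⟩ := w
  have h1 : π ω = 0 := by
    have : ω ∈ LinearMap.ker π.toLinearMap := by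
      rw [hker]; exact lam_le_lamGe hlt hω
    exact this
  obtain ⟨b, hb⟩ := R.exact_of_eq_zero h1 hd
  exact hne b hb

end Cat

/-! ### Homogeneous generators -/

theorem exists_homogeneous_basis {A : Type} [AddCommGroup A] [Module ℚ A] (U : ℕ → Submodule ℚ A)
    (hfin : FiniteDimensional ℚ (⨆ n, U n : Submodule ℚ A)) :
    ∃ (k : ℕ) (v : Fin k → A) (d : Fin k → ℕ), (∀ i, v i ∈ U (d i)) ∧ LinearIndependent ℚ v ∧
      Submodule.span ℚ (Set.range v) = ⨆ n, U n := by
  obtain ⟨s, hs, hspan, hli⟩ := exists_linearIndependent ℚ (⋃ n, (U n : Set A))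
  have hspan' : Submodule.span ℚ s = ⨆ n, U n := by
    rw [hspan, Submodule.span_iUnion]; simp
  have hfs : Finite s := by
    rw [← hspan'] at hfin
    let w : s → Submodule.span ℚ s := fun a => ⟨a, Submodule.subset_span a.2⟩
    have hw : LinearIndependent ℚ w :=
      LinearIndependent.of_comp (Submodule.span ℚ s).subtype hli
    exact hw.finite
  obtain ⟨k, ⟨f⟩⟩ := Finite.exists_equiv_fin s
  have hmem : ∀ i : Fin k, ∃ d, ((f.symm i : s) : A) ∈ U d := fun i =>
    Set.mem_iUnion.1 (hs (f.symm i).2)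
  choose d hd using hmem
  refine ⟨k, fun i => f.symm i, d, hd, hli.comp _ f.symm.injective, ?_⟩
  rw [← hspan']
  congr 1
  ext a
  constructor
  · rintro ⟨i, rfl⟩; exact (f.symm i).2
  · exact fun ha => ⟨f ⟨a, ha⟩, by simp⟩

namespace MinimalSullivan

variable {A : Type} [GCDGA A] {S : MinimalSullivan A}

theorem freeOn (hpure : S.Pure) {ι : Type} {v : ι → A} {deg : ι → ℕ}
    (hv : ∀ i, v i ∈ S.V (deg i)) (hli : LinearIndependent ℚ v)
    (hspan : Submodule.span ℚ (Set.range v) = S.lam 1) : FreeOn v deg := by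
  refine ⟨fun i => S.V_le _ (hv i), ?_, fun B _ c hc => ?_⟩
  · rw [← Algebra.adjoin_span (R := ℚ) (s := Set.range v), hspan, adjoin_lam_one hpure]
  · obtain ⟨L, hL⟩ : ∃ L : A →ₗ[ℚ] B, ∀ i, L (v i) = c i := by
      obtain ⟨L, hL⟩ := LinearMap.exists_extend
        ((Module.Basis.span hli).constr ℚ c : Submodule.span ℚ (Set.range v) →ₗ[ℚ] B)
      refine ⟨L, fun i => ?_⟩
      have h := LinearMap.congr_fun hL (Module.Basis.span hli i)
      rw [Module.Basis.constr_basis, LinearMap.comp_apply, Submodule.subtype_apply,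
        Module.Basis.span_apply] at h
      exact h
    have hLV : ∀ n, ∀ a ∈ S.V n, L a ∈ Gr B n := by
      intro n a ha
      have h1 : a ∈ Submodule.span ℚ (Set.range v) := by
        rw [hspan, S.lam_one]; exact Submodule.mem_iSup_of_mem n ha
      have h2 : L (pr A n a) = pr B n (L a) := by
        refine LinearMap.eqOn_span' (f := L ∘ₗ pr A n) (g := pr B n ∘ₗ L) ?_ h1
        rintro _ ⟨i, rfl⟩
        have h3 := S.V_le _ (hv i)
        change L (pr A n (v i)) = pr B n (L (v i))
        by_cases h : n = deg i
        · subst h; rw [pr_of_mem h3, hL, pr_of_mem (hc i)]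
        · rw [pr_of_ne h3 h, hL, pr_of_ne (hc i) h, map_zero]
      rw [pr_of_mem (S.V_le n ha)] at h2
      rw [h2]; exact pr_mem n _
    obtain ⟨g, ⟨hg, hgV⟩, _⟩ := S.free B (fun n => L ∘ₗ (S.V n).subtype) fun n a => hLV n a a.2
    exact ⟨g, hg, fun i => (hgV (deg i) ⟨v i, hv i⟩).trans (hL i)⟩

end MinimalSullivan

/-- A homogeneous basis of the even generators of a pure coformal model. -/
structure XBasis {A : Type} [GCDGA A] (S : MinimalSullivan A) (x : Fin 2 → A) (e : Fin 2 → ℕ) :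
    Prop where
  pure : S.Pure
  cof : S.Coformal
  fin : FiniteDimensional ℚ (S.lam 1)
  even : ∀ i, Even (e i)
  mem : ∀ i, x i ∈ S.V (e i)
  li : LinearIndependent ℚ x
  span : Submodule.span ℚ (Set.range x) = S.Veven

namespace XBasis

variable {A : Type} [GCDGA A] {S : MinimalSullivan A} {x : Fin 2 → A} {e : Fin 2 → ℕ}
  (h : XBasis S x e)

include h

theorem mem_Gr (i : Fin 2) : x i ∈ Gr A (e i) := S.V_le _ (h.mem i)

theorem comm (i : Fin 2) (a : A) : x i * a = a * x i := even_comm (h.mem_Gr i) (h.even i) a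

theorem e_pos (i : Fin 2) : 0 < e i := by
  rcases Nat.eq_zero_or_pos (e i) with h0 | h0
  · have := h.mem i
    rw [h0, S.V0, Submodule.mem_bot] at this
    exact absurd this (h.li.ne_zero i)
  · exact h0

theorem x_mem_Veven (i : Fin 2) : x i ∈ S.Veven := by
  rw [← h.span]; exact Submodule.subset_span ⟨i, rfl⟩

theorem Dd_x (i : Fin 2) : Dd A (x i) = 0 := h.pure.1 _ (h.x_mem_Veven i)

/-- Combining the basis of the even generators with one of the odd generators. -/
theorem freeOn_sum {κ : Type} {y : κ → A} {d : κ → ℕ} (hy : ∀ k, y k ∈ S.V (2 * d k + 1))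
    (hli : LinearIndependent ℚ y) (hspan : Submodule.span ℚ (Set.range y) = S.Vodd) :
    FreeOn (Sum.elim x y) (Sum.elim e fun k => 2 * d k + 1) := by
  refine MinimalSullivan.freeOn h.pure ?_ (h.li.sum_type hli ?_) ?_
  · rintro (i | k)
    exacts [h.mem i, hy k]
  · rw [h.span, hspan]; exact S.disjoint_Veven_Vodd
  · rw [Set.Sum.elim_range, Submodule.span_union, h.span, hspan, S.Veven_sup_Vodd]

theorem finVodd : FiniteDimensional ℚ S.Vodd :=
  have := h.fin
  Submodule.finiteDimensional_of_le (S.Veven_sup_Vodd ▸ le_sup_right : S.Vodd ≤ S.lam 1)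

theorem exists_toPoly : ∃ f : A →ₐ[ℚ] Poly e h.even, GrHom f ∧ (∀ i, f (x i) = Poly.X e h.even i) ∧
    ∀ y ∈ S.Vodd, f y = 0 := by
  obtain ⟨k, y, d, hy, hli, hspan⟩ := exists_homogeneous_basis _ h.finVodd
  obtain ⟨f, hf, hfg⟩ := (h.freeOn_sum hy hli hspan).2.2 (Poly e h.even)
    (Sum.elim (Poly.X e h.even) 0) (by
      rintro (i | k)
      exacts [Poly.X_mem i, zero_mem _])
  refine ⟨f, hf, fun i => hfg (Sum.inl i), fun a ha => ?_⟩
  rw [show S.Vodd = ⨆ n, S.V (2 * n + 1) from rfl, ← hspan] at ha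
  refine (Submodule.span_le.2 ?_ : _ ≤ LinearMap.ker f.toLinearMap) ha
  rintro _ ⟨i, rfl⟩
  exact hfg (Sum.inr i)

theorem exists_quad {a : A} (ha : a ∈ S.Veven ^ 2) : ∃ c, a = quad x c := by
  rw [pow_two, ← h.span, Submodule.span_mul_span] at ha
  induction ha using Submodule.span_induction with
  | zero => exact ⟨0, by simp [quad]⟩
  | add a b _ _ ha hb =>
    obtain ⟨c, rfl⟩ := ha
    obtain ⟨c', rfl⟩ := hb
    exact ⟨c + c', (Regular.quad_add x c c').symm⟩
  | smul q a _ ha =>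
    obtain ⟨c, rfl⟩ := ha
    exact ⟨q • c, (Regular.quad_smul x q c).symm⟩
  | mem a ha =>
    obtain ⟨_, ⟨i, rfl⟩, _, ⟨j, rfl⟩, rfl⟩ := ha
    fin_cases i <;> fin_cases j
    · exact ⟨![1, 0, 0], by simp [quad]⟩
    · exact ⟨![0, 1, 0], by simp [quad]⟩
    · exact ⟨![0, 1, 0], by simp [quad, h.comm 1]⟩
    · exact ⟨![0, 0, 1], by simp [quad]⟩

theorem Dd_Vodd {y : A} (hy : y ∈ S.Vodd) : ∃ c, Dd A y = quad x c := by
  refine h.exists_quad ?_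
  have h1 : Dd A y ∈ S.lam 2 := MinimalSullivan.Dd_lam h.pure h.cof 1 y
    ((S.Veven_sup_Vodd ▸ le_sup_right : S.Vodd ≤ S.lam 1) hy)
  refine mem_of_mem_iSup_of_le S.lam_internal.submodule_iSupIndep (fun k => ?_)
    (adjoin_le_iSup_pow _ (h.pure.2 y hy)) h1
  exact (pow_le_pow_left' (S.Veven_sup_Vodd ▸ le_sup_left : S.Veven ≤ S.lam 1) k).trans
    (S.lam_one_pow_le k)

omit h in
theorem _root_.RHT.Poly.quad_injective {he : ∀ i, Even (e i)} :
    Function.Injective (quad (Poly.X e he)) := by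
  intro c c' hcc
  have key : ∀ c : Fin 3 → ℚ, ∀ p q : ℚ,
      MvPolynomial.eval ![p, q] (quad (Poly.X e he) c : MvPolynomial (Fin 2) ℚ) =
        c 0 * (p * p) + c 1 * (p * q) + c 2 * (q * q) := by
    intro c p q
    have := map_quad (MvPolynomial.aeval ![p, q] : MvPolynomial (Fin 2) ℚ →ₐ[ℚ] ℚ)
      (MvPolynomial.X) c
    refine Eq.trans ?_ (this.trans ?_)
    · rw [← MvPolynomial.coe_aeval_eq_eval]; rfl
    · simp [quad]
  have h1 := fun p q => (key c p q).symm.trans ((congrArg _ hcc).trans (key c' p q))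
  have h10 := h1 1 0
  have h01 := h1 0 1
  have h11 := h1 1 1
  ext i
  fin_cases i <;> simp at h10 h01 h11 ⊢ <;> linarith

theorem quad_injective : Function.Injective (quad x) := by
  obtain ⟨f, _, hfx, _⟩ := h.exists_toPoly
  intro c c' hcc
  have := congrArg f hcc
  rw [map_quad, map_quad, show f ∘ x = Poly.X e h.even from funext hfx] at this
  exact Poly.quad_injective this

end XBasis

/-! ### Linear systems of binary quadratic forms without common zeros -/

theorem exists_zero_of_degenerate (β : Fin 3 → ℂ) (h0 : β ≠ 0) (hdeg : β 0 * β 2 = β 1 * β 1) :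
    ∃ p : Fin 2 → ℂ, p ≠ 0 ∧
      ∀ c : Fin 3 → ℚ, c 0 * β 0 + c 1 * β 1 + c 2 * β 2 = 0 → quad p c = 0 := by
  by_cases hp : β 0 = 0
  · have h1 : β 1 = 0 := by rw [hp, zero_mul] at hdeg; exact mul_self_eq_zero.1 hdeg.symm
    have h2 : β 2 ≠ 0 := fun h2 => h0 (by ext i; fin_cases i <;> assumption)
    refine ⟨![0, 1], fun h => by simpa using congrFun h 1, fun c hc => ?_⟩
    rw [hp, h1, mul_zero, mul_zero, zero_add, zero_add] at hc
    have hc2 : (c 2 : ℂ) = 0 := (mul_eq_zero.1 hc).resolve_right h2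
    simp only [quad, Algebra.smul_def, eq_ratCast]
    simp [hc2]
  · refine ⟨![β 0, β 1], fun h => hp (congrFun h 0), fun c hc => ?_⟩
    simp only [quad, Algebra.smul_def, eq_ratCast]
    simp only [Matrix.cons_val]
    linear_combination β 0 * hc - (c 2 : ℂ) * hdeg

theorem exists_form (D : Submodule ℚ (Fin 3 → ℚ))
    (hD : ∀ p : Fin 2 → ℂ, p ≠ 0 → ∃ c ∈ D, quad p c ≠ 0) :
    D = ⊤ ∨ ∃ b : Fin 3 → ℚ, b 0 * b 2 - b 1 * b 1 ≠ 0 ∧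
      ∀ c, c ∈ D ↔ c 0 * b 0 + c 1 * b 1 + c 2 * b 2 = 0 := by
  have hfun : ∀ f : (Fin 3 → ℚ) →ₗ[ℚ] ℚ, ∃ b : Fin 3 → ℚ,
      ∀ c, f c = c 0 * b 0 + c 1 * b 1 + c 2 * b 2 := fun f => by
    refine ⟨fun i => f (Pi.single i 1), fun c => ?_⟩
    conv_lhs => rw [LinearMap.pi_apply_eq_sum_univ f c]
    rw [Fin.sum_univ_three]
    simp [← Pi.single_apply, eq_comm]
  have hsep : ∀ c, c ∉ D → ∃ b : Fin 3 → ℚ, (∀ c ∈ D, c 0 * b 0 + c 1 * b 1 + c 2 * b 2 = 0) ∧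
      c 0 * b 0 + c 1 * b 1 + c 2 * b 2 ≠ 0 := fun c hc => by
    obtain ⟨f, hf, hfD⟩ := Submodule.exists_le_ker_of_notMem hc
    obtain ⟨b, hb⟩ := hfun f
    exact ⟨b, fun c' hc' => by rw [← hb]; exact hfD hc', by rwa [← hb]⟩
  have hdeg : ∀ β : Fin 3 → ℂ, β ≠ 0 → (∀ c ∈ D, c 0 * β 0 + c 1 * β 1 + c 2 * β 2 = 0) →
      β 0 * β 2 - β 1 * β 1 ≠ 0 := fun β h0 hβ hd => by
    obtain ⟨p, hp, hpc⟩ := exists_zero_of_degenerate β h0 (sub_eq_zero.1 hd)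
    obtain ⟨c, hc, hne⟩ := hD p hp
    exact hne (hpc c (hβ c hc))
  by_cases htop : D = ⊤
  · exact Or.inl htop
  obtain ⟨c₀, hc₀⟩ : ∃ c, c ∉ D := by
    by_contra! h; exact htop (eq_top_iff.2 fun c _ => h c)
  obtain ⟨b, hb, hbc⟩ := hsep c₀ hc₀
  have hbnd : (b 0 : ℂ) * b 2 - b 1 * b 1 ≠ 0 := by
    refine hdeg (fun i => (b i : ℂ)) (fun h => hbc ?_) fun c hc => by exact_mod_cast hb c hc
    have : ∀ i, b i = 0 := fun i => by
      have := congrFun h i; simpa using this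
    simp [this]
  refine Or.inr ⟨b, by exact_mod_cast hbnd, fun c => ⟨hb c, fun hc => ?_⟩⟩
  by_contra hcD
  obtain ⟨b', hb', hbc'⟩ := hsep c hcD
  obtain ⟨z, hz⟩ := IsAlgClosed.exists_pow_nat_eq (k := ℂ)
    (((b 0 : ℂ) * b' 2 + b' 0 * b 2 - 2 * b 1 * b' 1) ^ 2 -
      4 * (b 0 * b 2 - b 1 * b 1) * (b' 0 * b' 2 - b' 1 * b' 1)) (n := 2) (by norm_num)
  set δ : ℂ := (b 0 : ℂ) * b 2 - b 1 * b 1 with hδ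
  set ν : ℂ := (b 0 : ℂ) * b' 2 + b' 0 * b 2 - 2 * b 1 * b' 1 with hν
  let t : ℂ := (z - ν) / (2 * δ)
  have ht : 2 * δ * t = z - ν := by
    change 2 * δ * ((z - ν) / (2 * δ)) = _
    field_simp
  refine hdeg (fun i => t * b i + b' i) (fun h => hbc' ?_) (fun c hc => ?_) ?_
  · have h' : ∀ i, t * (b i : ℂ) + b' i = 0 := fun i => congrFun h i
    have hcC : (c 0 : ℂ) * b 0 + c 1 * b 1 + c 2 * b 2 = 0 := by exact_mod_cast hc
    have : (c 0 : ℂ) * b' 0 + c 1 * b' 1 + c 2 * b' 2 = 0 := by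
      linear_combination c 0 * h' 0 + c 1 * h' 1 + c 2 * h' 2 - t * hcC
    exact_mod_cast this
  · have h1 : (c 0 : ℂ) * b 0 + c 1 * b 1 + c 2 * b 2 = 0 := by exact_mod_cast hb c hc
    have h2 : (c 0 : ℂ) * b' 0 + c 1 * b' 1 + c 2 * b' 2 = 0 := by exact_mod_cast hb' c hc
    linear_combination t * h1 + h2
  · have h4 : 4 * δ * (δ * t ^ 2 + ν * t + (b' 0 * b' 2 - b' 1 * b' 1)) = 0 := by
      linear_combination (2 * δ * t + ν + z) * ht + hz
    have h5 := (mul_eq_zero.1 h4).resolve_left (mul_ne_zero (by norm_num) hbnd)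
    rw [← h5, hδ, hν]
    ring

/-! ### The quadratic relations of an elliptic model -/

theorem pr_Dd {A : Type} [GCDGA A] (n : ℕ) (a : A) :
    pr A (n + 1) (Dd A a) = Dd A (pr A n a) := by
  induction a using Gr_induction with
  | add a b h h' => rw [map_add, map_add, h, h', map_add, map_add]
  | hom i a ha =>
    by_cases h : n = i
    · subst h; rw [pr_of_mem ha, pr_of_mem (Dd_mem ha)]
    · rw [pr_of_ne ha h, pr_of_ne (Dd_mem ha) (by omega), map_zero]

theorem exists_pr_Dd {A : Type} [GCDGA A] (n : ℕ) (a : A) : ∃ b, pr A n (Dd A a) = Dd A b := by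
  cases n with
  | succ n => exact ⟨_, pr_Dd n a⟩
  | zero =>
    refine ⟨0, ?_⟩
    rw [map_zero]
    induction a using Gr_induction with
    | add a b h h' => rw [map_add, map_add, h, h', add_zero]
    | hom i a ha => exact pr_of_ne (Dd_mem ha) (by omega)

theorem exists_exact_of_finite {A : Type} [GCDGA A] (hfin : FiniteDimensional ℚ (CohClasses A))
    (a : ℕ → A) (d : ℕ → ℕ) (hinj : Function.Injective d) (ha : ∀ n, a n ∈ Gr A (d n))
    (hd : ∀ n, Dd A (a n) = 0) : ∃ n b, a n = Dd A b := by
  by_contra! hne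
  let q : LinearMap.ker (Dd A) →ₗ[ℚ] CohClasses A :=
    ((LinearMap.range (Dd A)).comap (LinearMap.ker (Dd A)).subtype).mkQ
  have hq : ∀ u : LinearMap.ker (Dd A), q u = 0 → ∃ b, (u : A) = Dd A b := fun u hu => by
    obtain ⟨b, hb⟩ := (Submodule.Quotient.mk_eq_zero _).1 hu
    exact ⟨b, hb.symm⟩
  have hli : LinearIndependent ℚ fun n => q ⟨a n, hd n⟩ := by
    rw [linearIndependent_iff']
    intro s g hg n hn
    rw [← (Finset.sum_congr rfl fun i _ => map_smul q (g i) ⟨a i, hd i⟩), ← map_sum] at hg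
    obtain ⟨b, hb⟩ := hq _ hg
    have h1 := congrArg (pr A (d n)) hb
    have h2 : pr A (d n) ((∑ i ∈ s, g i • (⟨a i, hd i⟩ : LinearMap.ker (Dd A)) :
        LinearMap.ker (Dd A)) : A) = g n • a n := by
      rw [AddSubmonoidClass.coe_finsetSum, map_sum, Finset.sum_eq_single n]
      · exact pr_of_mem (Submodule.smul_mem _ _ (ha n))
      · exact fun i _ hi => pr_of_ne (Submodule.smul_mem _ _ (ha i)) fun h => hi (hinj h.symm)
      · exact fun h => absurd hn h
    rw [h2] at h1
    by_contra hgn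
    obtain ⟨b', hb'⟩ := exists_pr_Dd (d n) b
    refine hne n ((g n)⁻¹ • b') ?_
    rw [map_smul, ← hb', ← h1, smul_smul, inv_mul_cancel₀ hgn, one_smul]
  exact Module.Finite.not_linearIndependent_of_infinite _ hli

namespace XBasis

variable {A : Type} [GCDGA A] {S : MinimalSullivan A} {x : Fin 2 → A} {e : Fin 2 → ℕ}
  (h : XBasis S x e)

/-- The coefficients of the differentials of the odd generators. -/
def rel (_ : XBasis S x e) : Submodule ℚ (Fin 3 → ℚ) where
  carrier := {c | ∃ y ∈ S.Vodd, Dd A y = quad x c}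
  zero_mem' := ⟨0, zero_mem _, by simp [quad]⟩
  add_mem' := by
    rintro c c' ⟨y, hy, hc⟩ ⟨y', hy', hc'⟩
    exact ⟨y + y', add_mem hy hy', by rw [map_add, hc, hc', Regular.quad_add]⟩
  smul_mem' := by
    rintro q c ⟨y, hy, hc⟩
    exact ⟨q • y, Submodule.smul_mem _ _ hy, by rw [map_smul, hc, Regular.quad_smul]⟩

include h

theorem exists_quad_ne_zero (hfin : FiniteDimensional ℚ (CohClasses A)) (p : Fin 2 → ℂ)
    (hp : p ≠ 0) : ∃ c ∈ h.rel, quad p c ≠ 0 := by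
  by_contra! hz
  obtain ⟨f, _, hfx, hfy⟩ := h.exists_toPoly
  let g : Poly e h.even →ₐ[ℚ] ℂ := (MvPolynomial.aeval p : MvPolynomial (Fin 2) ℚ →ₐ[ℚ] ℂ)
  let χ : A →ₐ[ℚ] ℂ := g.comp f
  have hχx : χ ∘ x = p := funext fun i => by
    change g (f (x i)) = p i
    rw [hfx]; exact MvPolynomial.aeval_X p i
  have hχd : ∀ a, χ (Dd A a) = 0 := by
    intro a
    have ha : a ∈ Algebra.adjoin ℚ (S.lam 1 : Set A) := by
      rw [MinimalSullivan.adjoin_lam_one h.pure]; trivial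
    induction ha using Algebra.adjoin_induction with
    | mem v hv =>
      rw [← S.Veven_sup_Vodd] at hv
      obtain ⟨u, hu, y, hy, rfl⟩ := Submodule.mem_sup.1 hv
      obtain ⟨c, hc⟩ := h.Dd_Vodd hy
      rw [map_add, h.pure.1 u hu, zero_add, hc, map_quad, hχx]
      exact hz c ⟨y, hy, hc⟩
    | algebraMap q => rw [Dd_algebraMap, map_zero]
    | add a b _ _ ha hb => rw [map_add, map_add, ha, hb, add_zero]
    | mul a b _ _ ha hb =>
      rw [Dd_mul, map_add, map_mul, map_mul, ha, hb, zero_mul, mul_zero, add_zero]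
  obtain ⟨i, hi⟩ : ∃ i, p i ≠ 0 := by
    by_contra! h0; exact hp (funext h0)
  obtain ⟨n, b, hnb⟩ := exists_exact_of_finite hfin (fun n => x i ^ n) (fun n => n * e i)
    (fun m n hmn => Nat.eq_of_mul_eq_mul_right (h.e_pos i) hmn)
    (fun n => by
      induction n with
      | zero => rw [pow_zero, zero_mul]; exact one_mem_Gr
      | succ n ih => rw [pow_succ, Nat.succ_mul]; exact mul_mem_Gr ih (h.mem_Gr i))
    (fun n => by
      induction n with
      | zero => rw [pow_zero, Dd_one]
      | succ n ih => rw [pow_succ, Dd_mul, ih, h.Dd_x, zero_mul, mul_zero, add_zero])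
  have h1 := congrArg χ hnb
  rw [hχd, map_pow, show χ (x i) = p i from congrFun hχx i] at h1
  exact pow_ne_zero n hi h1

theorem pr_Dd_mem {y : A} (hy : y ∈ S.Vodd) (n : ℕ) {c : Fin 3 → ℚ}
    (hc : pr A n (Dd A y) = quad x c) (hn : 0 < n) : c ∈ h.rel := by
  obtain ⟨n, rfl⟩ := Nat.exists_eq_succ_of_ne_zero hn.ne'
  exact ⟨pr A n y, S.prStable_Vodd n y hy, by rw [← pr_Dd]; exact hc⟩

/-- The quadratic relations of an elliptic model are all the quadratic forms or the kernel of
a nondegenerate form. -/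
theorem rel_eq (hfin : FiniteDimensional ℚ (CohClasses A)) :
    h.rel = ⊤ ∨ ∃ b : QForm e, ∀ c, c ∈ h.rel ↔ b.ev c = 0 := by
  rcases exists_form h.rel (h.exists_quad_ne_zero hfin) with hD | ⟨b, hb, hbD⟩
  · exact Or.inl hD
  refine Or.inr ?_
  by_cases he : e 0 = e 1
  · exact ⟨⟨h.even, e 0 + e 0, b 0, b 1, b 2, fun _ => rfl, fun _ => by rw [he],
      fun _ => by rw [he],
      hb⟩, hbD⟩
  have key : ∀ c ∈ h.rel, c 0 * b 0 = 0 ∧ c 1 * b 1 = 0 ∧ c 2 * b 2 = 0 := by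
    rintro c ⟨y, hy, hc⟩
    have m : ∀ i j, x i * x j ∈ Gr A (e i + e j) := fun i j =>
      mul_mem_Gr (h.mem_Gr i) (h.mem_Gr j)
    have hpr : ∀ n, pr A n (Dd A y) = quad x ![if n = e 0 + e 0 then c 0 else 0,
        if n = e 0 + e 1 then c 1 else 0, if n = e 1 + e 1 then c 2 else 0] := fun n => by
      have hm : ∀ i j (q : ℚ), pr A n (q • (x i * x j)) =
          (if n = e i + e j then q else 0) • (x i * x j) := fun i j q => by
        rw [map_smul]
        split_ifs with h'
        · rw [h', pr_of_mem (m i j)]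
        · rw [pr_of_ne (m i j) h', smul_zero, zero_smul]
      rw [hc, quad, map_add, map_add, hm, hm, hm]; rfl
    have e0 := h.e_pos 0
    have h0 := (hbD _).1 (h.pr_Dd_mem hy _ (hpr (e 0 + e 0)) (by omega))
    have h1 := (hbD _).1 (h.pr_Dd_mem hy _ (hpr (e 0 + e 1)) (by omega))
    have h2 := (hbD _).1 (h.pr_Dd_mem hy _ (hpr (e 1 + e 1)) (by have := h.e_pos 1; omega))
    rw [if_pos rfl, if_neg (by omega), if_neg (by omega)] at h0
    rw [if_neg (by omega), if_pos rfl, if_neg (by omega)] at h1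
    rw [if_neg (by omega), if_neg (by omega), if_pos rfl] at h2
    simp at h0 h1 h2
    simpa using ⟨h0, h1, h2⟩
  have k01 := (key ![b 1, -b 0, 0] ((hbD _).2 (by simp; ring))).1
  have k02 := (key ![b 2, 0, -b 0] ((hbD _).2 (by simp; ring))).1
  have k12 := (key ![0, b 2, -b 1] ((hbD _).2 (by simp; ring))).2.1
  simp only [Matrix.cons_val] at k01 k02 k12
  have hb1 : b 1 ≠ 0 := fun h0 => hb (by rw [h0, mul_comm, k02]; ring)
  have hb0 : b 0 = 0 := (mul_eq_zero.1 k01).resolve_left hb1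
  have hb2 : b 2 = 0 := (mul_eq_zero.1 k12).resolve_right hb1
  exact ⟨⟨h.even, e 0 + e 1, b 0, b 1, b 2, fun h0 => absurd hb0 h0, fun _ => rfl,
    fun h0 => absurd hb2 h0, hb⟩, hbD⟩

end XBasis

theorem FreeOn.reindex {A : Type} [GCDGA A] {ι κ : Type} {g : ι → A} {deg : ι → ℕ}
    (h : FreeOn g deg) (s : κ ≃ ι) : FreeOn (g ∘ s) (deg ∘ s) := by
  refine ⟨fun k => h.1 (s k), by rw [s.surjective.range_comp, h.2.1], fun B _ c hc => ?_⟩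
  obtain ⟨f, hf, hfg⟩ := h.2.2 B (c ∘ s.symm) fun i => by
    simpa using hc (s.symm i)
  exact ⟨f, hf, fun k => by simp [hfg]⟩

/-- The resolution `R → R'` induces a resolution of a free extension of `R`. -/
theorem exists_model {A R R' : Type} [GCDGA A] [GCDGA R] [GCDGA R'] {f : R →ₐ[ℚ] R'}
    (hf : IsDGAHom f) (hfs : SurjAcyc f) {σ : R →ₐ[ℚ] A} (hσ : IsDGAHom σ) {ι : Type} {g : ι → R}
    {deg : ι → ℕ} (hg : FreeOn g deg) {n : ℕ} (w : Fin n → A) (c : Fin n → OddCocycle R)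
    (hA : FreeOn (Sum.elim (σ ∘ g) w) (Sum.elim deg fun k => (c k).deg))
    (hw : ∀ k, Dd A (w k) = σ (c k).z) :
    ∃ (A' : Type) (_ : GCDGA A') (i' : R' →ₐ[ℚ] A') (φ : A →ₐ[ℚ] A'), IsDGAHom i' ∧ IsDGAHom φ ∧
      SurjAcyc φ ∧ (∀ a, φ (σ a) = i' (f a)) ∧ ∀ t, (∀ b, t ≠ Dd R' b) →
        ∀ b, i' t * (List.ofFn fun k => φ (w k)).prod ≠ Dd A' b := by
  obtain ⟨E⟩ := exists_kExt n f hf c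
  obtain ⟨Ψ, hΨ, hΨg, hbij⟩ := hA.exists_iso (E.freeOn hg)
  have hΨσ : ∀ a, Ψ (σ a) = E.i a := fun a => DFunLike.congr_fun
    (algHom_ext_gens (f := Ψ.comp σ) (f' := E.i) hg.2.1 fun i => hΨg (Sum.inl i)) a
  have hΨw : ∀ k, Ψ (w k) = E.w k := fun k => hΨg (Sum.inr k)
  have hΨd : IsDGAHom Ψ := by
    refine isDGAHom_of_gens hΨ hA.2.1 ?_
    rintro _ ⟨i | k, rfl⟩
    · change Ψ (Dd A (σ (g i))) = Dd _ (Ψ (σ (g i)))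
      rw [← hσ.1, hΨσ, hΨσ, E.i_dga.1]
    · change Ψ (Dd A (w k)) = Dd _ (Ψ (w k))
      rw [hw, hΨσ, hΨw, E.Dd_w]
  refine ⟨E.M', E.instM', E.i', E.F.comp Ψ, E.i'_dga, E.F_dga.comp hΨd,
    (E.F_surjAcyc hfs).comp (surjAcyc_of_bijective hbij) hΨd, fun a => ?_, fun t ht b => ?_⟩
  · rw [AlgHom.comp_apply, hΨσ, E.F_i]
  · simp only [AlgHom.comp_apply, hΨw]
    exact E.not_exact t ht b

namespace Regular

variable {e : Fin 2 → ℕ} {b : QForm e} (D : Regular b)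

/-- The generators of the Koszul algebra. -/
def gens : Option (Option (Fin 2)) → D.Kos := fun i => i.elim (Adj.w _ _) fun i =>
  Adj.inl _ _ (i.elim (Adj.w _ _) fun i => Adj.inl _ _ (Poly.X e b.even i))

theorem gens_freeOn : FreeOn D.gens fun i => i.elim D.z₂.deg fun i => i.elim D.z₁.deg e :=
  Adj.freeOn _ (Adj.freeOn _ Poly.freeOn)

/-- The resolution of an algebra free on even generators `x`, odd generators `y` killing the
two quadrics and odd generators `w` with quadratic differentials. -/
theorem exists_model {B : Type} [GCDGA B] {x : Fin 2 → B} (hdx : ∀ i, Dd B (x i) = 0)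
    {y : Fin 2 → B} (hy₀ : Dd B (y 0) = quad x D.c₁) (hy₁ : Dd B (y 1) = quad x D.c₂) {n : ℕ}
    {w : Fin n → B} {d : Fin n → ℕ} (hd : ∀ k, Odd (d k)) {c : Fin n → Fin 3 → ℚ}
    (hc : ∀ k, quad (Poly.X e b.even) (c k) ∈ Gr (Poly e b.even) (d k + 1))
    (hw : ∀ k, Dd B (w k) = quad x (c k))
    (hB : FreeOn (Sum.elim x (Sum.elim y w)) (Sum.elim e (Sum.elim ![D.z₁.deg, D.z₂.deg] d))) :
    ∃ (B' : Type) (_ : GCDGA B') (i : QAlg b →ₐ[ℚ] B') (φ : B →ₐ[ℚ] B'), IsDGAHom i ∧ IsDGAHom φ ∧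
      SurjAcyc φ ∧ (∀ k, φ (x k) = i (QAlg.x b k)) ∧ (∀ k, φ (y k) = 0) ∧
        ∀ u, i (QAlg.τ b) * (List.ofFn fun k => φ (w k)).prod ≠ Dd B' u := by
  have hx := fun i => hB.1 (Sum.inl i)
  have hy := fun i => hB.1 (Sum.inr (Sum.inl i))
  obtain ⟨σ₀, hσ₀, hσ₀X⟩ := Poly.exists_lift (he := b.even) x hx
  have hσ₀d : IsDGAHom σ₀ := isDGAHom_of_gens hσ₀ Poly.adjoin_X (by
    rintro _ ⟨i, rfl⟩
    rw [hσ₀X, hdx, Poly.Dd_eq, map_zero])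
  have hσ₀q : ∀ c, σ₀ (quad (Poly.X e b.even) c) = quad x c := fun c => by
    rw [map_quad, show σ₀ ∘ Poly.X e b.even = x from funext hσ₀X]
  have hσ₁d := Adj.lift_dga σ₀ hσ₀d (y 0) (hy 0) (by rw [D.hz₁, hσ₀q, hy₀])
  have hσd := Adj.lift_dga _ hσ₁d (c := D.z₂.map (Adj.inl _ D.z₁) Adj.inl_dga) (y 1) (hy 1) (by
    refine hy₁.trans ((hσ₀q _).symm.trans ?_)
    rw [← D.hz₂]
    exact (Adj.lift_inl _ _ _ _ _).symm)
  set σ := Adj.lift (c := D.z₂.map (Adj.inl _ D.z₁) Adj.inl_dga) _ hσ₁d.gr (y 1) (hy 1)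
  have hσP : ∀ p, σ (Adj.inl _ _ (Adj.inl _ _ p)) = σ₀ p := fun p =>
    (Adj.lift_inl _ _ _ _ _).trans (Adj.lift_inl _ _ _ _ _)
  let s : Option (Option (Fin 2)) ⊕ Fin n ≃ Fin 2 ⊕ (Fin 2 ⊕ Fin n) :=
    { toFun := Sum.elim (fun i => i.elim (Sum.inr (Sum.inl 1)) fun i =>
        i.elim (Sum.inr (Sum.inl 0)) Sum.inl) fun k => Sum.inr (Sum.inr k)
      invFun := Sum.elim (fun i => Sum.inl (some (some i)))
        (Sum.elim ![Sum.inl (some none), Sum.inl none] Sum.inr)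
      left_inv := by rintro ((_ | _ | i) | k) <;> rfl
      right_inv := by
        rintro (i | i | k)
        · rfl
        · fin_cases i <;> rfl
        · rfl }
  have hs := hB.reindex s
  let C : Fin n → OddCocycle D.Kos := fun k => ((⟨d k, hd k, _, hc k, Poly.Dd_eq _⟩ :
    OddCocycle (Poly e b.even)).map (Adj.inl _ D.z₁) Adj.inl_dga).map (Adj.inl _ _) Adj.inl_dga
  obtain ⟨B', inst, i, φ, hi, hφ, hφs, hφσ, hne⟩ := RHT.exists_model D.kosToQ_dga D.kosToQ_surjAcyc
    hσd D.gens_freeOn w C (by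
      convert hs using 1
      · funext i
        rcases i with (_ | _ | i) | k
        · exact Adj.lift_w _ _ _ _
        · exact (Adj.lift_inl _ _ _ _ _).trans (Adj.lift_w _ _ _ _)
        · exact (hσP _).trans (hσ₀X i)
        · rfl
      · funext i
        rcases i with (_ | _ | i) | k <;> rfl) fun k => by
      rw [hw, ← hσ₀q, ← hσP]; rfl
  refine ⟨B', inst, i, φ, hi, hφ, hφs, fun k => ?_, fun k => ?_, hne _ QAlg.τ_not_exact⟩
  · rw [← hσ₀X, ← hσP, hφσ, kosToQ_apply]
    exact congrArg i (polyToQ_X b k)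
  · fin_cases k
    · have h := hφσ (D.gens (some none))
      have h' : σ (D.gens (some none)) = y 0 := (Adj.lift_inl _ _ _ _ _).trans (Adj.lift_w _ _ _ _)
      rw [h', kosToQ_apply] at h
      refine h.trans ?_
      change i (polyToQ b 0) = 0
      rw [map_zero, map_zero]
    · have h := hφσ (D.gens none)
      have h' : σ (D.gens none) = y 1 := Adj.lift_w _ _ _ _
      rw [h', kosToQ_apply] at h
      refine h.trans ?_
      change i (polyToQ b 0) = 0
      rw [map_zero, map_zero]

theorem _root_.RHT.quad_mem_Gr {B : Type} [GCDGA B] {x : Fin 2 → B} (hx : ∀ i, x i ∈ Gr B (e i))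
    {c : Fin 3 → ℚ} {n : ℕ} (h0 : c 0 ≠ 0 → e 0 + e 0 = n) (h1 : c 1 ≠ 0 → e 0 + e 1 = n)
    (h2 : c 2 ≠ 0 → e 1 + e 1 = n) : quad x c ∈ Gr B n := by
  have key : ∀ (q : ℚ) i j, (q ≠ 0 → e i + e j = n) → q • (x i * x j) ∈ Gr B n := by
    intro q i j h
    by_cases hq : q = 0
    · rw [hq, zero_smul]; exact zero_mem _
    · rw [← h hq]; exact Submodule.smul_mem _ _ (mul_mem_Gr (hx i) (hx j))
  exact add_mem (add_mem (key _ _ _ h0) (key _ _ _ h1)) (key _ _ _ h2)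

end Regular

/-- The hyperbolic form. -/
def QForm.hyp (e : Fin 2 → ℕ) (he : ∀ i, Even (e i)) : QForm e where
  even := he
  D := e 0 + e 1
  b11 := 0
  b12 := 1
  b22 := 0
  h11 := fun h => absurd rfl h
  h12 := fun _ => rfl
  h22 := fun h => absurd rfl h
  nondeg := by norm_num

namespace Regular

variable {e : Fin 2 → ℕ}

theorem exists_of_quad {b : QForm e} {c₁ c₂ : Fin 3 → ℚ} {n₁ n₂ : ℕ} (ev₁ : b.ev c₁ = 0)
    (ev₂ : b.ev c₂ = 0) (span : ∀ c, b.ev c = 0 → ∃ u v : ℚ, c = u • c₁ + v • c₂)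
    (hn₁ : Odd n₁) (hn₂ : Odd n₂)
    (h₁ : quad (Poly.X e b.even) c₁ ∈ Gr (Poly e b.even) (n₁ + 1))
    (h₂ : quad (Poly.X e b.even) c₂ ∈ Gr (Poly e b.even) (n₂ + 1)) :
    ∃ D : Regular b, D.c₁ = c₁ ∧ D.c₂ = c₂ ∧ D.z₁.deg = n₁ ∧ D.z₂.deg = n₂ :=
  ⟨⟨c₁, c₂, ev₁, ev₂, span, ⟨n₁, hn₁, _, h₁, Poly.Dd_eq _⟩, ⟨n₂, hn₂, _, h₂, Poly.Dd_eq _⟩,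
    rfl, rfl⟩,
    rfl, rfl, rfl, rfl⟩

theorem exists_hyp (he : ∀ i, Even (e i)) (hpos : ∀ i, 0 < e i) :
    ∃ D : Regular (QForm.hyp e he), D.c₁ = ![1, 0, 0] ∧ D.c₂ = ![0, 0, 1] ∧
      D.z₁.deg = 2 * e 0 - 1 ∧ D.z₂.deg = 2 * e 1 - 1 := by
  have h0 := hpos 0
  have h1 := hpos 1
  refine exists_of_quad (by simp [QForm.ev, QForm.hyp]) (by simp [QForm.ev, QForm.hyp])
    (fun c hc => ⟨c 0, c 2, ?_⟩) ⟨e 0 - 1, by omega⟩ ⟨e 1 - 1, by omega⟩ ?_ ?_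
  · have hc1 : c 1 = 0 := by simpa [QForm.ev, QForm.hyp] using hc
    ext i; fin_cases i <;> simp [hc1]
  · exact quad_mem_Gr Poly.X_mem (fun _ => by omega) (fun h => absurd rfl h) fun h => absurd rfl h
  · exact quad_mem_Gr Poly.X_mem (fun h => absurd rfl h) (fun h => absurd rfl h) fun _ => by omega

theorem _root_.RHT.QForm.hyp_or_eq (b : QForm e) :
    (b.b11 = 0 ∧ b.b22 = 0 ∧ b.b12 ≠ 0) ∨ e 0 = e 1 := by
  by_cases h : e 0 = e 1
  · exact Or.inr h
  left
  have nd := b.nondeg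
  have h11 : b.b11 = 0 := by
    by_contra h11
    have h12 : b.b12 = 0 := by
      by_contra h12; have := b.h11 h11; have := b.h12 h12; omega
    have h22 : b.b22 = 0 := by
      by_contra h22; have := b.h11 h11; have := b.h22 h22; omega
    rw [h12, h22] at nd; simp at nd
  have h12 : b.b12 ≠ 0 := fun h12 => by rw [h11, h12] at nd; simp at nd
  refine ⟨h11, ?_, h12⟩
  by_contra h22
  have := b.h22 h22; have := b.h12 h12; omega

theorem exists_regular (b : QForm e) (hpos : ∀ i, 0 < e i) : Nonempty (Regular b) := by
  have h0 := hpos 0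
  have h1 := hpos 1
  rcases b.hyp_or_eq with ⟨h11, h22, h12⟩ | he
  · obtain ⟨D, -⟩ := exists_of_quad (b := b) (c₁ := ![1, 0, 0]) (c₂ := ![0, 0, 1])
      (n₁ := 2 * e 0 - 1) (n₂ := 2 * e 1 - 1) (by simp [QForm.ev, h11]) (by simp [QForm.ev, h22])
      (fun c hc => ⟨c 0, c 2, by
        have hc1 : c 1 = 0 := by simpa [QForm.ev, h11, h22, h12] using hc
        ext i; fin_cases i <;> simp [hc1]⟩) ⟨e 0 - 1, by omega⟩ ⟨e 1 - 1, by omega⟩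
      (quad_mem_Gr Poly.X_mem (fun _ => by omega) (fun h => absurd rfl h) fun h => absurd rfl h)
      (quad_mem_Gr Poly.X_mem (fun h => absurd rfl h) (fun h => absurd rfl h) fun _ => by omega)
    exact ⟨D⟩
  obtain ⟨c₁, c₂, ev₁, ev₂, hs⟩ : ∃ c₁ c₂, b.ev c₁ = 0 ∧ b.ev c₂ = 0 ∧
      ∀ c, b.ev c = 0 → ∃ u v : ℚ, c = u • c₁ + v • c₂ := by
    by_cases h : b.b12 = 0
    · have h11 : b.b11 ≠ 0 := fun h11 => b.nondeg (by rw [h, h11]; ring)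
      refine ⟨![b.b12, -b.b11, 0], ![b.b22, 0, -b.b11], ?_, ?_, fun c hc => ⟨-(c 1 / b.b11),
        -(c 2 / b.b11), ?_⟩⟩
      · simp [QForm.ev]; ring
      · simp [QForm.ev]; ring
      · simp only [QForm.ev] at hc
        ext i; fin_cases i <;> simp
        · field_simp; linear_combination hc
        · field_simp
        · field_simp
    · refine ⟨![b.b12, -b.b11, 0], ![0, -b.b22, b.b12], ?_, ?_, fun c hc => ⟨c 0 / b.b12,
        c 2 / b.b12, ?_⟩⟩
      · simp [QForm.ev]; ring
      · simp [QForm.ev]; ring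
      · simp only [QForm.ev] at hc
        ext i; fin_cases i <;> simp
        · field_simp
        · field_simp; linear_combination hc
        · field_simp
  obtain ⟨D, -⟩ := exists_of_quad (n₁ := 2 * e 0 - 1) (n₂ := 2 * e 0 - 1) ev₁ ev₂ hs
    ⟨e 0 - 1, by omega⟩ ⟨e 0 - 1, by omega⟩
    (quad_mem_Gr Poly.X_mem (fun _ => by omega) (fun _ => by omega) fun _ => by omega)
    (quad_mem_Gr Poly.X_mem (fun _ => by omega) (fun _ => by omega) fun _ => by omega)
  exact ⟨D⟩

end Regular

namespace MinimalSullivan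

variable {A : Type} [GCDGA A] (S : MinimalSullivan A)

/-- Completing a family of homogeneous odd generators to a basis by means of a homogeneous
complement. -/
theorem exists_adapted (hfin : FiniteDimensional ℚ S.Vodd) {s : ℕ} {p : Fin s → A} {dp : Fin s → ℕ}
    (hp : ∀ j, p j ∈ S.V (2 * dp j + 1)) (U : ℕ → Submodule ℚ A) (hU : ∀ n, U n ≤ S.V (2 * n + 1))
    (hspan : ∀ y ∈ S.Vodd, ∃ q : Fin s → ℚ, y - ∑ j, q j • p j ∈ ⨆ n, U n)
    (hdis : ∀ q : Fin s → ℚ, ∑ j, q j • p j ∈ ⨆ n, U n → q = 0) :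
    ∃ (n : ℕ) (w : Fin n → A) (d : Fin n → ℕ), (∀ k, w k ∈ U (d k)) ∧
      LinearIndependent ℚ (Sum.elim p w) ∧
      Submodule.span ℚ (Set.range (Sum.elim p w)) = S.Vodd ∧ Module.finrank ℚ S.Vodd = s + n := by
  have hUle : ⨆ n, U n ≤ S.Vodd := iSup_mono hU
  obtain ⟨n, w, d, hw, hli, hsp⟩ := exists_homogeneous_basis U
    (Submodule.finiteDimensional_of_le hUle)
  have hpli : LinearIndependent ℚ p := Fintype.linearIndependent_iff.2 fun q hq =>
    congrFun (hdis q (by rw [hq]; exact zero_mem _))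
  have hall : LinearIndependent ℚ (Sum.elim p w) := hpli.sum_type hli (by
    rw [hsp, Submodule.disjoint_def]
    intro a ha ha'
    obtain ⟨q, rfl⟩ := Submodule.mem_span_range_iff_exists_fun ℚ |>.1 ha
    simp [hdis q ha'])
  have hsp' : Submodule.span ℚ (Set.range (Sum.elim p w)) = S.Vodd := by
    rw [Set.Sum.elim_range, Submodule.span_union, hsp]
    refine le_antisymm (sup_le (Submodule.span_le.2 ?_) hUle) fun y hy => ?_
    · rintro _ ⟨j, rfl⟩; exact Submodule.mem_iSup_of_mem (dp j) (hp j)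
    · obtain ⟨q, hq⟩ := hspan y hy
      refine Submodule.mem_sup.2 ⟨_, ?_, _, hq, add_sub_cancel _ _⟩
      exact sum_mem fun j _ => Submodule.smul_mem _ _ (Submodule.subset_span ⟨j, rfl⟩)
  refine ⟨n, w, d, hw, hall, hsp', ?_⟩
  rw [← hsp', finrank_span_eq_card hall]; simp

theorem mem_iSup_closed {y : A} (hy : y ∈ S.Vodd) (hd : Dd A y = 0) :
    y ∈ ⨆ n, S.V (2 * n + 1) ⊓ LinearMap.ker (Dd A) := by
  obtain ⟨s, hs⟩ := exists_sum_pr y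
  rw [hs]
  refine sum_mem fun i _ => ?_
  have h1 : pr A i y ∈ S.Vodd := S.prStable_Vodd i y hy
  have h2 : pr A i y ∈ S.V i :=
    S.mem_V ((S.Veven_sup_Vodd ▸ le_sup_right : S.Vodd ≤ S.lam 1) h1) (pr_mem i y)
  rcases Nat.even_or_odd' i with ⟨k, rfl | rfl⟩
  · have h3 : pr A (2 * k) y ∈ S.Veven := Submodule.mem_iSup_of_mem k h2
    rw [Submodule.disjoint_def.1 S.disjoint_Veven_Vodd _ h3 h1]
    exact zero_mem _
  · exact Submodule.mem_iSup_of_mem k ⟨h2, by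
      change Dd A _ = 0
      rw [← pr_Dd, hd, map_zero]⟩

end MinimalSullivan

namespace XBasis

variable {A : Type} [GCDGA A] {S : MinimalSullivan A} {x : Fin 2 → A} {e : Fin 2 → ℕ}
  (h : XBasis S x e)

include h

theorem exists_adapted {s : ℕ} {p : Fin s → A} {dp : Fin s → ℕ}
    (hp : ∀ j, p j ∈ S.V (2 * dp j + 1)) (c : Fin s → Fin 3 → ℚ)
    (hc : ∀ j, Dd A (p j) = quad x (c j))
    (hli : LinearIndependent ℚ c) (hspan : h.rel ≤ Submodule.span ℚ (Set.range c)) :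
    ∃ (n : ℕ) (w : Fin n → A) (d : Fin n → ℕ), (∀ k, w k ∈ S.V (2 * d k + 1)) ∧
      (∀ k, Dd A (w k) = 0) ∧ LinearIndependent ℚ (Sum.elim p w) ∧
      Submodule.span ℚ (Set.range (Sum.elim p w)) = S.Vodd ∧ Module.finrank ℚ S.Vodd = s + n := by
  have hsum : ∀ q : Fin s → ℚ, Dd A (∑ j, q j • p j) = quad x (∑ j, q j • c j) := fun q => by
    let Q : (Fin 3 → ℚ) →ₗ[ℚ] A :=
      { toFun := quad x, map_add' := Regular.quad_add x, map_smul' := Regular.quad_smul x }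
    change _ = Q _
    rw [map_sum, map_sum]
    refine Finset.sum_congr rfl fun j _ => ?_
    rw [map_smul, map_smul, hc]; rfl
  obtain ⟨n, w, d, hw, h1, h2, h3⟩ := S.exists_adapted h.finVodd hp
    (fun n => S.V (2 * n + 1) ⊓ LinearMap.ker (Dd A)) (fun n => inf_le_left) (fun y hy => by
      obtain ⟨c', hc'⟩ := h.Dd_Vodd hy
      obtain ⟨q, hq⟩ := Submodule.mem_span_range_iff_exists_fun ℚ |>.1 (hspan ⟨y, hy, hc'⟩)
      refine ⟨q, S.mem_iSup_closed (sub_mem hy (sum_mem fun j _ => Submodule.smul_mem _ _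
        (Submodule.mem_iSup_of_mem (dp j) (hp j)))) ?_⟩
      rw [map_sub, hsum, hq, hc', sub_self]) (fun q hq => by
      have h0 : Dd A (∑ j, q j • p j) = 0 :=
        (iSup_le fun n => inf_le_right : _ ≤ LinearMap.ker (Dd A)) hq
      rw [hsum, ← (by simp [quad] : quad x 0 = 0)] at h0
      exact funext (Fintype.linearIndependent_iff.1 hli q (h.quad_injective h0)))
  exact ⟨n, w, d, fun k => (hw k).1, fun k => (hw k).2, h1, h2, h3⟩

theorem exists_odd {c : Fin 3 → ℚ} (hc : c ∈ h.rel) {n : ℕ} (hn : Odd n)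
    (hq : quad x c ∈ Gr A (n + 1)) : ∃ k, n = 2 * k + 1 ∧
      ∃ y ∈ S.V (2 * k + 1), Dd A y = quad x c := by
  obtain ⟨k, rfl⟩ := hn
  obtain ⟨y, hy, hyc⟩ := hc
  refine ⟨k, rfl, pr A _ y, S.mem_V ((S.Veven_sup_Vodd ▸ le_sup_right : S.Vodd ≤ S.lam 1)
    (S.prStable_Vodd _ y hy)) (pr_mem _ y), ?_⟩
  rw [← pr_Dd, hyc, pr_of_mem hq]

theorem quad_mem_Gr_of_poly {he : ∀ i, Even (e i)} {c : Fin 3 → ℚ} {n : ℕ}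
    (hc : quad (Poly.X e he) c ∈ Gr (Poly e he) n) : quad x c ∈ Gr A n := by
  obtain ⟨f, hf, hfX⟩ := Poly.exists_lift (he := he) x h.mem_Gr
  have := hf _ _ hc
  rwa [map_quad, show f ∘ Poly.X e he = x from funext hfX] at this

theorem freeOn_elim {s n : ℕ} {p : Fin s → A} {w : Fin n → A} {dp : Fin s → ℕ} {d : Fin n → ℕ}
    (hp : ∀ j, p j ∈ S.V (2 * dp j + 1)) (hw : ∀ k, w k ∈ S.V (2 * d k + 1))
    (hli : LinearIndependent ℚ (Sum.elim p w))
    (hspan : Submodule.span ℚ (Set.range (Sum.elim p w)) = S.Vodd) :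
    FreeOn (Sum.elim x (Sum.elim p w))
      (Sum.elim e (Sum.elim (fun j => 2 * dp j + 1) fun k => 2 * d k + 1)) := by
  have := h.freeOn_sum (d := Sum.elim dp d) (by rintro (j | k); exacts [hp j, hw k]) hli hspan
  convert this using 2
  funext i; rcases i with j | k <;> rfl

/-- The model of an elliptic algebra whose relations are the kernel of a nondegenerate form. -/
theorem exists_model_of_form {b : QForm e} (hb : ∀ c, c ∈ h.rel ↔ b.ev c = 0) :
    ∃ (n : ℕ) (w : Fin n → A) (d : Fin n → ℕ), (∀ k, w k ∈ S.V (2 * d k + 1)) ∧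
      (∀ k, Dd A (w k) = 0) ∧ Module.finrank ℚ S.Vodd = n + 2 ∧
      ∃ (A' : Type) (_ : GCDGA A') (i : QAlg b →ₐ[ℚ] A') (φ : A →ₐ[ℚ] A'), IsDGAHom i ∧ IsDGAHom φ ∧
        SurjAcyc φ ∧ (∀ k, φ (x k) = i (QAlg.x b k)) ∧
        (∀ v ∈ S.Vodd, φ v ∈ Submodule.span ℚ (Set.range fun k => φ (w k))) ∧
        ∀ u, i (QAlg.τ b) * (List.ofFn fun k => φ (w k)).prod ≠ Dd A' u := by
  obtain ⟨D⟩ := Regular.exists_regular b h.e_pos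
  have hg₁ := D.z₁.mem
  have hg₂ := D.z₂.mem
  rw [D.hz₁] at hg₁
  rw [D.hz₂] at hg₂
  obtain ⟨k₁, hk₁, y₁, hy₁, hd₁⟩ := h.exists_odd ((hb _).2 D.ev₁) D.z₁.odd
    (h.quad_mem_Gr_of_poly hg₁)
  obtain ⟨k₂, hk₂, y₂, hy₂, hd₂⟩ := h.exists_odd ((hb _).2 D.ev₂) D.z₂.odd
    (h.quad_mem_Gr_of_poly hg₂)
  have hli : LinearIndependent ℚ ![D.c₁, D.c₂] := by
    refine LinearIndependent.pair_iff.2 fun q q' hq => ?_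
    have hX : quad (Poly.X e b.even) (q • D.c₁ + q' • D.c₂) = 0 := by rw [hq]; simp [quad]
    rw [Regular.quad_add, Regular.quad_smul, Regular.quad_smul, ← D.hz₁, ← D.hz₂,
      Algebra.smul_def, Algebra.smul_def] at hX
    obtain ⟨k, hk, hk'⟩ := D.syzygy hX
    have h1 := congrArg (polyToQ b) hk
    have h2 := congrArg (polyToQ b) hk'
    rw [map_mul, D.polyToQ_z₁, mul_zero, AlgHom.commutes, Algebra.algebraMap_eq_smul_one] at h1
    rw [map_neg, map_mul, D.polyToQ_z₂, mul_zero, neg_zero, AlgHom.commutes,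
      Algebra.algebraMap_eq_smul_one] at h2
    have h1' : q' * 1 = 0 := congrArg QAlg.c h1
    have h2' : q * 1 = 0 := congrArg QAlg.c h2
    exact ⟨by simpa using h2', by simpa using h1'⟩
  have hp : ∀ j, ![y₁, y₂] j ∈ S.V (2 * ![k₁, k₂] j + 1) := by
    intro j; fin_cases j; exacts [hy₁, hy₂]
  obtain ⟨n, w, d, hw, hdw, hall, hspan, hrk⟩ := h.exists_adapted hp ![D.c₁, D.c₂]
    (by intro j; fin_cases j; exacts [hd₁, hd₂]) hli (fun c hc => by
      obtain ⟨u, v, rfl⟩ := D.span c ((hb c).1 hc)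
      exact add_mem (Submodule.smul_mem _ _ (Submodule.subset_span ⟨0, rfl⟩))
        (Submodule.smul_mem _ _ (Submodule.subset_span ⟨1, rfl⟩)))
  obtain ⟨A', inst, i, φ, hi, hφ, hφs, hφx, hφy, hne⟩ := D.exists_model h.Dd_x
    (y := ![y₁, y₂]) hd₁ hd₂
    (fun k => odd_two_mul_add_one (d k)) (c := fun _ => 0)
    (fun k => by simp [quad]) (fun k => by rw [hdw]; simp [quad]) (by
      convert h.freeOn_elim hp hw hall hspan using 3
      funext j; fin_cases j
      exacts [hk₁, hk₂])
  refine ⟨n, w, d, hw, hdw, by rw [hrk, add_comm], A', inst, i, φ, hi, hφ, hφs, hφx,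
    fun v hv => ?_, hne⟩
  rw [← hspan] at hv
  refine (Submodule.span_le.2 ?_ : _ ≤ (Submodule.span ℚ (Set.range fun k => φ (w k))).comap
    φ.toLinearMap) hv
  rintro _ ⟨j | k, rfl⟩
  · change φ (![y₁, y₂] j) ∈ Submodule.span ℚ _
    rw [hφy]; exact zero_mem _
  · exact Submodule.subset_span ⟨k, rfl⟩

/-- The model of an elliptic algebra all of whose quadratic forms are relations. -/
theorem exists_model_of_top (hb : h.rel = ⊤) :
    ∃ (y : Fin 2 → A) (dy : Fin 2 → ℕ) (n : ℕ) (w : Fin (n + 1) → A) (d : Fin (n + 1) → ℕ),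
      (∀ j, y j ∈ S.V (2 * dy j + 1)) ∧ (∀ k, w k ∈ S.V (2 * d k + 1)) ∧
      (∀ j, Dd A (y j) = x j * x j) ∧ Dd A (w 0) = x 0 * x 1 ∧
      (∀ k : Fin n, Dd A (w k.succ) = 0) ∧ Module.finrank ℚ S.Vodd = n + 1 + 2 ∧
      ∃ (A' : Type) (_ : GCDGA A') (i : QAlg (QForm.hyp e h.even) →ₐ[ℚ] A') (φ : A →ₐ[ℚ] A'),
        IsDGAHom i ∧ IsDGAHom φ ∧ SurjAcyc φ ∧ (∀ k, φ (x k) = i (QAlg.x _ k)) ∧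
        (∀ j, φ (y j) = 0) ∧
        (∀ v ∈ S.Vodd, φ v ∈ Submodule.span ℚ (Set.range fun k => φ (w k))) ∧
        ∀ u, i (QAlg.τ _) * (List.ofFn fun k => φ (w k)).prod ≠ Dd A' u := by
  have e0 := h.e_pos 0
  have e1 := h.e_pos 1
  obtain ⟨D, hc₁, hc₂, hz₁, hz₂⟩ := Regular.exists_hyp h.even h.e_pos
  obtain ⟨k0, hk0⟩ := h.even 0
  obtain ⟨k1, hk1⟩ := h.even 1
  have hq : ∀ {B : Type} [GCDGA B] {v : Fin 2 → B}, (∀ i, v i ∈ Gr B (e i)) →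
      quad v ![1, 0, 0] ∈ Gr B (2 * e 0 - 1 + 1) ∧ quad v ![0, 0, 1] ∈ Gr B (2 * e 1 - 1 + 1) ∧
      quad v ![0, 1, 0] ∈ Gr B (e 0 + e 1 - 1 + 1) := fun hv =>
    ⟨quad_mem_Gr hv (fun _ => by omega) (fun h => absurd rfl h) fun h => absurd rfl h,
      quad_mem_Gr hv (fun h => absurd rfl h) (fun h => absurd rfl h) fun _ => by omega,
      quad_mem_Gr hv (fun h => absurd rfl h) (fun _ => by omega) fun h => absurd rfl h⟩
  obtain ⟨hq0, hq1, hq2⟩ := hq h.mem_Gr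
  obtain ⟨d0, hd0, y0, hy0, hdy0⟩ := h.exists_odd (hb ▸ trivial) ⟨e 0 - 1, by omega⟩ hq0
  obtain ⟨d1, hd1, y1, hy1, hdy1⟩ := h.exists_odd (hb ▸ trivial) ⟨e 1 - 1, by omega⟩ hq1
  obtain ⟨d2, hd2, y2, hy2, hdy2⟩ := h.exists_odd (hb ▸ trivial) ⟨k0 + k1 - 1, by omega⟩ hq2
  have hp : ∀ j, ![y0, y1, y2] j ∈ S.V (2 * ![d0, d1, d2] j + 1) := by
    intro j; fin_cases j; exacts [hy0, hy1, hy2]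
  obtain ⟨n, w, d, hw, hdw, hall, hspan, hrk⟩ := h.exists_adapted hp
    ![![1, 0, 0], ![0, 0, 1], ![0, 1, 0]] (by intro j; fin_cases j; exacts [hdy0, hdy1, hdy2])
    (Fintype.linearIndependent_iff.2 fun q hq j => by
      rw [Fin.sum_univ_three] at hq
      have h0 := congrFun hq 0
      have h1 := congrFun hq 1
      have h2 := congrFun hq 2
      simp at h0 h1 h2
      fin_cases j <;> assumption) (fun c _ => by
      refine Submodule.mem_span_range_iff_exists_fun ℚ |>.2 ⟨![c 0, c 2, c 1], ?_⟩
      rw [Fin.sum_univ_three]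
      ext j; fin_cases j <;> simp)
  let s : Fin 2 ⊕ (Fin 2 ⊕ Fin (n + 1)) ≃ Fin 2 ⊕ (Fin 3 ⊕ Fin n) :=
    { toFun := Sum.elim Sum.inl (Sum.elim ![Sum.inr (Sum.inl 0), Sum.inr (Sum.inl 1)]
        (Fin.cons (Sum.inr (Sum.inl 2)) fun k => Sum.inr (Sum.inr k)))
      invFun := Sum.elim Sum.inl (Sum.elim ![Sum.inr (Sum.inl 0), Sum.inr (Sum.inl 1),
        Sum.inr (Sum.inr 0)] fun k => Sum.inr (Sum.inr k.succ))
      left_inv := by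
        rintro (i | i | k)
        · rfl
        · fin_cases i <;> rfl
        · refine Fin.cases ?_ (fun k => ?_) k <;> rfl
      right_inv := by
        rintro (i | i | k)
        · rfl
        · fin_cases i <;> rfl
        · rfl }
  have hdw' : ∀ k, Dd A ((Fin.cons y2 w : Fin (n + 1) → A) k) =
      quad x ((Fin.cons ![0, 1, 0] fun _ => 0 : Fin (n + 1) → Fin 3 → ℚ) k) := fun k => by
    refine Fin.cases hdy2 (fun k => ?_) k
    rw [Fin.cons_succ, Fin.cons_succ, hdw]; simp [quad]
  obtain ⟨A', inst, i, φ, hi, hφ, hφs, hφx, hφy, hne⟩ := D.exists_model h.Dd_x (y := ![y0, y1])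
    (hc₁ ▸ hdy0) (hc₂ ▸ hdy1) (w := Fin.cons y2 w) (d := fun k =>
      2 * (Fin.cons d2 d : Fin (n + 1) → ℕ) k + 1) (fun k => odd_two_mul_add_one _)
    (c := Fin.cons ![0, 1, 0] fun _ => 0)
    (fun k => by
      refine Fin.cases ?_ (fun k => ?_) k
      · rw [Fin.cons_zero, Fin.cons_zero, ← hd2]; exact (hq Poly.X_mem).2.2
      · rw [Fin.cons_succ]; simp [quad]) hdw' (by
      convert (h.freeOn_elim hp hw hall hspan).reindex s using 1
      · funext j
        rcases j with i | i | k
        · rfl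
        · fin_cases i <;> rfl
        · refine Fin.cases ?_ (fun k => ?_) k <;> rfl
      · funext j
        rcases j with i | i | k
        · rfl
        · fin_cases i
          exacts [hz₁.trans hd0, hz₂.trans hd1]
        · refine Fin.cases ?_ (fun k => ?_) k <;> rfl)
  refine ⟨![y0, y1], ![d0, d1], n, Fin.cons y2 w, Fin.cons d2 d, fun j => ?_, fun k => ?_,
    fun j => ?_, ?_, fun k => hdw k, by rw [hrk]; omega, A', inst, i, φ, hi, hφ, hφs, hφx, hφy,
    fun v hv => ?_, hne⟩
  · fin_cases j; exacts [hy0, hy1]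
  · refine Fin.cases hy2 hw k
  · fin_cases j
    · refine hdy0.trans ?_; simp [quad]
    · refine hdy1.trans ?_; simp [quad]
  · refine hdy2.trans ?_; simp [quad]
  · rw [← hspan] at hv
    refine (Submodule.span_le.2 ?_ : _ ≤ (Submodule.span ℚ (Set.range fun k => φ _)).comap
      φ.toLinearMap) hv
    rintro _ ⟨j | k, rfl⟩
    · fin_cases j
      · change φ y0 ∈ Submodule.span ℚ _
        rw [show φ y0 = 0 from hφy 0]; exact zero_mem _
      · change φ y1 ∈ Submodule.span ℚ _
        rw [show φ y1 = 0 from hφy 1]; exact zero_mem _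
      · exact Submodule.subset_span ⟨0, rfl⟩
    · exact Submodule.subset_span ⟨k.succ, rfl⟩

end XBasis

/-! ### Nilpotency bounds -/

theorem sum_pow_eq_zero {R κ : Type*} [Semiring R] (s : Finset κ) {U : κ → R} {n : κ → ℕ}
    (h : ∀ i, U i ^ (n i + 1) = 0) (hc : ∀ i j, Commute (U i) (U j)) :
    (∑ i ∈ s, U i) ^ (∑ i ∈ s, n i + 1) = 0 := by
  classical
  induction s using Finset.induction_on with
  | empty => simp
  | insert a s ha ih =>
    rw [Finset.sum_insert ha, Finset.sum_insert ha]
    exact Commute.add_pow_eq_zero_of_add_le_succ_of_pow_eq_zero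
      (Commute.sum_right _ _ _ fun j _ => hc a j) (h a) ih (by omega)

section Homogeneous

variable {A : Type} [GCDGA A]

theorem commute_span_homogeneous {s t : A} {m n : ℕ} (hs : s ∈ Gr A m) (ht : t ∈ Gr A n) :
    Commute (Submodule.span ℚ {s}) (Submodule.span ℚ {t}) := by
  rw [commute_iff_eq, Submodule.span_mul_span, Submodule.span_mul_span, Set.singleton_mul_singleton,
    Set.singleton_mul_singleton]
  rcases Nat.even_or_odd m with hm | hm
  · rw [even_comm hs hm]
  rcases Nat.even_or_odd n with hn | hn
  · rw [even_comm ht hn]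
  · rw [odd_anticomm hs hm ht hn, ← Set.neg_singleton, Submodule.span_neg]

theorem commute_span_top {t : A} {n : ℕ} (ht : t ∈ Gr A n) :
    Commute (Submodule.span ℚ {t}) (⊤ : Submodule ℚ A) := by
  have hs : ∀ b, ∃ b', t * b = b' * t ∧ b * t = t * b' := fun b => by
    rcases Nat.even_or_odd n with hn | hn
    · exact ⟨b, even_comm ht hn b, (even_comm ht hn b).symm⟩
    · exact ⟨sgn A b, odd_comm ht hn b, by rw [odd_comm ht hn, sgn_sgn]⟩
  refine le_antisymm (Submodule.mul_le.2 fun a ha b _ => ?_) (Submodule.mul_le.2 fun b _ a ha => ?_)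
  all_goals
    obtain ⟨c, rfl⟩ := Submodule.mem_span_singleton.1 ha
    obtain ⟨b', h1, h2⟩ := hs b
  · rw [smul_mul_assoc, h1, ← mul_smul_comm]
    exact Submodule.mul_mem_mul trivial ha
  · rw [mul_smul_comm, h2, ← smul_mul_assoc]
    exact Submodule.mul_mem_mul ha trivial

/-- The span of a pair of elements. -/
theorem span_pair_eq (X : Fin 2 → A) :
    Submodule.span ℚ (Set.range X) = Submodule.span ℚ {X 0} + Submodule.span ℚ {X 1} := by
  rw [Submodule.add_eq_sup, ← Submodule.span_union]
  congr 1
  ext a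
  simp [Fin.exists_fin_two, eq_comm, or_comm]

theorem le_sum_submodule {ι : Type} [Fintype ι] (P : ι → Submodule ℚ A) (j : ι) :
    P j ≤ ∑ i, P i := by
  classical
  rw [← Finset.add_sum_erase _ _ (Finset.mem_univ j)]
  exact le_sup_left

theorem span_range_le_sum {l : ℕ} (w : Fin l → A) :
    Submodule.span ℚ (Set.range w) ≤ ∑ k, Submodule.span ℚ {w k} := by
  rw [Submodule.span_le]
  rintro _ ⟨k, rfl⟩
  exact le_sum_submodule (fun k => Submodule.span ℚ {w k}) k (Submodule.subset_span rfl)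

theorem span_pow_three {X : Fin 2 → A} (hX : ∀ i j k, X i * X j * X k = 0) :
    Submodule.span ℚ (Set.range X) ^ (2 + 1) = 0 := by
  rw [pow_succ, pow_two, Submodule.span_mul_span, Submodule.span_mul_span, Submodule.zero_eq_bot,
    ← le_bot_iff, Submodule.span_le]
  rintro _ ⟨_, ⟨_, ⟨i, rfl⟩, _, ⟨j, rfl⟩, rfl⟩, _, ⟨k, rfl⟩, rfl⟩
  exact hX i j k

theorem span_pow_two {t : A} {n : ℕ} (ht : t ∈ Gr A n) (hn : Odd n) :
    Submodule.span ℚ {t} ^ (1 + 1) = 0 := by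
  rw [pow_two, Submodule.span_mul_span, Set.singleton_mul_singleton, odd_sq ht hn,
    Submodule.span_zero_singleton]
  rfl

theorem commute_span_pair {X : Fin 2 → A} {P : Submodule ℚ A}
    (h : ∀ i, Commute (Submodule.span ℚ {X i}) P) : Commute (Submodule.span ℚ (Set.range X)) P := by
  rw [span_pair_eq]; exact (h 0).add_left (h 1)

/-- The submodule spanned by a family of pairs and a family of odd elements is nilpotent. -/
theorem pairs_lines_pow {ι κ : Type} [Fintype ι] [Fintype κ] {X : ι → Fin 2 → A} {e : Fin 2 → ℕ}
    (hX : ∀ j i, X j i ∈ Gr A (e i)) (hX3 : ∀ j i i' i'', X j i * X j i' * X j i'' = 0)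
    {w : κ → A} {d : κ → ℕ} (hw : ∀ k, w k ∈ Gr A (2 * d k + 1)) :
    (∑ j, Submodule.span ℚ (Set.range (X j)) + ∑ k, Submodule.span ℚ {w k}) ^
      (2 * Fintype.card ι + Fintype.card κ + 1) = 0 := by
  have h1 : ∀ j, Commute (Submodule.span ℚ (Set.range (X j))) (Submodule.span ℚ (Set.range (X j)))
    := fun j => Commute.refl _
  have h2 := sum_pow_eq_zero (R := Submodule ℚ A) (κ := ι ⊕ κ) Finset.univ
    (U := Sum.elim (fun j => Submodule.span ℚ (Set.range (X j))) fun k => Submodule.span ℚ {w k})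
    (n := Sum.elim (fun _ => 2) fun _ => 1)
    (by
      rintro (j | k)
      · exact span_pow_three (hX3 j)
      · exact span_pow_two (hw k) (odd_two_mul_add_one _))
    (by
      have hl : ∀ j k, Commute (Submodule.span ℚ (Set.range (X j))) (Submodule.span ℚ {w k}) :=
        fun j k => commute_span_pair fun i => commute_span_homogeneous (hX j i) (hw k)
      rintro (j | k) (j' | k')
      · exact commute_span_pair fun i => (commute_span_pair fun i' =>
          commute_span_homogeneous (hX j' i') (hX j i)).symm
      · exact hl j k'
      · exact (hl j' k).symm
      · exact commute_span_homogeneous (hw k) (hw k'))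
  rw [Fintype.sum_sum_type, Fintype.sum_sum_type] at h2
  simpa [mul_comm] using h2

theorem commute_pairs_lines_top {ι κ : Type} [Fintype ι] [Fintype κ] {X : ι → Fin 2 → A}
    {e : Fin 2 → ℕ} (hX : ∀ j i, X j i ∈ Gr A (e i)) {w : κ → A} {d : κ → ℕ}
    (hw : ∀ k, w k ∈ Gr A (2 * d k + 1)) :
    Commute (∑ j, Submodule.span ℚ (Set.range (X j)) + ∑ k, Submodule.span ℚ {w k})
      (⊤ : Submodule ℚ A) :=
  (Commute.sum_left _ _ _ fun j _ => commute_span_pair fun i =>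
    commute_span_top (hX j i)).add_left
    (Commute.sum_left _ _ _ fun k _ => commute_span_top (hw k))

end Homogeneous

section Upper

variable {A : Type} [GCDGA A] {S : MinimalSullivan A} {A' : Type} [GCDGA A'] {φ : A →ₐ[ℚ] A'}
  {X : Fin 2 → A'} {e : Fin 2 → ℕ} {l : ℕ} {w : Fin l → A'} {d : Fin l → ℕ}

theorem map_lam_eq_zero (hpure : S.Pure) (hX : ∀ i, X i ∈ Gr A' (e i))
    (hX3 : ∀ i j k, X i * X j * X k = 0) (hw : ∀ k, w k ∈ Gr A' (2 * d k + 1))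
    (hφ : ∀ v ∈ S.lam 1, φ v ∈ Submodule.span ℚ (Set.range X) + Submodule.span ℚ (Set.range w))
    {k : ℕ} (hk : l + 2 < k) {a : A} (ha : a ∈ S.lam k) : φ a = 0 := by
  have h := pairs_lines_pow (ι := Unit) (X := fun _ => X) (fun _ => hX) (fun _ => hX3) hw
  rw [Fintype.sum_unique, Fintype.card_unit, Fintype.card_fin] at h
  have h' := pow_eq_zero_of_le (show 2 * 1 + l + 1 ≤ k by omega) h
  rw [MinimalSullivan.lam_eq hpure] at ha
  have h1 : (S.lam 1).map φ.toLinearMap ≤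
      Submodule.span ℚ (Set.range X) + ∑ k, Submodule.span ℚ {w k} := by
    rintro _ ⟨v, hv, rfl⟩
    exact sup_le_sup (a := Submodule.span ℚ (Set.range X)) le_rfl (span_range_le_sum w) (hφ v hv)
  have h2 : (S.lam 1).map φ.toLinearMap ^ k ≤ 0 := (pow_le_pow_left' h1 k).trans h'.le
  rw [← Submodule.map_pow] at h2
  exact h2 (Submodule.mem_map_of_mem ha)

/-- The kernel of the multiplication is generated by the differences of generators. -/
theorem kerMu_le {r : ℕ} (D : TensorData φ (r + 1)) (hpure : S.Pure) :
    D.TP.kerMu ≤ ⊤ * (Submodule.span ℚ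
      {t | ∃ v ∈ S.lam 1, ∃ j, t = D.TP.ι j v - D.TP.ι 0 v}) * ⊤ := by
  set G : Submodule ℚ D.T := Submodule.span ℚ {t | ∃ v ∈ S.lam 1, ∃ j, t = D.TP.ι j v - D.TP.ι 0 v}
  have hl : ∀ a b, b ∈ ⊤ * G * ⊤ → a * b ∈ ⊤ * G * ⊤ := fun a b hb => by
    have : (⊤ : Submodule ℚ D.T) * (⊤ * G * ⊤) ≤ ⊤ * G * ⊤ := by
      rw [← mul_assoc, ← mul_assoc]
      exact mul_le_mul' (mul_le_mul' le_top le_rfl) le_rfl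
    exact this (Submodule.mul_mem_mul trivial hb)
  have hr : ∀ a b, b ∈ ⊤ * G * ⊤ → b * a ∈ ⊤ * G * ⊤ := fun a b hb => by
    have : ⊤ * G * ⊤ * (⊤ : Submodule ℚ D.T) ≤ ⊤ * G * ⊤ := by
      rw [mul_assoc]
      exact mul_le_mul' le_rfl le_top
    exact this (Submodule.mul_mem_mul hb trivial)
  have hG : ∀ g ∈ G, g ∈ ⊤ * G * ⊤ := fun g hg => by
    have := Submodule.mul_mem_mul (Submodule.mul_mem_mul (Submodule.mem_top :
      (1 : D.T) ∈ (⊤ : Submodule ℚ D.T)) hg) (Submodule.mem_top : (1 : D.T) ∈ (⊤ : Submodule ℚ D.T))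
    rwa [one_mul, mul_one] at this
  have hmul : ∀ (f : D.T →ₐ[ℚ] D.T) (a b : D.T), a - f a ∈ ⊤ * G * ⊤ → b - f b ∈ ⊤ * G * ⊤ →
      a * b - f (a * b) ∈ ⊤ * G * ⊤ := fun f a b ha hb => by
    have := add_mem (hr b _ ha) (hl (f a) _ hb)
    rwa [show (a - f a) * b + f a * (b - f b) = a * b - f (a * b) by rw [map_mul]; noncomm_ring]
      at this
  let f : D.T →ₐ[ℚ] D.T := (D.TP.ι 0).comp D.TP.mu
  have hι : ∀ j a, f (D.TP.ι j a) = D.TP.ι 0 a := fun j a => congrArg (D.TP.ι 0) (D.TP.mu_ι j a)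
  have h1 : ∀ j a, D.TP.ι j a - f (D.TP.ι j a) ∈ ⊤ * G * ⊤ := fun j a => by
    have ha : a ∈ Algebra.adjoin ℚ (S.lam 1 : Set A) := by
      rw [MinimalSullivan.adjoin_lam_one hpure]; trivial
    induction ha using Algebra.adjoin_induction with
    | mem v hv =>
      rw [hι]
      exact hG _ (Submodule.subset_span ⟨v, hv, j, rfl⟩)
    | algebraMap c => rw [AlgHom.commutes, AlgHom.commutes, sub_self]; exact zero_mem _
    | add a b _ _ ha hb =>
      rw [map_add, map_add, add_sub_add_comm]; exact add_mem ha hb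
    | mul a b _ _ ha hb => rw [map_mul]; exact hmul f _ _ ha hb
  have h2 : ∀ t, t - f t ∈ ⊤ * G * ⊤ := fun t => by
    have ht : t ∈ Algebra.adjoin ℚ (⋃ j, Set.range (D.TP.ι j)) := by rw [D.gen]; trivial
    induction ht using Algebra.adjoin_induction with
    | mem t ht =>
      obtain ⟨j, a, rfl⟩ := Set.mem_iUnion.1 ht
      exact h1 j a
    | algebraMap c => rw [AlgHom.commutes, sub_self]; exact zero_mem _
    | add a b _ _ ha hb => rw [map_add, add_sub_add_comm]; exact add_mem ha hb
    | mul a b _ _ ha hb => exact hmul f _ _ ha hb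
  intro t ht
  have := h2 t
  rwa [show f t = 0 from (congrArg (D.TP.ι 0) (D.TP.mem_kerMu.1 ht)).trans (map_zero _), sub_zero]
    at this

theorem kerMu_pow_le_ker {r : ℕ} (D : TensorData φ (r + 1)) (hpure : S.Pure)
    (hX : ∀ i, X i ∈ Gr A' (e i)) (hX3 : ∀ i j k, X i * X j * X k = 0)
    (hw : ∀ k, w k ∈ Gr A' (2 * d k + 1))
    (hφ : ∀ v ∈ S.lam 1, φ v ∈ Submodule.span ℚ (Set.range X) + Submodule.span ℚ (Set.range w)) :
    D.TP.kerMu ^ (r * (l + 2) + 2 + 1) ≤ LinearMap.ker D.Φ.toLinearMap := by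
  let U : Submodule ℚ D.T' := ∑ j, Submodule.span ℚ (Set.range fun i => D.ι' j (X i)) +
    ∑ p : Fin r × Fin l, Submodule.span ℚ {D.ι' p.1.succ (w p.2) - D.ι' 0 (w p.2)}
  have hX' : ∀ j i, D.ι' j (X i) ∈ Gr D.T' (e i) := fun j i => (D.ι'_dga j).2 _ _ (hX i)
  have hw' : ∀ p : Fin r × Fin l, D.ι' p.1.succ (w p.2) - D.ι' 0 (w p.2) ∈
      Gr D.T' (2 * d p.2 + 1) := fun p =>
    sub_mem ((D.ι'_dga _).2 _ _ (hw _)) ((D.ι'_dga _).2 _ _ (hw _))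
  have hU : U ^ (r * (l + 2) + 2 + 1) = 0 := by
    have := pairs_lines_pow hX' (fun j i i' i'' => by
      rw [← map_mul, ← map_mul, hX3, map_zero]) hw'
    rw [Fintype.card_prod, Fintype.card_fin, Fintype.card_fin, Fintype.card_fin] at this
    rw [show r * (l + 2) + 2 + 1 = 2 * (r + 1) + r * l + 1 by ring]
    exact this
  have hUt : Commute U ⊤ := commute_pairs_lines_top hX' hw'
  have hXU : ∀ j, ∀ a ∈ Submodule.span ℚ (Set.range X), D.ι' j a ∈ U := fun j => by
    have : Submodule.span ℚ (Set.range X) ≤ U.comap (D.ι' j).toLinearMap := by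
      rw [Submodule.span_le]
      rintro _ ⟨i, rfl⟩
      refine (le_sup_left : _ ≤ U) ?_
      exact le_sum_submodule (fun j => Submodule.span ℚ (Set.range fun i => D.ι' j (X i))) j
        (Submodule.subset_span ⟨i, rfl⟩)
    exact this
  have hwU : ∀ j, ∀ a ∈ Submodule.span ℚ (Set.range w), D.ι' j a - D.ι' 0 a ∈ U := fun j => by
    have : Submodule.span ℚ (Set.range w) ≤
        U.comap ((D.ι' j).toLinearMap - (D.ι' 0).toLinearMap) := by
      rw [Submodule.span_le]
      rintro _ ⟨k, rfl⟩
      change D.ι' j (w k) - D.ι' 0 (w k) ∈ U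
      cases j using Fin.cases with
      | zero => rw [sub_self]; exact zero_mem _
      | succ j =>
        refine (le_sup_right : _ ≤ U) ?_
        exact le_sum_submodule (fun p : Fin r × Fin l =>
          Submodule.span ℚ {D.ι' p.1.succ (w p.2) - D.ι' 0 (w p.2)}) (j, k)
          (Submodule.subset_span rfl)
    exact this
  have hG : (Submodule.span ℚ {t | ∃ v ∈ S.lam 1, ∃ j, t = D.TP.ι j v - D.TP.ι 0 v}).map
      D.Φ.toLinearMap ≤ U := by
    rw [Submodule.map_le_iff_le_comap, Submodule.span_le]
    rintro _ ⟨v, hv, j, rfl⟩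
    obtain ⟨a, ha, b, hb, hab⟩ := Submodule.mem_sup.1 (hφ v hv)
    change D.Φ _ ∈ U
    rw [map_sub, D.Φ_ι, D.Φ_ι, ← hab, map_add, map_add, add_sub_add_comm]
    exact add_mem (sub_mem (hXU _ a ha) (hXU _ a ha)) (hwU _ b hb)
  have hK : D.TP.kerMu.map D.Φ.toLinearMap ≤ U * ⊤ := by
    refine (Submodule.map_mono (kerMu_le (S := S) D hpure)).trans ?_
    rw [Submodule.map_mul, Submodule.map_mul]
    refine (mul_le_mul' (mul_le_mul' le_top hG) le_top).trans ?_
    rw [← hUt.eq, mul_assoc]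
    exact mul_le_mul' le_rfl le_top
  rw [LinearMap.le_ker_iff_map, Submodule.map_pow, ← le_bot_iff]
  refine (pow_le_pow_left' hK _).trans ?_
  rw [hUt.mul_pow, hU, zero_mul]
  exact le_rfl

end Upper

/-! ### Products of families -/

theorem ofFn_prod_mem_pow {A : Type} [Ring A] [Algebra ℚ A] {P : Submodule ℚ A} {n : ℕ}
    {v : Fin n → A} (h : ∀ k, v k ∈ P) : (List.ofFn v).prod ∈ P ^ n := by
  induction n with
  | zero => rw [List.ofFn_zero, List.prod_nil, pow_zero]; exact Submodule.one_le.1 le_rfl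
  | succ n ih =>
    rw [List.ofFn_succ, List.prod_cons, pow_succ']
    exact Submodule.mul_mem_mul (h 0) (ih fun k => h k.succ)

theorem mul_ofFn_sub {A : Type} [Ring A] [Algebra ℚ A] {n : ℕ} {g h : Fin n → A} {P : A}
    (hP : ∀ k a, P * a * g k = 0) :
    P * (List.ofFn fun k => g k - h k).prod = (-1 : ℚ) ^ n • (P * (List.ofFn h).prod) := by
  induction n generalizing P with
  | zero => simp
  | succ n ih =>
    have h0 : P * g 0 = 0 := by rw [← mul_one P]; exact hP 0 1
    rw [List.ofFn_succ, List.prod_cons, List.ofFn_succ (f := h), List.prod_cons, ← mul_assoc,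
      mul_sub, h0, zero_sub, neg_mul, ih fun k a => by rw [mul_assoc P]; exact hP k.succ _]
    simp only [pow_succ, mul_assoc]
    module

theorem map_ofFn_prod {A B F : Type} [Ring A] [Ring B] [FunLike F A B] [MonoidHomClass F A B]
    (f : F) {n : ℕ} (v : Fin n → A) :
    f (List.ofFn v).prod = (List.ofFn fun k => f (v k)).prod := by
  rw [map_list_prod, List.map_ofFn]; rfl

section GCDGA

variable {A : Type} [GCDGA A]

theorem Dd_ofFn_prod {n : ℕ} {v : Fin n → A} (h : ∀ k, Dd A (v k) = 0) :
    Dd A (List.ofFn v).prod = 0 := by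
  induction n with
  | zero => rw [List.ofFn_zero, List.prod_nil, Dd_one]
  | succ n ih =>
    rw [List.ofFn_succ, List.prod_cons, Dd_mul, h, ih fun k => h k.succ, zero_mul, mul_zero,
      add_zero]

theorem Dd_mul_eq_zero {a b : A} (ha : Dd A a = 0) (hb : Dd A b = 0) : Dd A (a * b) = 0 := by
  rw [Dd_mul, ha, hb, zero_mul, mul_zero, add_zero]

theorem ofFn_prod_homogeneous {n : ℕ} {v : Fin n → A} {d : Fin n → ℕ} (h : ∀ k, v k ∈ Gr A (d k)) :
    ∃ N, (List.ofFn v).prod ∈ Gr A N := by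
  induction n with
  | zero => exact ⟨0, one_mem_Gr⟩
  | succ n ih =>
    obtain ⟨N, hN⟩ := ih fun k => h k.succ
    exact ⟨d 0 + N, by rw [List.ofFn_succ, List.prod_cons]; exact mul_mem_Gr (h 0) hN⟩

theorem odd_mul_mul {t : A} {n : ℕ} (ht : t ∈ Gr A n) (hn : Odd n) (a : A) : t * a * t = 0 := by
  rw [odd_comm ht hn, mul_assoc, odd_sq ht hn, mul_zero]

theorem ofFn_prod_mul_mul {n : ℕ} {w : Fin n → A} {d : Fin n → ℕ}
    (hw : ∀ k, w k ∈ Gr A (2 * d k + 1)) (k : Fin n) (a : A) :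
    (List.ofFn w).prod * a * w k = 0 := by
  induction n with
  | zero => exact k.elim0
  | succ n ih =>
    rw [List.ofFn_succ, List.prod_cons]
    cases k using Fin.cases with
    | zero => rw [mul_assoc (w 0)]; exact odd_mul_mul (hw 0) (odd_two_mul_add_one _) _
    | succ k =>
      have := ih (fun k => hw k.succ) k
      rw [mul_assoc (w 0), mul_assoc (w 0), this, mul_zero]

end GCDGA

section Chain

variable {A A' : Type} [GCDGA A] [GCDGA A'] {φ : A →ₐ[ℚ] A'}

theorem TensorPower.sub_mem_kerMu {r : ℕ} {T : Type} [GCDGA T] (TP : TensorPower A r T)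
    (i j : Fin r) (a : A) : TP.ι i a - TP.ι j a ∈ TP.kerMu := by
  rw [TP.mem_kerMu, map_sub, TP.mu_ι, TP.mu_ι, sub_self]

/-- The lower bound for the topological complexity, from two families of zero-divisors. -/
theorem TC_eq_of_chain {r : ℕ} (D : TensorData φ (r + 2)) {m : ℕ}
    (hle : D.TP.kerMu ^ ((r + 1) * m + 2 + 1) ≤ LinearMap.ker D.Φ.toLinearMap)
    {top : A'} (htop : ∀ b, top ≠ Dd A' b)
    {F : D.T} {c : ℚ} (hc : c ≠ 0) (hF : F ∈ D.TP.kerMu ^ (m + 2)) (hFd : Dd D.T F = 0)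
    (hΦF : D.Φ F = c • (D.ι' 0 top * D.ι' 1 top))
    {E : Fin r → D.T} {c' : ℚ} (hc' : c' ≠ 0) (hE : ∀ j, E j ∈ D.TP.kerMu ^ m)
    (hEd : ∀ j, Dd D.T (E j) = 0)
    (hΦE : ∀ j Q, D.ι' 0 top * Q * D.Φ (E j) = c' • (D.ι' 0 top * Q * D.ι' j.succ.succ top)) :
    TC A (r + 2) = (r + 1) * m + 2 := by
  have key : ∀ (n : ℕ) (a b : Fin n → D.T')
      (_ : ∀ j Q, D.ι' 0 top * Q * a j = c' • (D.ι' 0 top * Q * b j)) (Q : D.T'),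
      D.ι' 0 top * Q * (List.ofFn a).prod = c' ^ n • (D.ι' 0 top * Q * (List.ofFn b).prod) := by
    intro n
    induction n with
    | zero => intro a b _ Q; simp
    | succ n ih =>
      intro a b hab Q
      rw [List.ofFn_succ, List.prod_cons, List.ofFn_succ (f := b), List.prod_cons, ← mul_assoc,
        hab 0 Q, smul_mul_assoc, mul_assoc _ Q, ih _ _ (fun j => hab j.succ), smul_smul, pow_succ']
      simp only [mul_assoc]
  refine TC_eq_of D (ω := F * (List.ofFn E).prod) hle ?_ (Dd_mul_eq_zero hFd (Dd_ofFn_prod hEd)) ?_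
  · have h := Submodule.mul_mem_mul hF (ofFn_prod_mem_pow hE)
    rwa [← pow_mul, ← pow_add, show m + 2 + m * r = (r + 1) * m + 2 by ring] at h
  · refine not_exact_of_map D.Φ_dga fun t ht => ?_
    have h1 : D.Φ (F * (List.ofFn E).prod) =
        (c * c' ^ r) • (List.ofFn fun j => D.ι' j top).prod := by
      rw [map_mul, hΦF, map_ofFn_prod, smul_mul_assoc,
        key r _ (fun j => D.ι' j.succ.succ top) hΦE, smul_smul, List.ofFn_succ, List.prod_cons,
        List.ofFn_succ, List.prod_cons, mul_assoc]
      rfl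
    refine D.prod_not_exact htop ((c * c' ^ r)⁻¹ • t) ?_
    rw [map_smul, ← ht, h1, smul_smul, inv_mul_cancel₀ (mul_ne_zero hc (pow_ne_zero r hc')),
      one_smul]

/-- Multiplying a class annihilated by the given elements with their differences. -/
theorem mul_map_ofFn_sub {T : Type} [GCDGA T] {f g : A' →ₐ[ℚ] T} {top : A'} {n : ℕ}
    {v : Fin n → A'} (h : ∀ k a, f top * a * f (v k) = 0) (Q : T) :
    f top * Q * (List.ofFn fun k => f (v k) - g (v k)).prod =
      (-1 : ℚ) ^ n • (f top * Q * g (List.ofFn v).prod) := by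
  rw [map_ofFn_prod]
  exact mul_ofFn_sub fun k a => by rw [mul_assoc (f top)]; exact h k _

end Chain

/-! ### Category and topological complexity: relations of codimension one -/

theorem QForm.exists_square {e : Fin 2 → ℕ} (b : QForm e) : ∃ (s₀ s₁ β : ℚ), β ≠ 0 ∧
    (s₀ • QAlg.x b 0 + s₁ • QAlg.x b 1) * (s₀ • QAlg.x b 0 + s₁ • QAlg.x b 1) = β • QAlg.τ b := by
  have key : ∀ s₀ s₁ : ℚ, (s₀ • QAlg.x b 0 + s₁ • QAlg.x b 1) *
      (s₀ • QAlg.x b 0 + s₁ • QAlg.x b 1) =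
      (s₀ * s₀ * b.b11 + 2 * (s₀ * s₁ * b.b12) + s₁ * s₁ * b.b22) • QAlg.τ b := fun s₀ s₁ => by
    simp only [add_mul, mul_add, smul_mul_smul_comm, mul_comm (QAlg.x b 1) (QAlg.x b 0),
      QAlg.x00, QAlg.x01, QAlg.x11]
    module
  by_cases h1 : b.b11 = 0
  · by_cases h2 : b.b22 = 0
    · exact ⟨1, 1, _, fun h => b.nondeg (by
        linear_combination (-b.b12 / 2) * h + (b.b22 + b.b12 / 2) * h1 +
          (b.b12 / 2) * h2), key 1 1⟩
    · exact ⟨0, 1, _, fun h => h2 (by linear_combination h), key 0 1⟩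
  · exact ⟨1, 0, _, fun h => h1 (by linear_combination h), key 1 0⟩

theorem sub_pow_four {R : Type} [Ring R] {a b : R} (h : a * b = b * a) (ha : a * a * a = 0)
    (hb : b * b * b = 0) :
    (a - b) * (a - b) * ((a - b) * (a - b)) = 6 * (a * a * (b * b)) := by
  have h4 := (Commute.neg_right (h : Commute a b)).add_pow 4
  have ha3 : a ^ 3 = 0 := by rw [pow_succ, pow_two, ha]
  have hb3 : b ^ 3 = 0 := by rw [pow_succ, pow_two, hb]
  have ha4 : a ^ 4 = 0 := by rw [pow_succ, ha3, zero_mul]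
  have hb4 : b ^ 4 = 0 := by rw [pow_succ, hb3, zero_mul]
  have e3 : (-b) ^ 3 = 0 := by rw [neg_pow, hb3, mul_zero]
  have e4 : (-b) ^ 4 = 0 := by rw [neg_pow, hb4, mul_zero]
  simp only [Finset.sum_range_succ, Finset.sum_range_zero, ha3, ha4, e3, e4, zero_mul, mul_zero,
    Nat.sub_zero, Nat.reduceSub, add_zero, zero_add, pow_zero] at h4
  rw [← sub_eq_add_neg, neg_sq] at h4
  have h5 : (a - b) * (a - b) * ((a - b) * (a - b)) = (a - b) ^ 4 := by noncomm_ring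
  rw [h5, h4, pow_two, pow_two, show Nat.choose 4 2 = 6 from rfl]
  push_cast
  exact (Nat.cast_commute 6 _).symm.eq

theorem QAlg.x_mul_mul {e : Fin 2 → ℕ} (b : QForm e) (i j k : Fin 2) :
    QAlg.x b i * QAlg.x b j * QAlg.x b k = 0 := by
  have : ∃ c : ℚ, QAlg.x b i * QAlg.x b j = c • QAlg.τ b := by
    fin_cases i <;> fin_cases j
    · exact ⟨_, QAlg.x00⟩
    · exact ⟨_, QAlg.x01⟩
    · exact ⟨_, (mul_comm _ _).trans QAlg.x01⟩
    · exact ⟨_, QAlg.x11⟩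
  obtain ⟨c, hc⟩ := this
  rw [hc, smul_mul_assoc, mul_comm, QAlg.x_mul_τ, smul_zero]

namespace XBasis

variable {A : Type} [GCDGA A] {S : MinimalSullivan A} {x : Fin 2 → A} {e : Fin 2 → ℕ}
  (h : XBasis S x e)

include h

theorem map_lam_one_mem {A' : Type} [GCDGA A'] {φ : A →ₐ[ℚ] A'} {X : Fin 2 → A'}
    {P : Submodule ℚ A'}
    (hx : ∀ k, φ (x k) = X k) (hV : ∀ v ∈ S.Vodd, φ v ∈ P) {v : A} (hv : v ∈ S.lam 1) :
    φ v ∈ Submodule.span ℚ (Set.range X) + P := by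
  rw [← S.Veven_sup_Vodd, ← h.span] at hv
  obtain ⟨a, ha, b, hb, rfl⟩ := Submodule.mem_sup.1 hv
  rw [map_add]
  refine Submodule.add_mem_sup ?_ (hV b hb)
  have : Submodule.span ℚ (Set.range x) ≤
      (Submodule.span ℚ (Set.range X)).comap φ.toLinearMap := by
    rw [Submodule.span_le]
    rintro _ ⟨k, rfl⟩
    change φ (x k) ∈ Submodule.span ℚ _
    rw [hx]
    exact Submodule.subset_span ⟨k, rfl⟩
  exact this ha

theorem cat_TC_of_form {b : QForm e} (hb : ∀ c, c ∈ h.rel ↔ b.ev c = 0) :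
    cat A S = Module.finrank ℚ S.Vodd ∧
      ∀ r, TC A (r + 2) = (r + 1) * Module.finrank ℚ S.Vodd + 2 := by
  obtain ⟨l, w, d, hw, hdw, hl, A', _, i, φ, hi, hφ, hsa, hx, hV, htop⟩ := h.exists_model_of_form hb
  rw [hl]
  have hφ1 : ∀ v ∈ S.lam 1, φ v ∈ Submodule.span ℚ (Set.range fun k => i (QAlg.x b k)) +
      Submodule.span ℚ (Set.range fun k => φ (w k)) := fun v hv => h.map_lam_one_mem hx hV hv
  have hX : ∀ k, i (QAlg.x b k) ∈ Gr A' (e k) := fun k => hi.2 _ _ (QAlg.x_mem k)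
  have hX3 : ∀ j k k', i (QAlg.x b j) * i (QAlg.x b k) * i (QAlg.x b k') = 0 := fun j k k' => by
    rw [← map_mul, ← map_mul, QAlg.x_mul_mul, map_zero]
  have hw' : ∀ k, φ (w k) ∈ Gr A' (2 * d k + 1) := fun k => hφ.2 _ _ (S.V_le _ (hw k))
  have hwl : ∀ k, w k ∈ S.lam 1 := fun k => by
    rw [S.lam_one]; exact Submodule.mem_iSup_of_mem _ (hw k)
  obtain ⟨s₀, s₁, β, hβ, hα⟩ := b.exists_square
  set α' : QAlg b := s₀ • QAlg.x b 0 + s₁ • QAlg.x b 1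
  let α : A := s₀ • x 0 + s₁ • x 1
  have hφα : φ α = i α' := by simp only [α, α', map_add, map_smul, hx]
  have hαl : α ∈ S.lam 1 := by
    rw [← S.Veven_sup_Vodd]
    exact Submodule.mem_sup_left (add_mem (Submodule.smul_mem _ _ (h.x_mem_Veven 0))
      (Submodule.smul_mem _ _ (h.x_mem_Veven 1)))
  have hdα : Dd A α = 0 := by simp only [α, map_add, map_smul, h.Dd_x, smul_zero, add_zero]
  have hατ : α' * QAlg.τ b = 0 := by
    simp only [α', add_mul, smul_mul_assoc, QAlg.x_mul_τ, smul_zero, add_zero]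
  have hα3 : α' * α' * α' = 0 := by rw [hα, smul_mul_assoc, mul_comm, hατ, smul_zero]
  let v : Fin (l + 2) → A := Fin.cons α (Fin.cons α w)
  have hvl : ∀ k, v k ∈ S.lam 1 := Fin.cases hαl (Fin.cases hαl hwl)
  have hvd : ∀ k, Dd A (v k) = 0 := Fin.cases hdα (Fin.cases hdα hdw)
  set W' := (List.ofFn fun k => φ (w k)).prod with hW'
  set top := i (QAlg.τ b) * W'
  have hvtop : (List.ofFn fun k => φ (v k)).prod = β • top := by
    rw [List.ofFn_succ, List.prod_cons, List.ofFn_succ, List.prod_cons, ← mul_assoc]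
    change φ α * φ α * W' = _
    rw [hφα, ← map_mul, hα, map_smul, smul_mul_assoc]
  refine ⟨cat_eq_of h.pure h.cof hφ hsa (ω := (List.ofFn v).prod)
    (fun k hk a ha => map_lam_eq_zero h.pure hX hX3 hw' hφ1 hk ha)
    (by rw [MinimalSullivan.lam_eq h.pure]; exact ofFn_prod_mem_pow hvl) (Dd_ofFn_prod hvd)
    (not_exact_of_map hφ fun t ht => htop (β⁻¹ • t) ?_), fun r => ?_⟩
  · rw [map_smul, ← ht, map_ofFn_prod, hvtop, smul_smul, inv_mul_cancel₀ hβ, one_smul]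
  obtain ⟨D⟩ := nonempty_tensorData hφ hsa (r + 2)
  have hcent : ∀ j t, D.ι' j (i α') * t = t * D.ι' j (i α') := fun j t => by
    have hk : ∀ k t, D.ι' j (i (QAlg.x b k)) * t = t * D.ι' j (i (QAlg.x b k)) := fun k t =>
      even_comm ((D.ι'_dga j).2 _ _ (hX k)) (h.even k) t
    simp only [α', map_add, map_smul, add_mul, mul_add, smul_mul_assoc, mul_smul_comm, hk]
  have hτc : ∀ j t, D.ι' j (i (QAlg.τ b)) * t = t * D.ι' j (i (QAlg.τ b)) := fun j t =>
    even_comm ((D.ι'_dga j).2 _ _ (hi.2 _ _ QAlg.τ_mem)) b.even_D t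
  have hwj : ∀ j k, D.ι' j (φ (w k)) ∈ Gr D.T' (2 * d k + 1) := fun j k =>
    (D.ι'_dga j).2 _ _ (hw' k)
  have hann : ∀ k a, D.ι' 0 top * a * D.ι' 0 (φ (w k)) = 0 := fun k a => by
    rw [map_mul, hW', map_ofFn_prod, mul_assoc, mul_assoc, ← mul_assoc _ a,
      ofFn_prod_mul_mul (hwj 0), mul_zero]
  have hannα : ∀ a, D.ι' 0 top * a * D.ι' 0 (φ α) = 0 := fun a => by
    rw [hφα, ← hcent, ← mul_assoc, ← map_mul, ← mul_assoc, ← map_mul, hατ]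
    simp
  let B : Fin (r + 2) → D.T := fun j => D.TP.ι 0 α - D.TP.ι j α
  have hBK : ∀ j, B j ∈ D.TP.kerMu := fun j => D.TP.sub_mem_kerMu 0 j α
  have hBd : ∀ j, Dd D.T (B j) = 0 := fun j => by
    simp only [B, map_sub, ← (D.TP.ι_dga _).1, hdα, map_zero, sub_zero]
  have hdv : ∀ j u, Dd A u = 0 → Dd D.T (D.TP.ι 0 u - D.TP.ι j u) = 0 := fun j u hu => by
    rw [map_sub, ← (D.TP.ι_dga _).1, ← (D.TP.ι_dga _).1, hu, map_zero, map_zero, sub_zero]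
  refine TC_eq_of_chain D (m := l + 2) (c := 6 * (β * β) * (-1) ^ l) (c' := (-1) ^ (l + 2) * β)
    (kerMu_pow_le_ker D h.pure hX hX3 hw' hφ1) htop
    (F := B 1 * B 1 * (B 1 * B 1) * D.TP.ι 0 (List.ofFn w).prod *
      (List.ofFn fun k => D.TP.ι 0 (w k) - D.TP.ι 1 (w k)).prod)
    (E := fun j => (List.ofFn fun k => D.TP.ι 0 (v k) - D.TP.ι j.succ.succ (v k)).prod)
    ?_ ?_ ?_ ?_ ?_ ?_ ?_ ?_
  · exact mul_ne_zero (mul_ne_zero (by norm_num) (mul_ne_zero hβ hβ)) (by simp)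
  · have h4 : B 1 * B 1 * (B 1 * B 1) ∈ D.TP.kerMu ^ (3 + 1) := by
      have h2 := Submodule.mul_mem_mul (hBK 1) (hBK 1)
      have := Submodule.mul_mem_mul h2 h2
      rwa [← pow_two, ← pow_two, ← pow_mul] at this
    have := Submodule.mul_mem_mul (D.TP.kerMu_pow_mul 3 (D.TP.ι 0 (List.ofFn w).prod) h4)
      (ofFn_prod_mem_pow fun k => D.TP.sub_mem_kerMu 0 1 (w k))
    rwa [← pow_add, show 3 + 1 + l = l + 2 + 2 by ring] at this
  · refine Dd_mul_eq_zero (Dd_mul_eq_zero ?_ ?_) (Dd_ofFn_prod fun k => hdv _ _ (hdw k))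
    · exact Dd_mul_eq_zero (Dd_mul_eq_zero (hBd 1) (hBd 1)) (Dd_mul_eq_zero (hBd 1) (hBd 1))
    · rw [← (D.TP.ι_dga 0).1, Dd_ofFn_prod hdw, map_zero]
  · have hB : D.Φ (B 1) = D.ι' 0 (i α') - D.ι' 1 (i α') := by
      simp only [B, map_sub, D.Φ_ι, hφα]
    have hW0 : D.Φ (D.TP.ι 0 (List.ofFn w).prod) = D.ι' 0 W' := by rw [D.Φ_ι, map_ofFn_prod φ]
    have hz : D.Φ (List.ofFn fun k => D.TP.ι 0 (w k) - D.TP.ι 1 (w k)).prod =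
        (List.ofFn fun k => D.ι' 0 (φ (w k)) - D.ι' 1 (φ (w k))).prod := by
      rw [map_ofFn_prod]; simp only [map_sub, D.Φ_ι]
    have hsq : ∀ j, D.ι' j (i α') * D.ι' j (i α') = β • D.ι' j (i (QAlg.τ b)) := fun j => by
      rw [← map_mul, ← map_mul, hα, map_smul, map_smul]
    have hcube : ∀ j, D.ι' j (i α') * D.ι' j (i α') * D.ι' j (i α') = 0 := fun j => by
      rw [← map_mul, ← map_mul, ← map_mul, ← map_mul, hα3, map_zero, map_zero]
    rw [map_mul, map_mul, map_mul, map_mul, hB,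
      sub_pow_four (hcent 0 _) (hcube 0) (hcube 1), hW0, hz,
      hsq, hsq]
    have hst := mul_map_ofFn_sub (f := D.ι' 0) (g := D.ι' 1) (top := top) hann
      (D.ι' 1 (i (QAlg.τ b)))
    have e1 : D.ι' 0 (i (QAlg.τ b)) * D.ι' 1 (i (QAlg.τ b)) * D.ι' 0 W' =
        D.ι' 0 top * D.ι' 1 (i (QAlg.τ b)) := by
      rw [mul_assoc, hτc 1, ← mul_assoc, ← map_mul]
    have h6 : ∀ z : D.T', 6 * z = (6 : ℚ) • z := fun z => by
      rw [Algebra.smul_def, map_ofNat]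
    have e2 : (6 : D.T') * (β • D.ι' 0 (i (QAlg.τ b)) * β • D.ι' 1 (i (QAlg.τ b))) * D.ι' 0 W' =
        (6 * (β * β)) • (D.ι' 0 top * D.ι' 1 (i (QAlg.τ b))) := by
      rw [← e1, h6, smul_mul_smul_comm, smul_smul, smul_mul_assoc]
    rw [e2, smul_mul_assoc, hst, smul_smul, ← hW', mul_assoc (D.ι' 0 top), ← map_mul]
  · exact mul_ne_zero (by simp) hβ
  · exact fun j => ofFn_prod_mem_pow fun k => D.TP.sub_mem_kerMu 0 _ (v k)
  · exact fun j => Dd_ofFn_prod fun k => hdv _ _ (hvd k)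
  · intro j Q
    have hst := mul_map_ofFn_sub (f := D.ι' 0) (g := D.ι' j.succ.succ) (top := top)
      (v := fun k => φ (v k)) (Fin.cases hannα (Fin.cases hannα hann)) Q
    rw [map_ofFn_prod]
    simp only [map_sub, D.Φ_ι]
    rw [hst, hvtop, map_smul, mul_smul_comm, smul_smul]

end XBasis

/-! ### Category and topological complexity: all quadratic relations -/

theorem koszul_syzygy {C : Type} [CommRing C] (a₀ a₁ b₀ b₁ : C) :
    (a₁ - b₁) * (a₁ - b₁) * (a₀ * a₀ - b₀ * b₀) + (a₀ - b₀) * (a₀ - b₀) * (a₁ * a₁ - b₁ * b₁) -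
      2 * ((a₀ - b₀) * (a₁ - b₁) * (a₀ * a₁ - b₀ * b₁)) = 0 := by
  ring

theorem smul_sub_mul_smul_sub {C R : Type} [CommRing C] [Ring R] [Algebra C R] {a₀ a₁ b₀ b₁ : C}
    {y y' : R} (h₀ : a₀ * a₀ = 0) (h₁ : a₁ * a₁ = 0) (k₀ : b₀ * b₀ = 0) (k₁ : b₁ * b₁ = 0)
    (hy : y * y = 0) (hy' : y' * y' = 0) (hyy : y' * y = -(y * y')) :
    (a₁ - b₁) • (a₀ • y - b₀ • y') * ((-2 * ((a₀ - b₀) * (a₁ - b₁))) • (y - y')) =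
      (8 * (a₀ * a₁ * (b₀ * b₁))) • (y * y') := by
  have h : (a₀ • y - b₀ • y') * (y - y') = (b₀ - a₀) • (y * y') := by
    simp only [sub_mul, mul_sub, Algebra.smul_mul_assoc, hy, hy', hyy]
    module
  rw [smul_mul_smul_comm, h, smul_smul]
  have : (a₁ - b₁) * (-2 * ((a₀ - b₀) * (a₁ - b₁))) * (b₀ - a₀) = 8 * (a₀ * a₁ * (b₀ * b₁)) := by
    linear_combination (2 * (a₁ - b₁) ^ 2) * h₀ + 2 * (a₁ - b₁) ^ 2 * k₀ - 4 * a₀ * b₀ * (h₁ + k₁)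
  rw [this]

theorem central_syzygy {R : Type} [Ring R] {a₀ a₁ b₀ b₁ : R} (h : ∀ z ∈ [a₀, a₁, b₀, b₁],
    ∀ t, t * z = z * t) :
    (a₁ - b₁) * (a₁ - b₁) * (a₀ * a₀ - b₀ * b₀) + (a₀ - b₀) * (a₀ - b₀) * (a₁ * a₁ - b₁ * b₁) -
      2 * ((a₀ - b₀) * (a₁ - b₁) * (a₀ * a₁ - b₀ * b₁)) = 0 := by
  simp only [List.forall_mem_cons, ← Subring.mem_center_iff] at h
  lift a₀ to Subring.center R using h.1
  lift a₁ to Subring.center R using h.2.1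
  lift b₀ to Subring.center R using h.2.2.1
  lift b₁ to Subring.center R using h.2.2.2.1
  exact congrArg Subtype.val (koszul_syzygy a₀ a₁ b₀ b₁)

theorem central_top {R : Type} [Ring R] {a₀ a₁ b₀ b₁ : R} (h : ∀ z ∈ [a₀, a₁, b₀, b₁],
    ∀ t, t * z = z * t)
    {y y' : R} (h₀ : a₀ * a₀ = 0) (h₁ : a₁ * a₁ = 0) (k₀ : b₀ * b₀ = 0) (k₁ : b₁ * b₁ = 0)
    (hy : y * y = 0) (hy' : y' * y' = 0) (hyy : y' * y = -(y * y')) :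
    (a₁ - b₁) * (a₀ * y - b₀ * y') * (-2 * ((a₀ - b₀) * (a₁ - b₁)) * (y - y')) =
      8 * (a₀ * a₁ * (b₀ * b₁)) * (y * y') := by
  simp only [List.forall_mem_cons, ← Subring.mem_center_iff] at h
  lift a₀ to Subring.center R using h.1
  lift a₁ to Subring.center R using h.2.1
  lift b₀ to Subring.center R using h.2.2.1
  lift b₁ to Subring.center R using h.2.2.2.1
  let _ : Algebra (Subring.center R) R :=
    (Subring.center R).subtype.toAlgebra' fun c r => (Subring.mem_center_iff.1 c.2 r).symm
  have ext {z : Subring.center R} (hz : (z : R) = 0) : z = 0 := Subtype.ext hz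
  exact smul_sub_mul_smul_sub (a₀ := a₀) (a₁ := a₁) (b₀ := b₀) (b₁ := b₁) (ext h₀) (ext h₁)
    (ext k₀) (ext k₁) hy hy' hyy

namespace XBasis

variable {A : Type} [GCDGA A] {S : MinimalSullivan A} {x : Fin 2 → A} {e : Fin 2 → ℕ}
  (h : XBasis S x e)

include h

theorem Dd_x_mul (k : Fin 2) (a : A) : Dd A (x k * a) = x k * Dd A a := by
  rw [Dd_mul, h.Dd_x, zero_mul, zero_add, sgn_of_even (h.mem_Gr k) (h.even k)]

theorem cat_TC_of_top (hb : h.rel = ⊤) :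
    cat A S = Module.finrank ℚ S.Vodd ∧
      ∀ r, TC A (r + 2) = (r + 1) * Module.finrank ℚ S.Vodd + 2 := by
  obtain ⟨y, dy, n, w, d, hy, hw, hdy, hdw0, hdw, hl, A', _, i, φ, hi, hφ, hsa, hx, hφy, hV,
    htop⟩ := h.exists_model_of_top hb
  rw [hl]
  have hX : ∀ k, i (QAlg.x _ k) ∈ Gr A' (e k) := fun k => hi.2 _ _ (QAlg.x_mem k)
  have hX3 : ∀ j k k', i (QAlg.x _ j) * i (QAlg.x _ k) * i (QAlg.x _ k') = 0 := fun j k k' => by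
    rw [← map_mul, ← map_mul, QAlg.x_mul_mul, map_zero]
  have hXX : ∀ k, i (QAlg.x _ k) * i (QAlg.x _ k) = 0 := by
    refine Fin.forall_fin_two.2 ⟨?_, ?_⟩
    · rw [← map_mul, QAlg.x00, show (QForm.hyp e h.even).b11 = 0 from rfl, zero_smul, map_zero]
    · rw [← map_mul, QAlg.x11, show (QForm.hyp e h.even).b22 = 0 from rfl, zero_smul, map_zero]
  have hX01 : i (QAlg.x _ 0) * i (QAlg.x _ 1) = i (QAlg.τ _) := by
    rw [← map_mul, QAlg.x01, show (QForm.hyp e h.even).b12 = 1 from rfl, one_smul]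
  have hτm := hi.2 _ _ (QAlg.τ_mem (b := QForm.hyp e h.even))
  have hτe : Even (QForm.hyp e h.even).D := QForm.even_D _
  have hφ1 : ∀ v ∈ S.lam 1, φ v ∈ Submodule.span ℚ (Set.range fun k => i (QAlg.x _ k)) +
      Submodule.span ℚ (Set.range fun k => φ (w k)) := fun v hv => h.map_lam_one_mem hx hV hv
  have hXτ : ∀ k, i (QAlg.τ _) * i (QAlg.x _ k) = 0 := fun k => by rw [← hX01, hX3]
  set X : Fin 2 → A' := fun k => i (QAlg.x _ k)
  set τ' := i (QAlg.τ _)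
  change ∀ k, X k * X k = 0 at hXX
  change X 0 * X 1 = τ' at hX01
  change ∀ k, τ' * X k = 0 at hXτ
  change ∀ k, φ (x k) = X k at hx
  have hw' : ∀ k, φ (w k) ∈ Gr A' (2 * d k + 1) := fun k => hφ.2 _ _ (S.V_le _ (hw k))
  have hlam : ∀ {v : A} {k : ℕ}, v ∈ S.V k → v ∈ S.lam 1 := fun hv => by
    rw [S.lam_one]; exact Submodule.mem_iSup_of_mem _ hv
  set W' := (List.ofFn fun k => φ (w k)).prod with hW'
  set top := τ' * W' with htop'
  set V' := (List.ofFn fun k : Fin n => φ (w k.succ)).prod with hV'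
  have hWV : W' = φ (w 0) * V' := by rw [hW', List.ofFn_succ, List.prod_cons]
  let z : A := x 0 * w 0 - x 1 * y 0
  have hφz : φ z = X 0 * φ (w 0) := by
    simp only [z, map_sub, map_mul, hx, hφy, mul_zero, sub_zero]
  have hdz : Dd A z = 0 := by
    rw [map_sub, h.Dd_x_mul, h.Dd_x_mul, hdw0, hdy, h.comm 1 (x 0 * x 0), mul_assoc, sub_self]
  have hzl : z ∈ S.lam 1 ^ 2 := by
    rw [pow_two]
    exact sub_mem (Submodule.mul_mem_mul (hlam (h.mem 0)) (hlam (hw 0)))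
      (Submodule.mul_mem_mul (hlam (h.mem 1)) (hlam (hy 0)))
  refine ⟨cat_eq_of h.pure h.cof hφ hsa (ω := x 1 * z * (List.ofFn fun k : Fin n => w k.succ).prod)
    (fun k hk a ha => map_lam_eq_zero h.pure hX hX3 hw' hφ1 hk ha) ?_
    (Dd_mul_eq_zero (Dd_mul_eq_zero (h.Dd_x 1) hdz) (Dd_ofFn_prod hdw))
    (not_exact_of_map hφ fun t ht => htop t ?_), fun r => ?_⟩
  · rw [MinimalSullivan.lam_eq h.pure, show n + 1 + 2 = 1 + 2 + n by ring, pow_add, pow_add,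
      pow_one]
    exact Submodule.mul_mem_mul (Submodule.mul_mem_mul (hlam (h.mem 1)) hzl)
      (ofFn_prod_mem_pow fun k => hlam (hw k.succ))
  · rw [← ht, map_mul, map_mul, map_ofFn_prod φ, hφz, htop', hWV, hx, ← mul_assoc, ← mul_assoc,
      ← hX01, even_comm (hX 0) (h.even 0)]
  obtain ⟨D⟩ := nonempty_tensorData hφ hsa (r + 2)
  have hXc : ∀ j k t, D.ι' j (X k) * t = t * D.ι' j (X k) := fun j k t =>
    even_comm ((D.ι'_dga j).2 _ _ (hX k)) (h.even k) t
  have hτc : ∀ j t, D.ι' j τ' * t = t * D.ι' j τ' := fun j t =>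
    even_comm ((D.ι'_dga j).2 _ _ hτm) hτe t
  have hwj : ∀ j k, D.ι' j (φ (w k)) ∈ Gr D.T' (2 * d k + 1) := fun j k =>
    (D.ι'_dga j).2 _ _ (hw' k)
  have hann : ∀ k a, D.ι' 0 top * a * D.ι' 0 (φ (w k)) = 0 := fun k a => by
    rw [map_mul, hW', map_ofFn_prod (D.ι' 0), mul_assoc, mul_assoc, ← mul_assoc _ a,
      ofFn_prod_mul_mul (hwj 0), mul_zero]
  have hannX : ∀ k a, D.ι' 0 top * a * D.ι' 0 (φ (x k)) = 0 := fun k a => by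
    rw [hx, ← hXc, ← mul_assoc, ← map_mul, ← mul_assoc,
      even_comm (hX k) (h.even k) τ', hXτ, zero_mul, map_zero, zero_mul]
  have hsub : ∀ j u, Dd D.T (D.TP.ι 0 u - D.TP.ι j u) =
      D.TP.ι 0 (Dd A u) - D.TP.ι j (Dd A u) := fun j u => by
    rw [map_sub, ← (D.TP.ι_dga _).1, ← (D.TP.ι_dga _).1]
  have hdv : ∀ j u, Dd A u = 0 → Dd D.T (D.TP.ι 0 u - D.TP.ι j u) = 0 := fun j u hu => by
    rw [hsub, hu, map_zero, map_zero, sub_zero]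
  let t : Fin 2 → Fin (r + 2) → D.T := fun k j => D.TP.ι 0 (x k) - D.TP.ι j (x k)
  have htK : ∀ k j, t k j ∈ D.TP.kerMu := fun k j => D.TP.sub_mem_kerMu 0 j _
  have hιx : ∀ j k, D.TP.ι j (x k) ∈ Gr D.T (e k) := fun j k =>
    (D.TP.ι_dga j).2 _ _ (h.mem_Gr k)
  have htm : ∀ k j, t k j ∈ Gr D.T (e k) := fun k j => sub_mem (hιx _ _) (hιx _ _)
  have htd : ∀ k j, Dd D.T (t k j) = 0 := fun k j => hdv j _ (h.Dd_x k)
  have htD : ∀ k k' j a, Dd D.T (t k j * t k' j * a) = t k j * t k' j * Dd D.T a :=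
    fun k k' j a => by
      rw [Dd_mul, Dd_mul_eq_zero (htd k j) (htd k' j), zero_mul, zero_add,
        sgn_of_even (mul_mem_Gr (htm k j) (htm k' j)) ((h.even k).add (h.even k'))]
  let K : Fin (r + 2) → D.T := fun j =>
    t 1 j * t 1 j * (D.TP.ι 0 (y 0) - D.TP.ι j (y 0)) +
      t 0 j * t 0 j * (D.TP.ι 0 (y 1) - D.TP.ι j (y 1)) -
      2 * (t 0 j * t 1 j * (D.TP.ι 0 (w 0) - D.TP.ι j (w 0)))
  have hKd : ∀ j, Dd D.T (K j) = 0 := fun j => by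
    have h2 : ∀ a, Dd D.T (2 * a) = 2 * Dd D.T a := fun a => by
      rw [two_mul, two_mul, map_add]
    rw [map_sub, map_add, h2, htD, htD, htD, hsub, hsub, hsub, hdy, hdy, hdw0]
    simp only [map_mul]
    refine central_syzygy fun c hc u => ?_
    simp only [List.mem_cons, List.not_mem_nil, or_false] at hc
    rcases hc with rfl | rfl | rfl | rfl <;> exact (even_comm (hιx _ _) (h.even _) u).symm
  have hKK : ∀ j, K j ∈ D.TP.kerMu ^ 3 := fun j => by
    have h3 : ∀ k k' u, t k j * t k' j * (D.TP.ι 0 u - D.TP.ι j u) ∈ D.TP.kerMu ^ 3 :=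
      fun k k' u => by
        rw [pow_succ, pow_two]
        exact Submodule.mul_mem_mul (Submodule.mul_mem_mul (htK k j) (htK k' j))
          (D.TP.sub_mem_kerMu 0 j u)
    refine sub_mem (add_mem (h3 _ _ _) (h3 _ _ _)) ?_
    rw [two_mul]
    exact add_mem (h3 _ _ _) (h3 _ _ _)
  have hΦt : ∀ k j, D.Φ (t k j) = D.ι' 0 (X k) - D.ι' j (X k) := fun k j => by
    simp only [t, map_sub, D.Φ_ι, hx]
  have hΦK : ∀ j, D.Φ (K j) = -2 * ((D.ι' 0 (X 0) - D.ι' j (X 0)) *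
      (D.ι' 0 (X 1) - D.ι' j (X 1))) * (D.ι' 0 (φ (w 0)) - D.ι' j (φ (w 0))) := fun j => by
    simp only [K, map_sub D.Φ, map_add D.Φ, map_mul D.Φ, hΦt, D.Φ_ι, hφy, map_zero, sub_zero,
      mul_zero, add_zero, zero_sub, map_ofNat D.Φ, neg_mul, mul_assoc]
  obtain ⟨N, hN⟩ := ofFn_prod_homogeneous fun k : Fin n => hw' k.succ
  have hε := Gr_comm (hwj 1 0) ((D.ι'_dga 0).2 _ _ hN)
  rw [← hV'] at hε
  set ε : ℚ := (-1) ^ ((2 * d 0 + 1) * N)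
  have hε0 : ε ≠ 0 := by simp [ε]
  refine TC_eq_of_chain D (m := n + 1 + 2) (c := 8 * ε * (-1) ^ n)
    (c' := -2 * (-1) ^ (n + 1 + 2))
    (kerMu_pow_le_ker D h.pure hX hX3 hw' hφ1) htop
    (F := t 1 1 * (D.TP.ι 0 z - D.TP.ι 1 z) * K 1 *
      D.TP.ι 0 (List.ofFn fun k : Fin n => w k.succ).prod *
      (List.ofFn fun k : Fin n => D.TP.ι 0 (w k.succ) - D.TP.ι 1 (w k.succ)).prod)
    (E := fun j => K j.succ.succ * (List.ofFn fun k : Fin n =>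
      D.TP.ι 0 (w k.succ) - D.TP.ι j.succ.succ (w k.succ)).prod)
    ?_ ?_ ?_ ?_ ?_ ?_ ?_ ?_
  · exact mul_ne_zero (mul_ne_zero (by norm_num) hε0) (by simp)
  · have h4 := Submodule.mul_mem_mul (Submodule.mul_mem_mul (htK 1 1)
      (D.TP.sub_mem_kerMu 0 1 z)) (hKK 1)
    rw [← pow_two, ← pow_add] at h4
    have := Submodule.mul_mem_mul (D.TP.kerMu_pow_mul 4
      (D.TP.ι 0 (List.ofFn fun k : Fin n => w k.succ).prod) h4)
      (ofFn_prod_mem_pow fun k : Fin n => D.TP.sub_mem_kerMu 0 1 (w k.succ))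
    rwa [← pow_add, show 4 + 1 + n = n + 1 + 2 + 2 by ring] at this
  · refine Dd_mul_eq_zero (Dd_mul_eq_zero (Dd_mul_eq_zero (Dd_mul_eq_zero (htd 1 1)
      (hdv 1 z hdz)) (hKd 1)) ?_) (Dd_ofFn_prod fun k => hdv _ _ (hdw k))
    rw [← (D.TP.ι_dga 0).1, Dd_ofFn_prod hdw, map_zero]
  · have hΦz : D.Φ (D.TP.ι 0 z - D.TP.ι 1 z) =
        D.ι' 0 (X 0) * D.ι' 0 (φ (w 0)) - D.ι' 1 (X 0) * D.ι' 1 (φ (w 0)) := by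
      rw [map_sub, D.Φ_ι, D.Φ_ι, hφz, map_mul, map_mul]
    have hP : D.Φ (List.ofFn fun k : Fin n => D.TP.ι 0 (w k.succ) - D.TP.ι 1 (w k.succ)).prod =
        (List.ofFn fun k : Fin n => D.ι' 0 (φ (w k.succ)) - D.ι' 1 (φ (w k.succ))).prod := by
      rw [map_ofFn_prod]; simp only [map_sub, D.Φ_ι]
    have hsq : ∀ j k, D.ι' j (X k) * D.ι' j (X k) = 0 := fun j k => by
      rw [← map_mul, hXX, map_zero]
    have hct := central_top (a₀ := D.ι' 0 (X 0)) (a₁ := D.ι' 0 (X 1)) (b₀ := D.ι' 1 (X 0))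
      (b₁ := D.ι' 1 (X 1)) (y := D.ι' 0 (φ (w 0))) (y' := D.ι' 1 (φ (w 0)))
      (fun c hc u => by
        simp only [List.mem_cons, List.not_mem_nil, or_false] at hc
        rcases hc with rfl | rfl | rfl | rfl <;> exact (hXc _ _ u).symm)
      (hsq 0 0) (hsq 0 1) (hsq 1 0) (hsq 1 1) (odd_sq (hwj 0 0) (odd_two_mul_add_one _))
      (odd_sq (hwj 1 0) (odd_two_mul_add_one _))
      (odd_anticomm (hwj 1 0) (odd_two_mul_add_one _) (hwj 0 0) (odd_two_mul_add_one _))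
    rw [← map_mul (D.ι' 0) (X 0) (X 1), ← map_mul (D.ι' 1) (X 0) (X 1), hX01, mul_assoc 8] at hct
    have h8 : ∀ u : D.T', 8 * u = (8 : ℚ) • u := fun u => by rw [Algebra.smul_def, map_ofNat]
    have e1 : D.ι' 0 τ' * D.ι' 1 τ' * (D.ι' 0 (φ (w 0)) * D.ι' 1 (φ (w 0))) * D.ι' 0 V' =
        ε • (D.ι' 0 top * (D.ι' 1 τ' * D.ι' 1 (φ (w 0)))) := by
      rw [mul_assoc, mul_assoc _ _ (D.ι' 0 V'), hε, mul_smul_comm, mul_smul_comm, htop', hWV,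
        map_mul, map_mul, mul_assoc (D.ι' 0 τ'), hτc 1]
      simp only [mul_assoc]
      rw [hτc 1]
    have hst := mul_map_ofFn_sub (f := D.ι' 0) (g := D.ι' 1) (top := top)
      (fun k : Fin n => hann k.succ) (D.ι' 1 τ' * D.ι' 1 (φ (w 0)))
    rw [map_mul, map_mul, map_mul, map_mul, hΦt, hΦz, hΦK, hct, hP, D.Φ_ι, map_ofFn_prod φ, ← hV',
      h8, smul_mul_assoc, smul_mul_assoc, e1, smul_mul_assoc, hst, smul_smul,
      smul_smul, ← hV', mul_assoc (D.ι' 0 top), ← map_mul, ← map_mul, mul_assoc τ', ← hWV,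
      mul_assoc]
  · exact mul_ne_zero (by norm_num) (by simp)
  · intro j
    have := Submodule.mul_mem_mul (hKK j.succ.succ)
      (ofFn_prod_mem_pow fun k : Fin n => D.TP.sub_mem_kerMu 0 j.succ.succ (w k.succ))
    rwa [← pow_add, show 3 + n = n + 1 + 2 by ring] at this
  · exact fun j => Dd_mul_eq_zero (hKd _) (Dd_ofFn_prod fun k => hdv _ _ (hdw k))
  · intro j Q
    have hst := mul_map_ofFn_sub (f := D.ι' 0) (g := D.ι' j.succ.succ) (top := top)
      (v := fun k => φ ((Fin.cons (x 0) (Fin.cons (x 1) w) : Fin (n + 1 + 2) → A) k))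
      (Fin.cases (hannX 0) (Fin.cases (hannX 1) hann)) Q
    have hvt : (List.ofFn fun k =>
        φ ((Fin.cons (x 0) (Fin.cons (x 1) w) : Fin (n + 1 + 2) → A) k)).prod = top := by
      rw [List.ofFn_succ, List.prod_cons, List.ofFn_succ, List.prod_cons, ← mul_assoc]
      change φ (x 0) * φ (x 1) * W' = _
      rw [hx, hx, hX01]
    rw [hvt] at hst
    have hΦE : D.Φ (K j.succ.succ * (List.ofFn fun k : Fin n =>
        D.TP.ι 0 (w k.succ) - D.TP.ι j.succ.succ (w k.succ)).prod) =
        (-2 : ℚ) • (List.ofFn fun k => D.ι' 0 (φ ((Fin.cons (x 0) (Fin.cons (x 1) w) :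
          Fin (n + 1 + 2) → A) k)) - D.ι' j.succ.succ (φ ((Fin.cons (x 0) (Fin.cons (x 1) w) :
          Fin (n + 1 + 2) → A) k))).prod := by
      rw [List.ofFn_succ, List.prod_cons, List.ofFn_succ, List.prod_cons, List.ofFn_succ,
        List.prod_cons, map_mul, map_ofFn_prod D.Φ, hΦK]
      simp only [map_sub, D.Φ_ι, Fin.cons_zero, Fin.cons_succ, hx]
      rw [Algebra.smul_def, map_neg, map_ofNat]
      simp only [mul_assoc]
    rw [hΦE, mul_smul_comm, hst, smul_smul]

end XBasis

/-! ### The extension by odd generators whose boundaries are squares -/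

namespace MinimalSullivan

variable {A : Type} [GCDGA A] (S : MinimalSullivan A)

theorem exists_xBasis (hpure : S.Pure) (hcof : S.Coformal)
    (hfin : FiniteDimensional ℚ (⨆ n, S.V n : Submodule ℚ A))
    (h2 : Module.finrank ℚ S.Veven = 2) : ∃ x e, XBasis S x e := by
  have hle : S.Veven ≤ ⨆ n, S.V n := iSup_le fun n => le_iSup S.V _
  obtain ⟨k, x, d, hx, hli, hspan⟩ := exists_homogeneous_basis (fun n => S.V (2 * n))
    (Submodule.finiteDimensional_of_le hle)
  change _ = S.Veven at hspan
  have hk : k = 2 := by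
    rw [← h2, ← hspan, finrank_span_eq_card hli, Fintype.card_fin]
  subst hk
  exact ⟨x, fun i => 2 * d i, hpure, hcof, S.lam_one ▸ hfin, fun i => even_two_mul _, hx, hli,
    hspan⟩

theorem cat_TC (hpure : S.Pure) (hcof : S.Coformal) (hell : Elliptic A S)
    (h2 : Module.finrank ℚ S.Veven = 2) :
    cat A S = Module.finrank ℚ S.Vodd ∧
      ∀ r, TC A (r + 2) = (r + 1) * Module.finrank ℚ S.Vodd + 2 := by
  obtain ⟨x, e, h⟩ := S.exists_xBasis hpure hcof hell.1 h2
  rcases h.rel_eq hell.2 with ht | ⟨b, hb⟩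
  · exact h.cat_TC_of_top ht
  · exact h.cat_TC_of_form hb

end MinimalSullivan

namespace LExt

variable {A : Type} [GCDGA A] {S : MinimalSullivan A} {x : Fin 2 → A} {e : Fin 2 → ℕ}
  {W : Type} [GCDGA W] (ext : LExt A S x e W)

theorem freeOn (h : XBasis S x e) {ι : Type} {g : ι → A} {deg : ι → ℕ} (hg : FreeOn g deg) :
    FreeOn (Sum.elim (fun i => ext.incl (g i)) ext.u) (Sum.elim deg fun k => 2 * e k - 1) := by
  have hpos : ∀ k, 2 * e k - 1 + 1 = e k + e k := fun k => by
    have := h.e_pos k; omega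
  let c : Fin 2 → OddCocycle A := fun k =>
    { deg := 2 * e k - 1
      odd := ⟨e k - 1, by have := h.e_pos k; omega⟩
      z := x k * x k
      mem := by rw [hpos]; exact mul_mem_Gr (h.mem_Gr k) (h.mem_Gr k)
      closed := Dd_mul_eq_zero (h.Dd_x k) (h.Dd_x k) }
  obtain ⟨E⟩ := exists_kExt 2 (AlgHom.id ℚ A) (isDGAHom_id A) c
  have hE : FreeOn (Sum.elim (fun i => E.i (g i)) E.w) (Sum.elim deg fun k => 2 * e k - 1) :=
    E.freeOn hg
  obtain ⟨f, ⟨hf, hfi, hfu⟩, -⟩ := ext.free E.M E.i E.i_dga E.w E.w_mem fun k => by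
    rw [E.Dd_w, pow_two, ← map_mul]
  obtain ⟨f', hf', hfi', hfw'⟩ := E.lift W ext.incl ext.incl_dga.gr ext.u ext.u_mem
  have hd' : IsDGAHom f' := by
    refine isDGAHom_of_gens hf' (E.gen _ hg.2.1) ?_
    rintro _ (⟨_, ⟨i, rfl⟩, rfl⟩ | ⟨k, rfl⟩)
    · rw [← E.i_dga.1, hfi', hfi', ← ext.incl_dga.1]
    · rw [E.Dd_w, hfi', hfw', ext.hdu, pow_two, ← map_mul]
  have hff : f'.comp f = AlgHom.id ℚ W := by
    obtain ⟨g₀, -, huniq⟩ := ext.free W ext.incl ext.incl_dga ext.u ext.u_mem ext.hdu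
    rw [huniq (f'.comp f) ⟨hd'.comp hf, ?_, fun i => ?_⟩,
      huniq (AlgHom.id ℚ W) ⟨isDGAHom_id W, rfl, fun i => rfl⟩]
    · ext a
      change f' (f (ext.incl a)) = _
      exact (congrArg f' (DFunLike.congr_fun hfi a)).trans (hfi' a)
    · change f' (f (ext.u i)) = _
      rw [hfu, hfw']
  have hff' : ∀ w, f' (f w) = w := fun w => DFunLike.congr_fun hff w
  have hgen : ∀ i, f' (Sum.elim (fun i => E.i (g i)) E.w i) =
      Sum.elim (fun i => ext.incl (g i)) ext.u i := by
    rintro (i | k)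
    exacts [hfi' _, hfw' k]
  refine ⟨fun i => ?_, ?_, fun B _ v hv => ?_⟩
  · rw [← hgen]; exact hf' _ _ (hE.1 i)
  · have := congrArg (Subalgebra.map f') hE.2.1
    rw [Algebra.map_top, (AlgHom.range_eq_top f').2 (fun w => ⟨f w, hff' w⟩),
      AlgHom.map_adjoin, ← Set.range_comp] at this
    rwa [show f' ∘ Sum.elim (fun i => E.i (g i)) E.w = _ from funext hgen] at this
  · obtain ⟨k, hk, hkv⟩ := hE.2.2 B v hv
    refine ⟨k.comp f, fun n a ha => hk _ _ (hf.gr _ _ ha), fun i => ?_⟩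
    rw [← hkv i]
    refine congrArg k ?_
    rcases i with i | j
    · exact DFunLike.congr_fun hfi (g i)
    · exact hfu j

end LExt

namespace LExt

variable {A : Type} [GCDGA A] {S : MinimalSullivan A} {x : Fin 2 → A} {e : Fin 2 → ℕ}
  {W : Type} [GCDGA W] (ext : LExt A S x e W) (h : XBasis S x e)

include h

theorem exists_model {n : ℕ} {v : Fin n → A} {d : Fin n → ℕ} (hv : ∀ k, v k ∈ S.V (2 * d k + 1))
    (hli : LinearIndependent ℚ v) (hspan : Submodule.span ℚ (Set.range v) = S.Vodd)
    {c : Fin n → Fin 3 → ℚ} (hc : ∀ k, Dd A (v k) = quad x (c k)) :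
    ∃ (B : Type) (_ : GCDGA B) (i : QAlg (QForm.hyp e h.even) →ₐ[ℚ] B) (φ : W →ₐ[ℚ] B),
      IsDGAHom i ∧ IsDGAHom φ ∧ SurjAcyc φ ∧ (∀ k, φ (ext.incl (x k)) = i (QAlg.x _ k)) ∧
      (∀ k, φ (ext.u k) = 0) ∧
      ∀ t, i (QAlg.τ _) * (List.ofFn fun k => φ (ext.incl (v k))).prod ≠ Dd B t := by
  obtain ⟨D, hc₁, hc₂, hz₁, hz₂⟩ := Regular.exists_hyp h.even h.e_pos
  obtain ⟨f, hf, hfx, -⟩ := h.exists_toPoly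
  let s : Fin 2 ⊕ (Fin 2 ⊕ Fin n) ≃ (Fin 2 ⊕ Fin n) ⊕ Fin 2 :=
    { toFun := Sum.elim (fun k => Sum.inl (Sum.inl k)) (Sum.elim Sum.inr
        fun k => Sum.inl (Sum.inr k))
      invFun := Sum.elim (Sum.elim Sum.inl fun k => Sum.inr (Sum.inr k))
        fun k => Sum.inr (Sum.inl k)
      left_inv := by rintro (i | i | k) <;> rfl
      right_inv := by rintro ((i | i) | k) <;> rfl }
  refine D.exists_model (x := fun k => ext.incl (x k)) (fun k => ?_) (y := ext.u) ?_ ?_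
    (w := fun k => ext.incl (v k)) (d := fun k => 2 * d k + 1)
    (fun k => odd_two_mul_add_one _) (c := c) (fun k => ?_) (fun k => ?_) ?_
  · rw [← ext.incl_dga.1, h.Dd_x, map_zero]
  · rw [hc₁, ext.hdu]; simp [quad, pow_two]
  · rw [hc₂, ext.hdu]; simp [quad, pow_two]
  · have := hf _ _ (Dd_mem (S.V_le _ (hv k)))
    rwa [hc, map_quad, show f ∘ x = Poly.X e h.even from funext hfx] at this
  · rw [← ext.incl_dga.1, hc, map_quad]; rfl
  · convert (ext.freeOn h (h.freeOn_sum hv hli hspan)).reindex s using 1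
    · funext j
      rcases j with i | i | k <;> rfl
    · funext j
      rcases j with i | i | k
      · rfl
      · fin_cases i
        exacts [hz₁, hz₂]
      · rfl

/-- Every element is the sum of an element of `x`-length zero and an element of the ideal generated
by the `x k`. -/
theorem exists_add (w : W) : ∃ a ∈ ⨆ q, ext.bl 0 q, ∃ b₀ b₁ : W,
    w = a + (b₀ * ext.incl (x 0) + b₁ * ext.incl (x 1)) := by
  obtain ⟨n, v, d, hv, hli, hspan⟩ := exists_homogeneous_basis _ h.finVodd
  have hgen := (ext.freeOn h (h.freeOn_sum hv hli hspan)).2.1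
  have hcomm : ∀ k b, ext.incl (x k) * b = b * ext.incl (x k) := fun k b =>
    even_comm (ext.incl_dga.2 _ _ (h.mem_Gr k)) (h.even k) b
  have hw : w ∈ (⊤ : Subalgebra ℚ W) := trivial
  rw [← hgen] at hw
  induction hw using Algebra.adjoin_induction with
  | mem w hw =>
    rcases hw with ⟨(k | k) | k, rfl⟩
    · refine ⟨0, zero_mem _, ?_⟩
      fin_cases k
      · exact ⟨1, 0, by simp⟩
      · exact ⟨0, 1, by simp⟩
    · exact ⟨_, Submodule.mem_iSup_of_mem 1 (ext.bl_y _ (Submodule.mem_iSup_of_mem (d k) (hv k))),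
        0, 0, by simp⟩
    · exact ⟨_, Submodule.mem_iSup_of_mem 1 (ext.bl_u k), 0, 0, by simp⟩
  | algebraMap q =>
    refine ⟨algebraMap ℚ W q, ?_, 0, 0, by simp⟩
    rw [Algebra.algebraMap_eq_smul_one]
    exact Submodule.smul_mem _ _ (Submodule.mem_iSup_of_mem 0 ext.bl_one)
  | add w w' _ _ hw hw' =>
    obtain ⟨a, ha, b₀, b₁, rfl⟩ := hw
    obtain ⟨a', ha', b₀', b₁', rfl⟩ := hw'
    exact ⟨a + a', add_mem ha ha', b₀ + b₀', b₁ + b₁', by noncomm_ring⟩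
  | mul w w' _ _ hw hw' =>
    obtain ⟨a, ha, b₀, b₁, rfl⟩ := hw
    obtain ⟨a', ha', b₀', b₁', rfl⟩ := hw'
    refine ⟨a * a', ?_, b₀ * a' + (a + (b₀ * ext.incl (x 0) + b₁ * ext.incl (x 1))) * b₀',
      b₁ * a' + (a + (b₀ * ext.incl (x 0) + b₁ * ext.incl (x 1))) * b₁', ?_⟩
    · have : (⨆ q, ext.bl 0 q) * (⨆ q, ext.bl 0 q) ≤ ⨆ q, ext.bl 0 q := by
        simp only [Submodule.iSup_mul, Submodule.mul_iSup]
        refine iSup_le fun q => iSup_le fun q' => Submodule.mul_le.2 fun b hb b' hb' => ?_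
        exact Submodule.mem_iSup_of_mem _ (ext.bl_mul _ _ _ _ _ _ hb hb')
      exact this (Submodule.mul_mem_mul ha ha')
    · have h0 := hcomm 0 a'
      have h1 := hcomm 1 a'
      linear_combination (norm := noncomm_ring) b₀ * h0 + b₁ * h1

omit h in
theorem mul_x_mem (b : W) (k : Fin 2) :
    b * ext.incl (x k) ∈ ⨆ pq ∈ {pq : ℕ × ℕ | pq.1 ≠ 0}, ext.bl pq.1 pq.2 := by
  have hb : b ∈ ⨆ pq : ℕ × ℕ, ext.bl pq.1 pq.2 := by
    rw [ext.bl_internal.submodule_iSup_eq_top]; trivial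
  induction hb using Submodule.iSup_induction' with
  | mem pq b hb =>
    exact Submodule.mem_iSup_of_mem (pq.1 + 1, pq.2) (Submodule.mem_iSup_of_mem
      (Nat.succ_ne_zero _) (ext.bl_mul _ _ _ _ _ _ hb (ext.bl_x k)))
  | zero => rw [zero_mul]; exact zero_mem _
  | add b b' _ _ hb hb' => rw [add_mul]; exact add_mem hb hb'

theorem exists_of_odd {z : W} (hz : z ∈ ⨆ (p : ℕ) (_ : Odd p) (q : ℕ), ext.bl p q) :
    ∃ b₀ b₁ : W, z = b₀ * ext.incl (x 0) + b₁ * ext.incl (x 1) := by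
  obtain ⟨a, ha, b₀, b₁, rfl⟩ := ext.exists_add h z
  have hdisj := ext.bl_internal.submodule_iSupIndep.disjoint_biSup_biSup
    (s := {pq : ℕ × ℕ | pq.1 = 0}) (t := {pq : ℕ × ℕ | pq.1 ≠ 0})
    (Set.disjoint_left.2 fun _ h1 h2 => h2 h1)
  have ha0 : a ∈ ⨆ pq ∈ {pq : ℕ × ℕ | pq.1 = 0}, ext.bl pq.1 pq.2 :=
    (iSup_le fun q => le_iSup₂_of_le (0, q) rfl le_rfl :
      ⨆ q, ext.bl 0 q ≤ ⨆ pq ∈ {pq : ℕ × ℕ | pq.1 = 0}, ext.bl pq.1 pq.2) ha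
  have hz1 := (iSup_le fun p => iSup_le fun hp => iSup_le fun q =>
    le_iSup₂_of_le (p, q) (fun h0 : p = 0 => by subst h0; exact absurd hp (by decide)) le_rfl :
      ⨆ (p : ℕ) (_ : Odd p) (q : ℕ), ext.bl p q ≤
        ⨆ pq ∈ {pq : ℕ × ℕ | pq.1 ≠ 0}, ext.bl pq.1 pq.2) hz
  have ha1 := sub_mem hz1 (add_mem (ext.mul_x_mem b₀ 0) (ext.mul_x_mem b₁ 1))
  rw [add_sub_cancel_right] at ha1
  exact ⟨b₀, b₁, by rw [Submodule.disjoint_def.1 hdisj a ha0 ha1, zero_add]⟩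

theorem le_two_of_witness {i : ℕ} (w : LWitness ext i) : i ≤ 2 := by
  by_contra! hi
  obtain ⟨n, v, d, hv, hli, hspan⟩ := exists_homogeneous_basis _ h.finVodd
  choose c hc using fun k => h.Dd_Vodd (Submodule.mem_iSup_of_mem (d k) (hv k) : v k ∈ S.Vodd)
  obtain ⟨B, _, j, φ, hj, hφ, hsa, hx, -, -⟩ := ext.exists_model h hv hli hspan hc
  have hX : ∀ k b, j (QAlg.x _ k) * b = b * j (QAlg.x _ k) := fun k b =>
    even_comm (hj.2 _ _ (QAlg.x_mem k)) (h.even k) b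
  let P : Submodule ℚ B := LinearMap.range (LinearMap.mulRight ℚ (j (QAlg.x _ 0))) ⊔
    LinearMap.range (LinearMap.mulRight ℚ (j (QAlg.x _ 1)))
  have hP : ∀ l, φ (w.z l) ∈ P := fun l => by
    obtain ⟨b₀, b₁, hb⟩ := ext.exists_of_odd h (w.odd_wl l)
    rw [hb, map_add, map_mul, map_mul, hx, hx]
    exact Submodule.add_mem_sup ⟨_, rfl⟩ ⟨_, rfl⟩
  have h3 : ∀ a ∈ P, ∀ b ∈ P, ∀ c ∈ P, a * b * c = 0 := by
    have key : ∀ (k l m : Fin 2) (a b c : B), a * j (QAlg.x _ k) * (b * j (QAlg.x _ l)) *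
        (c * j (QAlg.x _ m)) = 0 := fun k l m a b c => by
      have : a * j (QAlg.x _ k) * (b * j (QAlg.x _ l)) * (c * j (QAlg.x _ m)) =
          a * b * c * (j (QAlg.x _ k) * j (QAlg.x _ l) * j (QAlg.x _ m)) := by
        simp only [mul_assoc]
        rw [← mul_assoc (j (QAlg.x _ k)) b, hX k b, mul_assoc b,
          ← mul_assoc (j (QAlg.x _ l)) c, hX l c, mul_assoc c,
          ← mul_assoc (j (QAlg.x _ k)) c, hX k c, mul_assoc c]
      rw [this, ← map_mul, ← map_mul, QAlg.x_mul_mul, map_zero, mul_zero]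
    intro a ha b hb c hc
    obtain ⟨_, ⟨a0, rfl⟩, _, ⟨a1, rfl⟩, rfl⟩ := Submodule.mem_sup.1 ha
    obtain ⟨_, ⟨b0, rfl⟩, _, ⟨b1, rfl⟩, rfl⟩ := Submodule.mem_sup.1 hb
    obtain ⟨_, ⟨c0, rfl⟩, _, ⟨c1, rfl⟩, rfl⟩ := Submodule.mem_sup.1 hc
    simp only [LinearMap.mulRight_apply, add_mul, mul_add, key, add_zero]
  obtain ⟨i, rfl⟩ : ∃ i', i = i' + 3 := ⟨i - 3, by omega⟩
  have h0 : φ (List.ofFn w.z).prod = 0 := by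
    rw [map_ofFn_prod, List.ofFn_succ, List.prod_cons, List.ofFn_succ, List.prod_cons,
      List.ofFn_succ, List.prod_cons, ← mul_assoc, ← mul_assoc, h3 _ (hP _) _ (hP _) _ (hP _),
      zero_mul]
  obtain ⟨k, -, hk⟩ := hsa.2 _ h0 (Dd_ofFn_prod w.closed)
  exact w.prod_ne k hk.symm

end LExt

namespace LExt

variable {A : Type} [GCDGA A] {S : MinimalSullivan A} {x : Fin 2 → A} {e : Fin 2 → ℕ}
  {W : Type} [GCDGA W] (ext : LExt A S x e W)

theorem mem_odd {z : W} {q : ℕ} (hz : z ∈ ext.bl 1 q) :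
    z ∈ ⨆ (p : ℕ) (_ : Odd p) (q : ℕ), ext.bl p q :=
  Submodule.mem_iSup_of_mem 1 (Submodule.mem_iSup_of_mem odd_one (Submodule.mem_iSup_of_mem q hz))

theorem nonempty_witness {B : Type} [GCDGA B] {φ : W →ₐ[ℚ] B} (hφ : IsDGAHom φ) {z₀ z₁ ζ : W}
    (h₀ : Dd W z₀ = 0) (h₁ : Dd W z₁ = 0) (hζ : Dd W ζ = 0) {q₀ q₁ : ℕ} (hz₀ : z₀ ∈ ext.bl 1 q₀)
    (hz₁ : z₁ ∈ ext.bl 1 q₁) {top : B} (htop : ∀ t, top ≠ Dd B t) {q : ℚ} (hq : q ≠ 0)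
    (h : φ (z₀ * z₁ * ζ) = q • top) : Nonempty (LWitness ext 2) := by
  refine ⟨⟨![z₀, z₁], fun j => ?_, fun j => ?_, fun t ht => htop (q⁻¹ • φ (t * ζ)) ?_⟩⟩
  · fin_cases j
    exacts [h₀, h₁]
  · fin_cases j
    exacts [ext.mem_odd hz₀, ext.mem_odd hz₁]
  · have ht' : z₀ * z₁ = Dd W t := by
      rw [← ht, List.ofFn_succ, List.ofFn_succ, List.ofFn_zero, List.prod_cons, List.prod_cons,
        List.prod_nil, mul_one]; rfl
    rw [map_smul, ← hφ.1, Dd_mul, hζ, mul_zero, add_zero, ← ht', h, smul_smul, inv_mul_cancel₀ hq,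
      one_smul]

variable (h : XBasis S x e)

include h

theorem Dd_x (k : Fin 2) : Dd W (ext.incl (x k)) = 0 := by
  rw [← ext.incl_dga.1, h.Dd_x, map_zero]

theorem Dd_x_mul (k : Fin 2) (a : W) :
    Dd W (ext.incl (x k) * a) = ext.incl (x k) * Dd W a := by
  rw [Dd_mul, ext.Dd_x h, zero_mul, zero_add,
    sgn_of_even (ext.incl_dga.2 _ _ (h.mem_Gr k)) (h.even k)]

omit h in
theorem Dd_sub_u {v : A} {c : Fin 3 → ℚ} (hc : Dd A v = quad x c) :
    Dd W (ext.incl v - c 0 • ext.u 0 - c 2 • ext.u 1) =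
      c 1 • (ext.incl (x 0) * ext.incl (x 1)) := by
  rw [map_sub, map_sub, map_smul, map_smul, ext.hdu, ext.hdu, ← ext.incl_dga.1, hc]
  simp only [quad, map_add, map_smul, map_mul, pow_two]
  module

theorem two_witness : Nonempty (LWitness ext 2) := by
  obtain ⟨n, v, d, hv, hli, hspan⟩ := exists_homogeneous_basis _ h.finVodd
  choose c hc using fun k => h.Dd_Vodd (Submodule.mem_iSup_of_mem (d k) (hv k) : v k ∈ S.Vodd)
  have hX01 : ∀ {B : Type} [GCDGA B] (j : QAlg (QForm.hyp e h.even) →ₐ[ℚ] B),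
      j (QAlg.x _ 0) * j (QAlg.x _ 1) = j (QAlg.τ _) := fun j => by
    rw [← map_mul, QAlg.x01, show (QForm.hyp e h.even).b12 = 1 from rfl, one_smul]
  by_cases hc1 : ∀ k, c k 1 = 0
  · obtain ⟨B, _, j, φ, hj, hφ, -, hx, hu, htop⟩ := ext.exists_model h hv hli hspan hc
    refine ext.nonempty_witness hφ (ext.Dd_x h 0) (ext.Dd_x h 1) (Dd_ofFn_prod fun k => ?_)
      (ext.bl_x 0) (ext.bl_x 1) htop one_ne_zero
      (ζ := (List.ofFn fun k => ext.incl (v k) - c k 0 • ext.u 0 - c k 2 • ext.u 1).prod) ?_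
    · rw [ext.Dd_sub_u (hc k), hc1, zero_smul]
    · rw [map_mul, map_mul, hx, hx, hX01, map_ofFn_prod, one_smul]
      simp only [map_sub, map_smul, hu, smul_zero, sub_zero]
  push Not at hc1
  obtain ⟨k₀, hk₀⟩ := hc1
  obtain ⟨n, rfl⟩ : ∃ n', n = n' + 1 := ⟨n - 1, by have := k₀.2; omega⟩
  obtain ⟨B, _, j, φ, hj, hφ, -, hx, hu, htop⟩ := ext.exists_model h
    (v := v ∘ Equiv.swap 0 k₀) (d := d ∘ Equiv.swap 0 k₀) (c := c ∘ Equiv.swap 0 k₀)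
    (fun k => hv _) (hli.comp _ (Equiv.injective _))
    (by rw [EquivLike.range_comp]; exact hspan) (fun k => hc _)
  set w := v ∘ Equiv.swap 0 k₀
  set a := c ∘ Equiv.swap 0 k₀
  have ha : a 0 1 ≠ 0 := by
    simpa [a] using hk₀
  have hw : ∀ k, Dd A (w k) = quad x (a k) := fun k => hc _
  have hwd : φ (ext.incl (w 0)) ∈ Gr B (2 * (d (Equiv.swap 0 k₀ 0)) + 1) :=
    hφ.2 _ _ (ext.incl_dga.2 _ _ (S.V_le _ (hv _)))
  let y := fun k => ext.incl (w k) - a k 0 • ext.u 0 - a k 2 • ext.u 1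
  have hy : ∀ k, Dd W (y k) = a k 1 • (ext.incl (x 0) * ext.incl (x 1)) := fun k =>
    ext.Dd_sub_u (hw k)
  have hyφ : ∀ k, φ (y k) = φ (ext.incl (w k)) := fun k => by
    simp only [y, map_sub, map_smul, hu, smul_zero, sub_zero]
  have hybl : y 0 ∈ ext.bl 0 1 :=
    sub_mem (sub_mem (ext.bl_y _ (Submodule.mem_iSup_of_mem _ (hv _)))
      (Submodule.smul_mem _ _ (ext.bl_u 0))) (Submodule.smul_mem _ _ (ext.bl_u 1))
  have hcomm : ext.incl (x 1) * ext.incl (x 0) = ext.incl (x 0) * ext.incl (x 1) :=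
    even_comm (ext.incl_dga.2 _ _ (h.mem_Gr 1)) (h.even 1) _
  refine ext.nonempty_witness hφ (ext.Dd_x h 1)
    (z₁ := ext.incl (x 0) * y 0 - a 0 1 • (ext.incl (x 1) * ext.u 0)) ?_
    (Dd_ofFn_prod (v := fun k : Fin n => (a k.succ 1 / a 0 1) • y 0 - y k.succ) fun k => ?_)
    (ext.bl_x 1) (sub_mem (ext.bl_mul _ _ _ _ _ _ (ext.bl_x 0) hybl)
      (Submodule.smul_mem _ _ (ext.bl_mul _ _ _ _ _ _ (ext.bl_x 1) (ext.bl_u 0)))) htop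
    (pow_ne_zero n (by norm_num : (-1 : ℚ) ≠ 0)) ?_
  · rw [map_sub, map_smul, ext.Dd_x_mul h, ext.Dd_x_mul h, hy, ext.hdu, pow_two, ← mul_assoc,
      hcomm, mul_smul_comm, mul_assoc, hcomm, sub_self]
  · rw [map_sub, map_smul, hy, hy, smul_smul, div_mul_cancel₀ _ ha, sub_self]
  · have h1 : φ (ext.incl (x 1) * (ext.incl (x 0) * y 0 - a 0 1 • (ext.incl (x 1) * ext.u 0))) =
        j (QAlg.τ _) * φ (ext.incl (w 0)) := by
      rw [mul_sub, ← mul_assoc, hcomm, map_sub, mul_smul_comm, map_smul, map_mul φ (_ * _),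
        map_mul, hx, hx, hX01, hyφ, map_mul, map_mul, hu, mul_zero, mul_zero, smul_zero, sub_zero]
    rw [map_mul, h1, map_ofFn_prod]
    simp only [map_sub, map_smul, hyφ]
    rw [mul_ofFn_sub, List.ofFn_succ, List.prod_cons, mul_assoc]
    intro k b
    rw [mul_smul_comm, mul_assoc (j _), mul_assoc (j _),
      odd_mul_mul hwd (odd_two_mul_add_one _), mul_zero, smul_zero]

theorem Lval_eq_two : Lval ext = 2 :=
  IsGreatest.csSup_eq ⟨ext.two_witness h, fun _ ⟨w⟩ => ext.le_two_of_witness h w⟩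

end LExt

/-- For a pure coformal elliptic minimal Sullivan model
`(ΛV,d) = (Λ(x₁,x₂,y₁,…,y_m),d)` with `dim V^even = 2` (and
`m = dim V^odd`): for any (homogeneous) basis `B` of `V^even` one has
`L(ΛV,B) = 2`, and consequently
`TC_r(ΛV) = r·cat(ΛV) + χ_π(ΛV) = (r−1)·m + 2` for every `r ≥ 2`. -/
theorem L_eq_two_of_two_even_generators (A : Type) [GCDGA A]
    (S : MinimalSullivan A)
    (hpure : S.Pure) (hcof : S.Coformal) (hell : Elliptic A S)
    (heven2 : Module.finrank ℚ S.Veven = 2) (m : ℕ)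
    (hodd : Module.finrank ℚ S.Vodd = m) (r : ℕ) (hr : 2 ≤ r) :
    (∀ (x : Fin 2 → A) (e : Fin 2 → ℕ), (∀ i, Even (e i)) →
        (∀ i, x i ∈ S.V (e i)) → LinearIndependent ℚ x →
        Submodule.span ℚ (Set.range x) = S.Veven →
        ∀ (W : Type) [GCDGA W] (ext : LExt A S x e W), Lval ext = 2) ∧
      (TC A r : ℤ) = r * cat A S + S.chiPi ∧
        (TC A r : ℤ) = ((r : ℤ) - 1) * m + 2 := by
  obtain ⟨hcat, hTC⟩ := S.cat_TC hpure hcof hell heven2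
  obtain ⟨r, rfl⟩ : ∃ r', r = r' + 2 := ⟨r - 2, by omega⟩
  refine ⟨fun x e he hx hli hspan W _ ext =>
    ext.Lval_eq_two ⟨hpure, hcof, S.lam_one ▸ hell.1, he, hx, hli, hspan⟩, ?_, ?_⟩
  · rw [hTC, hcat, MinimalSullivan.chiPi, heven2, hodd]
    push_cast
    ring
  · rw [hTC, hodd]
    push_cast
    ring

end RHT
end
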